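/- Every balanced triangulation Δ of the dunce hat satisfies f_0(Δ) ≥ 10. Moreover, if f_0^{sing}(Δ) + m ≥ 7, where m is the number of bichromatic missing edges of Δ and f_0^{sing}(Δ) the number of vertices of the singularity, then f_0(Δ) ≥ 11. -/

import Mathlib

open Finset

variable {V : Type} [DecidableEq V] {W : Type} [DecidableEq W]

/-- An abstract simplicial complex, given by its finite set of (nonempty) faces. -/
def IsCplx (K : Finset (Finset V)) : Prop :=
  ∅ ∉ K ∧ ∀ F ∈ K, ∀ G, G ⊆ F → G ≠ ∅ → G ∈ K

/-- The vertex set of a complex. -/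
def verts (K : Finset (Finset V)) : Finset V := K.sup id

/-- The number of `i`-dimensional faces. -/
def fnum (K : Finset (Finset V)) (i : ℕ) : ℕ := (K.filter fun F => F.card = i + 1).card

/-- The link of a face. -/
def link (K : Finset (Finset V)) (F : Finset V) : Finset (Finset V) :=
  K.filter fun G => Disjoint G F ∧ G ∪ F ∈ K

/-- A complex is pure `d`-dimensional. -/
def PureC (d : ℕ) (K : Finset (Finset V)) : Prop :=
  (∀ F ∈ K, F.card ≤ d + 1) ∧ ∀ F ∈ K, ∃ G ∈ K, F ⊆ G ∧ G.card = d + 1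

/-- A proper `(d+1)`-coloring of the vertices. -/
def ProperColoring (d : ℕ) (K : Finset (Finset V)) (κ : V → Fin (d + 1)) : Prop :=
  ∀ F ∈ K, Set.InjOn κ ↑F

/-- A `d`-dimensional complex is balanced if its graph is `(d+1)`-colorable. -/
def BalancedC (d : ℕ) (K : Finset (Finset V)) : Prop :=
  ∃ κ : V → Fin (d + 1), ProperColoring d K κ

/-- Connectivity of the underlying graph. -/
def Conn (K : Finset (Finset V)) : Prop :=
  ∀ u ∈ verts K, ∀ w ∈ verts K,
    Relation.ReflTransGen (fun a b => ({a, b} : Finset V) ∈ K) u w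

/-- Isomorphism onto. -/
def IsoTo (K : Finset (Finset V)) (L : Finset (Finset W)) : Prop :=
  ∃ f : V → W, Set.InjOn f ↑(verts K) ∧ L = K.image (Finset.image f)

/-- The boundary complex of the `(d+1)`-dimensional cross-polytope. -/
def stdCross (d : ℕ) : Finset (Finset (Fin (d + 1) × Bool)) :=
  (univ : Finset (Fin (d + 1) × Bool)).powerset.filter fun F =>
    F ≠ ∅ ∧ ∀ p ∈ F, ∀ q ∈ F, Prod.fst p = Prod.fst q → p = q

/-- The geometric realization of a simplicial complex. -/
def geomReal [Fintype V] (K : Finset (Finset V)) : Set (V → ℝ) :=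
  {f | (∀ v, 0 ≤ f v) ∧ (∑ v, f v) = 1 ∧ ∃ F ∈ K, {v | f v ≠ 0} = ↑F}

/-- Straight-line path on the edge from vertex `a` to vertex `b` of the triangle. -/
def epath (a b : Fin 3) (t : ℝ) : Fin 3 → ℝ := fun i => if i = a then 1 - t else if i = b then t else 0

/-- Identifications giving the dunce hat (boundary word `a a a⁻¹`). -/
def dhRel (x y : stdSimplex ℝ (Fin 3)) : Prop :=
  ∃ t : ℝ, 0 ≤ t ∧ t ≤ 1 ∧
    ((x.val = epath 0 1 t ∧ y.val = epath 1 2 t) ∨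
     (x.val = epath 0 1 t ∧ y.val = epath 0 2 t))

/-- The dunce hat: quotient of a triangle identifying its edges non-coherently. -/
def DunceHat : Type := Quot dhRel

instance : TopologicalSpace DunceHat := by unfold DunceHat; infer_instance

/-- A 1-dimensional complex is a circle (a triangulation of `S¹`). -/
def IsCircle (L : Finset (Finset V)) : Prop :=
  (∀ F ∈ L, F.card ≤ 2) ∧ (verts L).Nonempty ∧
  (∀ v ∈ verts L, (L.filter fun e => e.card = 2 ∧ v ∈ e).card = 2) ∧ Conn L

open scoped Classical in
/-- The vertices on the singular set: those whose link is not a circle. -/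
noncomputable def singVerts (K : Finset (Finset V)) : Finset V :=
  (verts K).filter fun v => ¬IsCircle (link K ({v} : Finset V))

/-- A triangulation of the dunce hat. -/
def IsDunceHatTri [Fintype V] (K : Finset (Finset V)) : Prop :=
  IsCplx K ∧ Nonempty (geomReal K ≃ₜ DunceHat)




/-! ### Winding numbers -/

/-- `c` has winding number `n` on `[0,1]`. -/
def HasWind (c : ℝ → ℂ) (n : ℤ) : Prop :=
  ∃ L : ℝ → ℂ, Continuous L ∧ (∀ t, Complex.exp (L t) = c t) ∧
    L 1 = L 0 + n * (2 * Real.pi * Complex.I)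

lemma exists_log_plane (g : ℂ → ℂ) (hg : Continuous g) (h0 : ∀ z, g z ≠ 0) :
    ∃ G : ℂ → ℂ, Continuous G ∧ ∀ z, Complex.exp (G z) = g z := by
  obtain ⟨F, ⟨-, hF⟩, -⟩ := Complex.isCoveringMapOn_exp.existsUnique_continuousMap_lifts
    (⟨g, hg⟩ : C(ℂ, ℂ)) (a₀ := 0) (e₀ := Complex.log (g 0)) (Complex.exp_log (h0 0))
    (fun a => h0 a)
  exact ⟨F, F.continuous, fun z => congrFun hF z⟩

lemma exists_log_line (c : ℝ → ℂ) (hc : Continuous c) (h0 : ∀ t, c t ≠ 0) :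
    ∃ L : ℝ → ℂ, Continuous L ∧ ∀ t, Complex.exp (L t) = c t := by
  obtain ⟨G, hG, hG'⟩ := exists_log_plane (fun z => c z.re)
    (hc.comp Complex.continuous_re) (fun z => h0 _)
  exact ⟨fun t => G t, hG.comp Complex.continuous_ofReal, fun t => by simpa using hG' t⟩

lemma const_of_exp_eq {X : Type*} [TopologicalSpace X] [PreconnectedSpace X]
    (L L' : X → ℂ) (hL : Continuous L) (hL' : Continuous L')
    (h : ∀ x, Complex.exp (L x) = Complex.exp (L' x)) (x y : X) :
    L x - L' x = L y - L' y := by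
  have h1 : ∀ x, ∃ n : ℤ, L x - L' x = n * (2 * Real.pi * Complex.I) := by
    intro x
    obtain ⟨n, hn⟩ := Complex.exp_eq_exp_iff_exists_int.1 (h x)
    exact ⟨n, by rw [hn]; ring⟩
  choose n hn using h1
  have hpi : (2 * Real.pi * Complex.I) ≠ 0 := Complex.two_pi_I_ne_zero
  have hc : Continuous (fun x => (n x : ℂ)) := by
    have : (fun x => (n x : ℂ)) = fun x => (L x - L' x) / (2 * Real.pi * Complex.I) := by
      funext x; rw [hn]; field_simp
    rw [this]; fun_prop
  have hc2 : Continuous n := by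
    have h3 : Continuous (fun x => ((n x : ℤ) : ℝ)) := by
      have := Complex.continuous_re.comp hc
      simpa [Function.comp_def] using this
    exact (Int.isClosedEmbedding_coe_real.isEmbedding.continuous_iff).2 h3
  have := PreconnectedSpace.constant (Y := ℤ) ‹_› hc2 (x := x) (y := y)
  rw [hn, hn, this]

lemma HasWind.unique {c : ℝ → ℂ} {n m : ℤ} (h : HasWind c n) (h' : HasWind c m) : n = m := by
  obtain ⟨L, hL, hLe, hL1⟩ := h
  obtain ⟨L', hL', hLe', hL1'⟩ := h'
  have := const_of_exp_eq L L' hL hL' (fun t => by rw [hLe, hLe']) 1 0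
  rw [hL1, hL1'] at this
  have hpi : (2 * Real.pi * Complex.I) ≠ 0 := Complex.two_pi_I_ne_zero
  have h2 : ((n : ℂ) - m) * (2 * Real.pi * Complex.I) = 0 := by linear_combination this
  rcases mul_eq_zero.1 h2 with h3 | h3
  · exact_mod_cast sub_eq_zero.1 h3
  · exact absurd h3 hpi

lemma exists_wind (c : ℝ → ℂ) (hc : Continuous c) (h0 : ∀ t, c t ≠ 0) (h : c 0 = c 1) :
    ∃ n, HasWind c n := by
  obtain ⟨L, hL, hLe⟩ := exists_log_line c hc h0
  have : Complex.exp (L 1) = Complex.exp (L 0) := by rw [hLe, hLe, h]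
  obtain ⟨n, hn⟩ := Complex.exp_eq_exp_iff_exists_int.1 this
  exact ⟨n, L, hL, hLe, hn⟩

lemma hasWind_slit (c : ℝ → ℂ) (hc : Continuous c) (h0 : ∀ t, c t ≠ 0)
    (hre : ∀ t, 0 ≤ (c t).re) (h : c 0 = c 1) : HasWind c 0 := by
  refine ⟨fun t => Complex.log (c t), ?_, fun t => Complex.exp_log (h0 t), by simp [h]⟩
  refine continuous_iff_continuousAt.2 fun t => ?_
  refine ContinuousAt.clog hc.continuousAt ?_
  rcases (hre t).lt_or_eq with h1 | h1
  · exact Or.inl h1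
  · right
    intro h2
    exact h0 t (Complex.ext h1.symm h2)

lemma hasWind_circle (r : ℝ) (hr : 0 < r) :
    HasWind (fun t => r * Complex.exp (2 * Real.pi * t * Complex.I)) 1 := by
  refine ⟨fun t => Real.log r + 2 * Real.pi * t * Complex.I, by fun_prop, fun t => ?_, ?_⟩
  · rw [Complex.exp_add, ← Complex.ofReal_exp, Real.exp_log hr]
  · push_cast; ring

lemma wind_mul (f : ℂ → ℂ) (r : ℝ) (hr : 0 < r)
    (hf : ContinuousOn f (Metric.closedBall 0 r \ {0}))
    (h0 : ∀ z ∈ Metric.closedBall (0 : ℂ) r \ {0}, f z ≠ 0) :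
    ∃ n : ℤ, ∀ z : ℝ → ℂ, (∀ t, z t ≠ 0 ∧ ‖z t‖ ≤ r) → ∀ k, HasWind z k →
      HasWind (fun t => f (z t)) (n * k) := by
  set E : ℂ → ℂ := fun w => Complex.exp ((min w.re (Real.log r) : ℝ) + w.im * Complex.I) with hE
  have hEc : Continuous E := by fun_prop
  have hEm : ∀ w, E w ∈ Metric.closedBall (0 : ℂ) r \ {0} := by
    intro w
    refine ⟨?_, Complex.exp_ne_zero _⟩
    rw [mem_closedBall_zero_iff, hE]
    simp only [Complex.norm_exp]
    simp only [Complex.add_re, Complex.ofReal_re, Complex.mul_re, Complex.I_re, mul_zero,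
      Complex.ofReal_im, Complex.I_im, mul_one, sub_self, add_zero]
    calc Real.exp (min w.re (Real.log r)) ≤ Real.exp (Real.log r) :=
          Real.exp_le_exp.2 (min_le_right _ _)
      _ = r := Real.exp_log hr
  obtain ⟨G, hG, hGe⟩ := exists_log_plane (fun w => f (E w))
    (hf.comp_continuous hEc hEm) (fun w => h0 _ (hEm w))
  have hEp : ∀ w (k : ℤ), E (w + k * (2 * Real.pi * Complex.I)) = E w := by
    intro w k
    simp only [hE]
    rw [Complex.exp_eq_exp_iff_exists_int]
    refine ⟨k, ?_⟩
    simp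
    ring
  have key : ∀ k : ℤ, ∀ w, G (w + k * (2 * Real.pi * Complex.I)) - G w
      = G (0 + k * (2 * Real.pi * Complex.I)) - G 0 := by
    intro k w
    exact const_of_exp_eq (fun w => G (w + k * (2 * Real.pi * Complex.I))) G (by fun_prop) hG
      (fun w => by rw [hGe, hGe, hEp]) w 0
  obtain ⟨n, hn⟩ : ∃ n : ℤ, G (0 + (1 : ℤ) * (2 * Real.pi * Complex.I)) = G 0 +
      n * (2 * Real.pi * Complex.I) := by
    apply Complex.exp_eq_exp_iff_exists_int.1
    rw [hGe, hGe, hEp]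
  have key2 : ∀ k : ℕ, ∀ w, G (w + k * (2 * Real.pi * Complex.I)) = G w +
      (n * k) * (2 * Real.pi * Complex.I) := by
    intro k
    induction k with
    | zero => intro w; simp
    | succ k ih =>
      intro w
      have h1 := key 1 (w + k * (2 * Real.pi * Complex.I))
      rw [hn, ih w] at h1
      have h2 : w + ((k + 1 : ℕ) : ℂ) * (2 * Real.pi * Complex.I) =
        w + k * (2 * Real.pi * Complex.I) + (1 : ℤ) * (2 * Real.pi * Complex.I) := by
        push_cast; ring
      rw [h2]
      push_cast at h1 ⊢
      linear_combination h1
  have key3 : ∀ k : ℤ, ∀ w, G (w + k * (2 * Real.pi * Complex.I)) = G w +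
      (n * k) * (2 * Real.pi * Complex.I) := by
    intro k w
    obtain ⟨m, rfl | rfl⟩ := k.eq_nat_or_neg
    · exact_mod_cast key2 m w
    · have := key2 m (w + ((-(m : ℤ) : ℤ) : ℂ) * (2 * Real.pi * Complex.I))
      have h2 : w + ((-(m : ℤ) : ℤ) : ℂ) * (2 * Real.pi * Complex.I) +
        m * (2 * Real.pi * Complex.I) = w := by push_cast; ring
      rw [h2] at this
      push_cast at this ⊢
      linear_combination -this
  refine ⟨n, fun z hz k hk => ?_⟩
  obtain ⟨L, hL, hLe, hL1⟩ := hk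
  refine ⟨fun t => G (L t), hG.comp hL, fun t => ?_, ?_⟩
  · rw [hGe]
    congr 1
    rw [← hLe t]
    simp only [hE]
    have : (L t).re ≤ Real.log r := by
      rw [Real.le_log_iff_exp_le hr, ← Complex.norm_exp, hLe]
      exact (hz t).2
    rw [min_eq_left this, Complex.re_add_im]
  · simp only
    rw [hL1, key3]
    push_cast
    ring


/-! ### Charts -/

/-- A compact chart `β : B → Y` centred at `p`. -/
structure IsChart {E Y : Type*} [TopologicalSpace E] [Zero E] [TopologicalSpace Y]
    (B : Set E) (β : E → Y) (p : Y) : Prop where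
  compact : IsCompact B
  zero_mem : (0 : E) ∈ B
  cont : ContinuousOn β B
  inj : Set.InjOn β B
  map_zero : β 0 = p
  nhd : β '' B ∈ nhds p

section charts
variable {E Y : Type*} [TopologicalSpace E] [Zero E] [TopologicalSpace Y]
  {B : Set E} {β : E → Y} {p : Y}

lemma IsChart.exists_inv [T2Space Y] (h : IsChart B β p) :
    ∃ ρ : Y → E, (∀ b ∈ B, ρ (β b) = b) ∧ ContinuousOn ρ (β '' B) := by
  have hl : ∀ b ∈ B, Function.invFunOn β B (β b) = b :=
    fun b hb => h.inj.leftInvOn_invFunOn hb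
  refine ⟨Function.invFunOn β B, hl, ?_⟩
  rw [continuousOn_iff_isClosed]
  intro t ht
  refine ⟨β '' (B ∩ t), ?_, ?_⟩
  · exact ((h.compact.inter_right ht).image_of_continuousOn
      (h.cont.mono Set.inter_subset_left)).isClosed
  · ext y
    constructor
    · rintro ⟨hy, b, hb, rfl⟩
      refine ⟨⟨b, ⟨hb, ?_⟩, rfl⟩, b, hb, rfl⟩
      rw [Set.mem_preimage, hl b hb] at hy
      exact hy
    · rintro ⟨⟨b, ⟨hb, hbt⟩, rfl⟩, -⟩
      refine ⟨?_, b, hb, rfl⟩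
      rw [Set.mem_preimage, hl b hb]
      exact hbt

lemma IsChart.small [T2Space Y] (h : IsChart B β p) {U : Set E} (hU : U ∈ nhds (0 : E)) :
    β '' (B ∩ U) ∈ nhds p := by
  obtain ⟨ρ, hρ, hρc⟩ := h.exists_inv
  have hp : ρ p = 0 := by rw [← h.map_zero]; exact hρ 0 h.zero_mem
  have hc : ContinuousAt ρ p := hρc.continuousAt h.nhd
  have h1 : ρ ⁻¹' U ∈ nhds p := hc (by rw [hp]; exact hU)
  filter_upwards [h1, h.nhd] with y hy1 hy2
  obtain ⟨b, hb, rfl⟩ := hy2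
  rw [Set.mem_preimage, hρ b hb] at hy1
  exact ⟨b, ⟨hb, hy1⟩, rfl⟩

lemma IsChart.pull (h : IsChart B β p) {N : Set Y} (hN : N ∈ nhds p) :
    ∃ U ∈ nhds (0 : E), ∀ b ∈ B ∩ U, β b ∈ N := by
  have := h.cont 0 h.zero_mem
  rw [ContinuousWithinAt, h.map_zero] at this
  have h2 := this hN
  rw [Filter.mem_map, mem_nhdsWithin_iff_exists_mem_nhds_inter] at h2
  obtain ⟨U, hU, hUs⟩ := h2
  exact ⟨U, hU, fun b hb => hUs ⟨hb.2, hb.1⟩⟩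

end charts

/-- The book with pages indexed by `ι`. -/
def Book (ι : Type*) : Set ((ι → ℝ) × ℝ) :=
  {b | (∀ i, 0 ≤ b.1 i ∧ b.1 i ≤ 1) ∧ (∀ i j, i ≠ j → b.1 i = 0 ∨ b.1 j = 0) ∧ |b.2| ≤ 1}

lemma Book.isCompact (ι : Type*) : IsCompact (Book ι) := by
  have h1 : IsCompact ((Set.univ.pi fun _ : ι => Set.Icc (0 : ℝ) 1) ×ˢ Set.Icc (-1 : ℝ) 1) :=
    (isCompact_univ_pi fun _ => isCompact_Icc).prod isCompact_Icc
  refine h1.of_isClosed_subset ?_ ?_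
  · have : Book ι = (⋂ i, {b | 0 ≤ b.1 i ∧ b.1 i ≤ 1}) ∩
        (⋂ i, ⋂ j, ⋂ (_ : i ≠ j), {b | b.1 i = 0 ∨ b.1 j = 0}) ∩ {b | |b.2| ≤ 1} := by
      ext b
      simp [Book, and_assoc]
    rw [this]
    refine IsClosed.inter (IsClosed.inter ?_ ?_) ?_
    · refine isClosed_iInter fun i => ?_
      exact isClosed_Icc.preimage (by fun_prop : Continuous fun b : (ι → ℝ) × ℝ => b.1 i)
    · refine isClosed_iInter fun i => isClosed_iInter fun j => isClosed_iInter fun _ => ?_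
      exact (isClosed_eq (by fun_prop) continuous_const).union
        (isClosed_eq (by fun_prop) continuous_const)
    · exact isClosed_le (by fun_prop) continuous_const
  · intro b hb
    refine ⟨fun i _ => hb.1 i, ?_⟩
    exact abs_le.1 hb.2.2

/-- The function on the book given by signs `a`. -/
noncomputable def bookFun {ι : Type*} [Fintype ι] (a : ι → ℝ) (b : (ι → ℝ) × ℝ) : ℂ :=
  ⟨∑ i, a i * b.1 i, b.2⟩

lemma bookFun_cont {ι : Type*} [Fintype ι] (a : ι → ℝ) : Continuous (bookFun a) := by
  have : bookFun a = fun b : (ι → ℝ) × ℝ => ((∑ i, a i * b.1 i : ℝ) : ℂ) + b.2 * Complex.I := by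
    funext b
    apply Complex.ext <;> simp [bookFun]
  rw [this]
  fun_prop

lemma bookFun_ne {ι : Type*} [Fintype ι] [DecidableEq ι] (a : ι → ℝ) (ha : ∀ i, a i ≠ 0)
    (b : (ι → ℝ) × ℝ) (hb : b ∈ Book ι) (h : bookFun a b = 0) : b = 0 := by
  have h1 : ∑ i, a i * b.1 i = 0 := congrArg Complex.re h
  have h2 : b.2 = 0 := congrArg Complex.im h
  refine Prod.ext (funext fun i => ?_) h2
  by_contra hi
  simp only [Prod.fst_zero, Pi.zero_apply] at hi
  rw [Finset.sum_eq_single i] at h1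
  · exact hi ((mul_eq_zero.1 h1).resolve_left (ha i))
  · intro j _ hj
    rcases hb.2.1 i j hj.symm with h3 | h3
    · exact absurd h3 hi
    · simp [h3]
  · simp

/-- Circle in pages `i,j`. -/
noncomputable def bookLoop {ι : Type*} [DecidableEq ι] (i j : ι) (ε : ℝ) (t : ℝ) :
    (ι → ℝ) × ℝ :=
  (fun m => if m = i then ε * max (Real.cos (2 * Real.pi * t)) 0 else
    if m = j then ε * max (-Real.cos (2 * Real.pi * t)) 0 else 0, ε * Real.sin (2 * Real.pi * t))

lemma bookLoop_cont {ι : Type*} [DecidableEq ι] (i j : ι) (ε : ℝ) :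
    Continuous (bookLoop i j ε) := by
  refine Continuous.prodMk (continuous_pi fun m => ?_) (by fun_prop)
  split_ifs <;> fun_prop

lemma bookLoop_mem {ι : Type*} [DecidableEq ι] (i j : ι) (ε : ℝ) (h0 : 0 ≤ ε)
    (h1 : ε ≤ 1) (t : ℝ) : bookLoop i j ε t ∈ Book ι := by
  have hc := Real.cos_le_one (2 * Real.pi * t)
  have hc' := Real.neg_one_le_cos (2 * Real.pi * t)
  have hs := Real.abs_sin_le_one (2 * Real.pi * t)
  have e1 : 0 ≤ max (Real.cos (2 * Real.pi * t)) 0 := le_max_right _ _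
  have e2 : 0 ≤ max (-Real.cos (2 * Real.pi * t)) 0 := le_max_right _ _
  have e3 : max (Real.cos (2 * Real.pi * t)) 0 ≤ 1 := max_le hc (by norm_num)
  have e4 : max (-Real.cos (2 * Real.pi * t)) 0 ≤ 1 := max_le (by linarith) (by norm_num)
  refine ⟨fun m => ?_, fun m n hmn => ?_, ?_⟩
  · simp only [bookLoop]
    split_ifs
    · exact ⟨by positivity, by nlinarith⟩
    · exact ⟨by positivity, by nlinarith⟩
    · simp
  · have : max (Real.cos (2 * Real.pi * t)) 0 = 0 ∨ max (-Real.cos (2 * Real.pi * t)) 0 = 0 := by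
      rcases le_total (Real.cos (2 * Real.pi * t)) 0 with h | h
      · left; exact max_eq_right h
      · right; exact max_eq_right (by linarith)
    simp only [bookLoop]
    rcases this with h | h <;> rw [h] <;> grind
  · simp only [bookLoop]
    rw [abs_mul, abs_of_nonneg h0]
    nlinarith [abs_nonneg (Real.sin (2 * Real.pi * t))]

lemma bookFun_loop {ι : Type*} [Fintype ι] [DecidableEq ι] (a : ι → ℝ) (i j : ι) (hij : i ≠ j)
    (ε t : ℝ) : bookFun a (bookLoop i j ε t) =
      ⟨a i * (ε * max (Real.cos (2 * Real.pi * t)) 0) +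
        a j * (ε * max (-Real.cos (2 * Real.pi * t)) 0), ε * Real.sin (2 * Real.pi * t)⟩ := by
  apply Complex.ext
  · simp only [bookFun, bookLoop]
    rw [Finset.sum_eq_add i j hij]
    · simp [hij.symm]
    · intro c _ hc
      simp [hc.1, hc.2]
    · simp
    · simp
  · simp [bookFun, bookLoop]

lemma bookFun_loop_one {ι : Type*} [Fintype ι] [DecidableEq ι] (a : ι → ℝ) (i j : ι)
    (hij : i ≠ j) (ε : ℝ) (hε : 0 < ε) (h1 : a i = 1) (h2 : a j = -1) :
    HasWind (fun t => bookFun a (bookLoop i j ε t)) 1 := by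
  convert hasWind_circle ε hε using 2 with t
  rw [bookFun_loop a i j hij, h1, h2]
  have : (2 * Real.pi * t * Complex.I : ℂ) = ((2 * Real.pi * t : ℝ) : ℂ) * Complex.I := by
    push_cast; ring
  rw [this, Complex.exp_mul_I, ← Complex.ofReal_cos, ← Complex.ofReal_sin]
  apply Complex.ext
  · simp only [Complex.mul_re, Complex.add_re, Complex.ofReal_re, Complex.ofReal_im,
      Complex.I_re, Complex.I_im, Complex.add_im, Complex.mul_im]
    rcases le_total (Real.cos (2 * Real.pi * t)) 0 with h | h
    · rw [max_eq_right h, max_eq_left (by linarith)]; ring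
    · rw [max_eq_left h, max_eq_right (by linarith)]; ring
  · simp only [Complex.mul_re, Complex.add_re, Complex.ofReal_re, Complex.ofReal_im,
      Complex.I_re, Complex.I_im, Complex.add_im, Complex.mul_im]
    ring

lemma bookLoop_zero_one {ι : Type*} [DecidableEq ι] (i j : ι) (ε : ℝ) :
    bookLoop i j ε 0 = bookLoop i j ε 1 := by
  simp [bookLoop]

lemma bookLoop_ne {ι : Type*} [DecidableEq ι] (i j : ι) (hij : i ≠ j) (ε : ℝ) (hε : 0 < ε)
    (t : ℝ) : bookLoop i j ε t ≠ 0 := by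
  intro h
  have h1 := congrFun (congrArg Prod.fst h) i
  have h2 := congrFun (congrArg Prod.fst h) j
  have h3 := congrArg Prod.snd h
  simp only [bookLoop, if_true, hij.symm, if_false, Prod.fst_zero, Prod.snd_zero,
    Pi.zero_apply, mul_eq_zero, hε.ne', false_or] at h1 h2 h3
  have h4 : Real.cos (2 * Real.pi * t) = 0 := by
    have := le_max_left (Real.cos (2 * Real.pi * t)) 0
    have := le_max_left (-Real.cos (2 * Real.pi * t)) 0
    linarith
  have := Real.sin_sq_add_cos_sq (2 * Real.pi * t)
  rw [h3, h4] at this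
  norm_num at this

lemma bookFun_loop_zero {ι : Type*} [Fintype ι] [DecidableEq ι] (a : ι → ℝ) (i j : ι)
    (hij : i ≠ j) (ε : ℝ) (hε : 0 < ε) (hε1 : ε ≤ 1) (ha : ∀ i, a i ≠ 0)
    (h1 : a i = 1) (h2 : a j = 1) :
    HasWind (fun t => bookFun a (bookLoop i j ε t)) 0 := by
  refine hasWind_slit _ ((bookFun_cont a).comp (bookLoop_cont i j ε)) (fun t h => ?_)
    (fun t => ?_) (by rw [bookLoop_zero_one])
  · exact bookLoop_ne i j hij ε hε t
      (bookFun_ne a ha _ (bookLoop_mem i j ε hε.le hε1 t) h)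
  · rw [bookFun_loop a i j hij, h1, h2]
    simp only
    positivity

lemma bookLoop_small {ι : Type*} [Finite ι] [DecidableEq ι]
    {U : Set ((ι → ℝ) × ℝ)} (hU : U ∈ nhds 0) :
    ∃ ε, 0 < ε ∧ ε ≤ 1 ∧ ∀ i j t, bookLoop i j ε t ∈ U := by
  cases nonempty_fintype ι
  obtain ⟨δ, hδ, hδU⟩ := Metric.mem_nhds_iff.1 hU
  refine ⟨min (δ / 2) 1, by positivity, min_le_right _ _, fun i j t => hδU ?_⟩
  have hb := bookLoop_mem i j 1 (by norm_num) le_rfl t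
  have hb2 : bookLoop i j (min (δ / 2) 1) t = (min (δ / 2) 1) • bookLoop i j 1 t := by
    refine Prod.ext (funext fun m => ?_) ?_
    · simp only [bookLoop, Prod.smul_mk, Pi.smul_apply, smul_eq_mul]
      split_ifs <;> simp
    · simp [bookLoop]
  rw [mem_ball_zero_iff, hb2, norm_smul]
  have h1 : ‖bookLoop i j 1 t‖ ≤ 1 := by
    rw [Prod.norm_def]
    refine max_le ?_ hb.2.2
    rw [pi_norm_le_iff_of_nonneg (by norm_num)]
    intro m
    rw [Real.norm_eq_abs, abs_of_nonneg (hb.1 m).1]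
    exact (hb.1 m).2
  have h2 : ‖min (δ / 2) 1‖ ≤ δ / 2 := by
    rw [Real.norm_eq_abs, abs_of_nonneg (by positivity)]
    exact min_le_left _ _
  nlinarith [norm_nonneg (bookLoop i j 1 t), norm_nonneg (min (δ/2) 1)]


lemma zero_mem_book (ι : Type*) : (0 : (ι → ℝ) × ℝ) ∈ Book ι := by
  refine ⟨fun i => by simp, fun i j _ => by simp, by simp⟩

lemma disc_small {U : Set ℂ} (hU : U ∈ nhds (0 : ℂ)) :
    ∃ r, 0 < r ∧ r ≤ 1 ∧ Metric.closedBall (0 : ℂ) r ⊆ Metric.closedBall 0 1 ∩ U := by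
  obtain ⟨δ, hδ, hδU⟩ := Metric.nhds_basis_closedBall.mem_iff.1 hU
  refine ⟨min δ 1, by positivity, min_le_right _ _, fun z hz => ⟨?_, hδU ?_⟩⟩
  · exact Metric.closedBall_subset_closedBall (min_le_right _ _) hz
  · exact Metric.closedBall_subset_closedBall (min_le_left _ _) hz

/-- A point with a disc chart cannot have a chart by a book with at least 3 pages. -/
lemma book_disc_three {ι Y : Type*} [Finite ι] [TopologicalSpace Y] [T2Space Y]
    {β : (ι → ℝ) × ℝ → Y} {γ : ℂ → Y} {p : Y} (hβ : IsChart (Book ι) β p)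
    (hγ : IsChart (Metric.closedBall (0 : ℂ) 1) γ p) (i j l : ι) (hij : i ≠ j) (hil : i ≠ l)
    (hjl : j ≠ l) : False := by
  classical
  cases nonempty_fintype ι
  obtain ⟨ρ, hρ, hρc⟩ := hβ.exists_inv
  obtain ⟨τ, hτ, hτc⟩ := hγ.exists_inv
  obtain ⟨U, hU, hUβ⟩ := hγ.pull hβ.nhd
  obtain ⟨r, hr, hr1, hrU⟩ := disc_small hU
  have hN : γ '' (Metric.closedBall (0 : ℂ) 1 ∩ Metric.closedBall (0 : ℂ) r) ∈ nhds p :=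
    hγ.small (Metric.closedBall_mem_nhds _ hr)
  obtain ⟨U', hU', hUγ⟩ := hβ.pull hN
  obtain ⟨ε, hε, hε1, hεU⟩ := bookLoop_small (ι := ι) hU'
  -- complex functions
  have hf : ∀ a : ι → ℝ, (∀ i, a i ≠ 0) → ∃ n : ℤ, ∀ z : ℝ → ℂ, (∀ t, z t ≠ 0 ∧ ‖z t‖ ≤ r) →
      ∀ k, HasWind z k → HasWind (fun t => bookFun a (ρ (γ (z t)))) (n * k) := by
    intro a ha
    refine wind_mul (fun z => bookFun a (ρ (γ z))) r hr ?_ ?_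
    · refine (bookFun_cont a).comp_continuousOn ?_
      refine hρc.comp (hγ.cont.mono ?_) ?_
      · exact fun z hz => (hrU hz.1).1
      · exact fun z hz => hUβ _ (hrU hz.1)
    · intro z hz h
      obtain ⟨b, hb, hbz⟩ := hUβ _ (hrU hz.1)
      rw [← hbz, hρ b hb] at h
      have hb0 := bookFun_ne a ha b hb h
      rw [hb0, hβ.map_zero, ← hγ.map_zero] at hbz
      exact hz.2 (hγ.inj hγ.zero_mem (hrU hz.1).1 hbz).symm
  -- loops
  have hz : ∀ i j : ι, i ≠ j → ∃ z : ℝ → ℂ, (∀ t, z t ≠ 0 ∧ ‖z t‖ ≤ r) ∧ (∃ k, HasWind z k) ∧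
      ∀ t, ρ (γ (z t)) = bookLoop i j ε t := by
    intro i j hij
    have hm := bookLoop_mem i j ε hε.le hε1
    have h1 : ∀ t, ∃ w ∈ Metric.closedBall (0 : ℂ) 1 ∩ Metric.closedBall (0 : ℂ) r,
        γ w = β (bookLoop i j ε t) := fun t => hUγ _ ⟨hm t, hεU i j t⟩
    have h2 : ∀ t, τ (β (bookLoop i j ε t)) ∈ Metric.closedBall (0 : ℂ) r ∧
        γ (τ (β (bookLoop i j ε t))) = β (bookLoop i j ε t) := by
      intro t
      obtain ⟨w, hw, hwe⟩ := h1 t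
      rw [← hwe, hτ w hw.1]
      exact ⟨hw.2, rfl⟩
    have h3 : ∀ t, τ (β (bookLoop i j ε t)) ≠ 0 := by
      intro t h
      have h4 := (h2 t).2
      rw [h, hγ.map_zero, ← hβ.map_zero] at h4
      exact bookLoop_ne i j hij ε hε t (hβ.inj hβ.zero_mem (hm t) h4).symm
    refine ⟨fun t => τ (β (bookLoop i j ε t)), fun t => ⟨h3 t, by simpa using (h2 t).1⟩, ?_, ?_⟩
    · refine exists_wind _ ?_ h3 (by rw [bookLoop_zero_one])
      refine hτc.comp_continuous (hβ.cont.comp_continuous (bookLoop_cont i j ε) hm) ?_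
      intro t
      obtain ⟨w, hw, hwe⟩ := h1 t
      exact ⟨w, hw.1, hwe⟩
    · intro t
      rw [(h2 t).2, hρ _ (hm t)]
  set a1 : ι → ℝ := fun m => if m = i then 1 else -1 with ha1
  set a2 : ι → ℝ := fun m => if m = j then -1 else 1 with ha2
  have ha1' : ∀ m, a1 m ≠ 0 := by intro m; simp only [ha1]; split_ifs <;> norm_num
  have ha2' : ∀ m, a2 m ≠ 0 := by intro m; simp only [ha2]; split_ifs <;> norm_num
  obtain ⟨n1, hn1⟩ := hf a1 ha1'
  obtain ⟨n2, hn2⟩ := hf a2 ha2'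
  obtain ⟨z, hz1, ⟨k, hk⟩, hz2⟩ := hz i j hij
  obtain ⟨z', hz1', ⟨k', hk'⟩, hz2'⟩ := hz i l hil
  have e1 := hn1 z hz1 k hk
  have e2 := hn2 z hz1 k hk
  have e3 := hn1 z' hz1' k' hk'
  have e4 := hn2 z' hz1' k' hk'
  simp only [hz2, hz2'] at e1 e2 e3 e4
  have f1 := e1.unique (bookFun_loop_one a1 i j hij ε hε (by simp [ha1]) (by simp [ha1, hij.symm]))
  have f2 := e2.unique (bookFun_loop_one a2 i j hij ε hε (by simp [ha2, hij]) (by simp [ha2]))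
  have f3 := e3.unique (bookFun_loop_one a1 i l hil ε hε (by simp [ha1]) (by simp [ha1, hil.symm]))
  have f4 := e4.unique (bookFun_loop_zero a2 i l hil ε hε hε1 ha2' (by simp [ha2, hij])
    (by simp [ha2, hjl.symm]))
  rcases mul_eq_zero.1 f4 with h | h
  · rw [h] at f2; simp at f2
  · rw [h] at f3; simp at f3

lemma fold_contra {ι Y : Type*} [TopologicalSpace Y] [T2Space Y]
    {β : (ι → ℝ) × ℝ → Y} {γ : ℂ → Y} {p : Y} (hβ : IsChart (Book ι) β p)
    (hγ : IsChart (Metric.closedBall (0 : ℂ) 1) γ p)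
    (φ : ℂ → (ι → ℝ) × ℝ) (hφ : Continuous φ) (hφ0 : φ 0 = 0)
    (hφB : ∀ z, ‖z‖ ≤ 1 → φ z ∈ Book ι) (hφi : ∀ z, φ z = 0 → z = 0) :
    ∃ s : ℝ, 0 < s ∧ ∀ z : ℝ → ℂ, Continuous z → (∀ t, z t ≠ 0 ∧ ‖z t‖ ≤ s ∧ 0 ≤ (z t).re) →
      z 0 = z 1 → ∀ r : ℝ, 0 < r → r ≤ 1 →
      (∀ t, β (φ (z t)) = γ (r * Complex.exp (2 * Real.pi * t * Complex.I))) → False := by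
  obtain ⟨τ, hτ, hτc⟩ := hγ.exists_inv
  obtain ⟨U, hU, hUγ⟩ := hβ.pull hγ.nhd
  have hU' : φ ⁻¹' U ∈ nhds (0 : ℂ) := hφ.continuousAt (by rw [hφ0]; exact hU)
  obtain ⟨s, hs, hs1, hsU⟩ := disc_small hU'
  have hB : ∀ z ∈ Metric.closedBall (0 : ℂ) s, φ z ∈ Book ι := fun z hz =>
    hφB z (by simpa using (hsU hz).1)
  obtain ⟨n, hn⟩ := wind_mul (fun z => τ (β (φ z))) s hs
    (hτc.comp (hβ.cont.comp hφ.continuousOn (fun z hz => hB z hz.1))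
      (fun z hz => hUγ _ ⟨hB z hz.1, (hsU hz.1).2⟩))
    (by
      intro z hz h
      obtain ⟨w, hw, hwe⟩ := hUγ _ ⟨hB z hz.1, (hsU hz.1).2⟩
      rw [← hwe, hτ w hw] at h
      rw [h, hγ.map_zero, ← hβ.map_zero] at hwe
      exact hz.2 (hφi z (hβ.inj hβ.zero_mem (hB z hz.1) hwe).symm))
  refine ⟨s, hs, fun z hzc hz hz01 r hr hr1 h => ?_⟩
  have hw0 := hasWind_slit z hzc (fun t => (hz t).1) (fun t => (hz t).2.2) hz01
  have h1 := hn z (fun t => ⟨(hz t).1, (hz t).2.1⟩) 0 hw0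
  have h2 : (fun t => τ (β (φ (z t)))) =
      fun t : ℝ => (r : ℂ) * Complex.exp (2 * Real.pi * t * Complex.I) := by
    funext t
    rw [h t]
    apply hτ
    rw [mem_closedBall_zero_iff, norm_mul]
    have : (2 * Real.pi * t * Complex.I : ℂ) = ((2 * Real.pi * t : ℝ) : ℂ) * Complex.I := by
      push_cast; ring
    rw [this, Complex.norm_exp_ofReal_mul_I, Complex.norm_real, Real.norm_eq_abs, abs_of_pos hr]
    simpa using hr1
  rw [h2] at h1
  have := h1.unique (hasWind_circle r hr)
  simp at this

lemma book_disc_le_one {ι Y : Type*} [Subsingleton ι] [TopologicalSpace Y] [T2Space Y]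
    {β : (ι → ℝ) × ℝ → Y} {γ : ℂ → Y} {p : Y} (hβ : IsChart (Book ι) β p)
    (hγ : IsChart (Metric.closedBall (0 : ℂ) 1) γ p) : False := by
  classical
  obtain ⟨ρ, hρ, hρc⟩ := hβ.exists_inv
  -- the loop in the book
  have loop : ∀ U ∈ nhds (0 : (ι → ℝ) × ℝ), ∃ r : ℝ, 0 < r ∧ r ≤ 1 ∧ ∃ b : ℝ → (ι → ℝ) × ℝ,
      Continuous b ∧ (∀ t, b t ∈ Book ι ∩ U ∧ b t ≠ 0) ∧ b 0 = b 1 ∧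
      ∀ t, β (b t) = γ (r * Complex.exp (2 * Real.pi * t * Complex.I)) := by
    intro U hU
    obtain ⟨U', hU', hUβ⟩ := hγ.pull (hβ.small hU)
    obtain ⟨r, hr, hr1, hrU⟩ := disc_small hU'
    have hm : ∀ t : ℝ, (r * Complex.exp (2 * Real.pi * t * Complex.I) : ℂ) ∈
        Metric.closedBall (0 : ℂ) r := by
      intro t
      rw [mem_closedBall_zero_iff, norm_mul]
      have : (2 * Real.pi * t * Complex.I : ℂ) = ((2 * Real.pi * t : ℝ) : ℂ) * Complex.I := by
        push_cast; ring
      rw [this, Complex.norm_exp_ofReal_mul_I, Complex.norm_real, Real.norm_eq_abs, abs_of_pos hr]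
      simp
    have hex : ∀ t : ℝ, ∃ b ∈ Book ι ∩ U, β b = γ (r * Complex.exp (2 * Real.pi * t * Complex.I)) :=
      fun t => hUβ _ (hrU (hm t))
    choose b hb hbe using hex
    have hbb : b = fun t : ℝ => ρ (γ (r * Complex.exp (2 * Real.pi * t * Complex.I))) := by
      funext t
      rw [← hbe, hρ _ (hb t).1]
    refine ⟨r, hr, hr1, b, ?_, fun t => ⟨hb t, fun h => ?_⟩, ?_, hbe⟩
    · rw [hbb]
      refine hρc.comp_continuous (hγ.cont.comp_continuous (by fun_prop) fun t => (hrU (hm t)).1) ?_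
      intro t
      exact ⟨b t, (hb t).1, hbe t⟩
    · have h1 := hbe t
      rw [h, hβ.map_zero, ← hγ.map_zero] at h1
      have h2 := hγ.inj hγ.zero_mem (hrU (hm t)).1 h1
      have h3 : (r : ℂ) ≠ 0 := by exact_mod_cast hr.ne'
      exact mul_ne_zero h3 (Complex.exp_ne_zero _) h2.symm
    · rw [hbb]
      simp [Complex.exp_two_pi_mul_I]
  rcases isEmpty_or_nonempty ι with he | ⟨⟨i⟩⟩
  · have hbook : ∀ c : ℝ, |c| ≤ 1 → ((fun i : ι => (0 : ℝ)), c) ∈ Book ι := fun c hc =>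
      ⟨fun i => he.elim i, fun i => he.elim i, hc⟩
    have hsg : ∀ σ : ℝ, |σ| = 1 → ∃ s : ℝ, 0 < s ∧ ∀ z : ℝ → ℂ, Continuous z →
      (∀ t, z t ≠ 0 ∧ ‖z t‖ ≤ s ∧ 0 ≤ (z t).re) →
      z 0 = z 1 → ∀ r : ℝ, 0 < r → r ≤ 1 →
      (∀ t, β (fun _ => 0, σ * ‖z t‖) = γ (r * Complex.exp (2 * Real.pi * t * Complex.I))) →
        False := by
      intro σ hσ
      refine fold_contra hβ hγ (fun z => (fun _ => 0, σ * ‖z‖)) (by fun_prop) ?_ ?_ ?_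
      · refine Prod.ext rfl (by simp)
      · intro z hz
        apply hbook
        rw [abs_mul, hσ]; simpa using hz
      · intro z hz
        have := congrArg Prod.snd hz
        simp only [Prod.snd_zero, mul_eq_zero, norm_eq_zero] at this
        rcases this with h | h
        · rw [h] at hσ; simp at hσ
        · exact h
    obtain ⟨s1, hs1, H1⟩ := hsg 1 (by simp)
    obtain ⟨s2, hs2, H2⟩ := hsg (-1) (by simp)
    obtain ⟨r, hr, hr1, b, hbc, hb, hb01, hbe⟩ := loop {b | |b.2| < min s1 s2} (by
      refine IsOpen.mem_nhds (isOpen_lt (by fun_prop) continuous_const) ?_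
      simp [hs1, hs2])
    have hb0 : ∀ t, (b t).2 ≠ 0 := fun t h => (hb t).2 (Prod.ext (funext fun i => he.elim i) h)
    have hb2 : ∀ t, b t = (fun _ => 0, (b t).2) := fun t => Prod.ext (funext fun i => he.elim i) rfl
    have hsign : (∀ t, 0 < (b t).2) ∨ (∀ t, (b t).2 < 0) := by
      have hy : Continuous fun t => (b t).2 := by fun_prop
      by_contra! hcon
      obtain ⟨⟨t1, h1⟩, ⟨t2, h2⟩⟩ := hcon
      obtain ⟨t, ht⟩ := mem_range_of_exists_le_of_exists_ge hy ⟨t1, h1⟩ ⟨t2, h2⟩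
      exact hb0 t ht
    have hlt : ∀ t, |(b t).2| < min s1 s2 := fun t => (hb t).1.2
    have hzz : ∀ t, (((|(b t).2| : ℝ) : ℂ) ≠ 0 ∧ ‖((|(b t).2| : ℝ) : ℂ)‖ ≤ min s1 s2 ∧
        0 ≤ ((|(b t).2| : ℝ) : ℂ).re) := by
      intro t
      refine ⟨by exact_mod_cast (abs_pos.2 (hb0 t)).ne', ?_, by simp⟩
      rw [Complex.norm_real, Real.norm_eq_abs, abs_abs]
      exact (hlt t).le
    rcases hsign with hp | hp
    · refine H1 (fun t => ((|(b t).2| : ℝ) : ℂ)) (by fun_prop) (fun t => ⟨(hzz t).1,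
        (hzz t).2.1.trans (min_le_left _ _), (hzz t).2.2⟩) (by rw [hb01]) r hr hr1 (fun t => ?_)
      rw [← hbe t, hb2 t]
      simp [abs_of_pos (hp t)]
    · refine H2 (fun t => ((|(b t).2| : ℝ) : ℂ)) (by fun_prop) (fun t => ⟨(hzz t).1,
        (hzz t).2.1.trans (min_le_right _ _), (hzz t).2.2⟩) (by rw [hb01]) r hr hr1 (fun t => ?_)
      rw [← hbe t, hb2 t]
      simp [abs_of_neg (hp t)]
  · obtain ⟨s, hs, H⟩ := fold_contra hβ hγ (fun z => (fun _ => |z.re|, z.im)) (by fun_prop)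
      (Prod.ext (funext fun i => by simp) (by simp))
      (fun z hz => ⟨fun i => ⟨abs_nonneg _, (Complex.abs_re_le_norm z).trans hz⟩,
        fun i j hij => absurd (Subsingleton.elim i j) hij, (Complex.abs_im_le_norm z).trans hz⟩)
      (fun z hz => by
        have h1 := congrFun (congrArg Prod.fst hz) i
        have h2 := congrArg Prod.snd hz
        simp at h1 h2
        exact Complex.ext h1 h2)
    obtain ⟨r, hr, hr1, b, hbc, hb, hb01, hbe⟩ := loop {b | |b.1 i| < s / 2 ∧ |b.2| < s / 2} (by
      refine IsOpen.mem_nhds ?_ ?_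
      · exact (isOpen_lt (by fun_prop) continuous_const).and
          (isOpen_lt (by fun_prop) continuous_const)
      · simp [hs])
    have hfst : ∀ t, (b t).1 = fun _ => (b t).1 i := fun t =>
      funext fun j => by rw [Subsingleton.elim j i]
    refine H (fun t => (((b t).1 i : ℝ) : ℂ) + ((b t).2 : ℝ) * Complex.I) (by fun_prop) (fun t => ?_)
      (by rw [hb01]) r hr hr1 (fun t => ?_)
    · refine ⟨fun h => (hb t).2 ?_, ?_, ?_⟩
      · have h1 := congrArg Complex.re h
        have h2 := congrArg Complex.im h
        simp at h1 h2
        refine Prod.ext ?_ h2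
        rw [hfst t, h1]; rfl
      · refine (norm_add_le _ _).trans ?_
        rw [norm_mul, Complex.norm_real, Complex.norm_real, Complex.norm_I]
        have := (hb t).1.2
        simp only [Set.mem_ofPred_eq] at this
        simp only [Real.norm_eq_abs]
        linarith
      · simpa using ((hb t).1.1.1 i).1
    · rw [← hbe t]
      congr 1
      refine Prod.ext ?_ (by simp)
      rw [hfst t]
      simp [abs_of_nonneg ((hb t).1.1.1 i).1]

theorem book_disc {ι Y : Type*} [Fintype ι] [TopologicalSpace Y] [T2Space Y]
    {β : (ι → ℝ) × ℝ → Y} {γ : ℂ → Y} {p : Y} (hβ : IsChart (Book ι) β p)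
    (hγ : IsChart (Metric.closedBall (0 : ℂ) 1) γ p) : Fintype.card ι = 2 := by
  rcases lt_trichotomy (Fintype.card ι) 2 with h | h | h
  · have : Subsingleton ι := Fintype.card_le_one_iff_subsingleton.1 (by omega)
    exact (book_disc_le_one hβ hγ).elim
  · exact h
  · obtain ⟨i, j, l, h1, h2, h3⟩ := Fintype.two_lt_card_iff.1 h
    exact (book_disc_three hβ hγ i j l h1 h2 h3).elim


/-! ### Counting local components -/

/-- At `p` the set `T` has locally at least `ι` many components. -/
def EndsGe {Y : Type*} [TopologicalSpace Y] (p : Y) (T : Set Y) (ι : Type*) : Prop :=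
  ∃ O : ι → Set Y, ∃ U ∈ nhds p, (∀ i, IsOpen (O i)) ∧
    (∀ i j, i ≠ j → ∀ y ∈ T ∩ U, y ∈ O i → y ∉ O j) ∧ (∀ y ∈ T ∩ U, ∃ i, y ∈ O i) ∧
    ∀ i, p ∈ closure (O i ∩ T)

/-- At `p` the set `T` has locally at most `ι` many components. -/
def EndsLe {Y : Type*} [TopologicalSpace Y] (p : Y) (T : Set Y) (ι : Type*) : Prop :=
  ∀ U ∈ nhds p, ∃ W ∈ nhds p, ∃ C : ι → Set Y, (∀ y ∈ T ∩ W, ∃ i, y ∈ C i) ∧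
    ∀ i, C i ⊆ T ∩ U ∧ IsPreconnected (C i)

lemma ends_emb {Y ι κ : Type*} [TopologicalSpace Y] {p : Y} {T : Set Y}
    (h1 : EndsGe p T ι) (h2 : EndsLe p T κ) : Nonempty (ι ↪ κ) := by
  obtain ⟨O, U, hU, hO, hd, hc, hcl⟩ := h1
  obtain ⟨W', hW, C, hC, hCp⟩ := h2 U hU
  have h3 : ∀ i, ∃ k, ∃ y, y ∈ O i ∧ y ∈ C k := by
    intro i
    obtain ⟨y, hyW, hyO, hyT⟩ := mem_closure_iff_nhds.1 (hcl i) W' hW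
    obtain ⟨k, hk⟩ := hC y ⟨hyT, hyW⟩
    exact ⟨k, y, hyO, hk⟩
  choose f y hyO hyC using h3
  refine ⟨f, fun i j hij => ?_⟩
  by_contra hne
  have hpre := (hCp (f i)).2
  have hsub := (hCp (f i)).1
  obtain ⟨z, hz, hz1, hz2⟩ := hpre (O i) (⋃ (l) (_ : l ≠ i), O l) (hO i)
    (isOpen_iUnion fun l => isOpen_iUnion fun _ => hO l)
    (by
      intro z hz
      obtain ⟨l, hl⟩ := hc z (hsub hz)
      by_cases hli : l = i
      · left; rw [← hli]; exact hl
      · right; simp only [Set.mem_iUnion]; exact ⟨l, hli, hl⟩)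
    ⟨y i, hyC i, hyO i⟩
    ⟨y j, by rw [hij]; exact hyC j, by
      simp only [Set.mem_iUnion]; exact ⟨j, fun h => hne h.symm, hyO j⟩⟩
  simp only [Set.mem_iUnion] at hz2
  obtain ⟨l, hl, hzl⟩ := hz2
  exact hd i l (fun h => hl h.symm) z (hsub hz) hz1 hzl

/-- Some local sector of the complement of `S` at `p` does not see all of `S`. -/
def SectorProp {Y : Type*} [TopologicalSpace Y] (p : Y) (S : Set Y) : Prop :=
  ∃ W ∈ nhds p, ∃ C C' : Set Y, IsOpen C ∧ IsOpen C' ∧ (∀ y ∈ W, y ∉ S → y ∈ C ∨ y ∈ C') ∧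
    (∀ y ∈ W, y ∉ S → y ∈ C → y ∉ C') ∧
    p ∈ closure (C \ S) ∧ p ∈ closure (S \ closure C)

section bookends
variable {ι Y : Type*} [Finite ι] [TopologicalSpace Y] [T2Space Y]
    {β : (ι → ℝ) × ℝ → Y} {p : Y} {S : Set Y}

/-- small box in the model of the book. -/
def bookBox (ι : Type*) (ε : ℝ) : Set ((ι → ℝ) × ℝ) := {b | (∀ i, |b.1 i| < ε) ∧ |b.2| < ε}

lemma bookBox_mem {ε : ℝ} (hε : 0 < ε) : bookBox ι ε ∈ nhds (0 : (ι → ℝ) × ℝ) := by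
  have : bookBox ι ε = (⋂ i, {b | |b.1 i| < ε}) ∩ {b | |b.2| < ε} := by
    ext b; simp [bookBox]
  rw [this]
  refine Filter.inter_mem ((Filter.iInter_mem).2 fun i => ?_) ?_
  · exact IsOpen.mem_nhds (isOpen_lt (by fun_prop) continuous_const) (by simpa using hε)
  · exact IsOpen.mem_nhds (isOpen_lt (by fun_prop) continuous_const) (by simpa using hε)

lemma exists_bookBox {U : Set ((ι → ℝ) × ℝ)} (hU : U ∈ nhds 0) :
    ∃ ε, 0 < ε ∧ ε ≤ 1 ∧ bookBox ι ε ⊆ U := by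
  cases nonempty_fintype ι
  obtain ⟨δ, hδ, hδU⟩ := Metric.mem_nhds_iff.1 hU
  refine ⟨min δ 1, by positivity, min_le_right _ _, fun b hb => hδU ?_⟩
  rw [mem_ball_zero_iff, Prod.norm_def]
  refine max_lt ?_ (lt_of_lt_of_le hb.2 (min_le_left _ _))
  rw [pi_norm_lt_iff hδ]
  exact fun i => lt_of_lt_of_le (hb.1 i) (min_le_left _ _)

/-- the small open page -/
def bookPage (β : (ι → ℝ) × ℝ → Y) (ε : ℝ) (i : ι) : Set Y :=
  β '' {b | b ∈ Book ι ∧ b ∈ bookBox ι ε ∧ b.1 i ≠ 0}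

omit [Finite ι] in
lemma single_mem_book [DecidableEq ι] (i : ι) (x y : ℝ) (hx : 0 ≤ x) (hx1 : x ≤ 1) (hy : |y| ≤ 1) :
    ((Pi.single i x : ι → ℝ), y) ∈ Book ι := by
  refine ⟨fun j => ?_, fun j k hjk => ?_, hy⟩
  · by_cases h : j = i
    · subst h; simp [hx, hx1]
    · simp [h]
  · by_cases h : j = i
    · right; simp [show k ≠ i from fun h' => hjk (h.trans h'.symm)]
    · left; simp [h]

omit [Finite ι] in
lemma eq_single_of_book [DecidableEq ι] {b : (ι → ℝ) × ℝ} (hb : b ∈ Book ι) (i : ι)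
    (hi : b.1 i ≠ 0) : b = ((Pi.single i (b.1 i) : ι → ℝ), b.2) := by
  refine Prod.ext (funext fun j => ?_) rfl
  by_cases h : j = i
  · subst h; simp
  · simp only [Pi.single_apply, h, if_false]
    exact (hb.2.1 i j (fun h' => h h'.symm)).resolve_left hi

omit [Finite ι] [T2Space Y] in
lemma bookPage_conn (hβ : IsChart (Book ι) β p) {ε : ℝ} (hε1 : ε ≤ 1) (i : ι) :
    IsPreconnected (bookPage β ε i) := by
  classical
  have : {b | b ∈ Book ι ∧ b ∈ bookBox ι ε ∧ b.1 i ≠ 0} =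
      (fun z : ℝ × ℝ => ((Pi.single i z.1 : ι → ℝ), z.2)) ''
        (Set.Ioo 0 ε ×ˢ Set.Ioo (-ε) ε) := by
    ext b
    constructor
    · rintro ⟨h1, h2, h3⟩
      refine ⟨(b.1 i, b.2), ⟨⟨lt_of_le_of_ne (h1.1 i).1 (Ne.symm h3), ?_⟩, abs_lt.1 h2.2⟩,
        (eq_single_of_book h1 i h3).symm⟩
      exact lt_of_le_of_lt (le_abs_self _) (h2.1 i)
    · rintro ⟨⟨x, y⟩, ⟨⟨hx0, hx1⟩, hy⟩, rfl⟩
      have hy' : |y| < ε := abs_lt.2 hy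
      refine ⟨single_mem_book i x y hx0.le (hx1.le.trans hε1) (hy'.le.trans hε1), ⟨fun j => ?_, hy'⟩,
        by simpa using hx0.ne'⟩
      by_cases h : j = i
      · subst h; simpa [abs_of_pos hx0] using hx1
      · simpa [h] using hx0.trans hx1
  rw [bookPage]
  refine IsPreconnected.image ?_ β (hβ.cont.mono fun b hb => hb.1)
  rw [this]
  refine IsPreconnected.image ?_ _ ?_
  · exact (isPreconnected_Ioo).prod isPreconnected_Ioo
  · refine Continuous.continuousOn ?_
    refine Continuous.prodMk (continuous_pi fun j => ?_) (by fun_prop)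
    by_cases h : j = i
    · subst h; simpa using continuous_fst
    · simpa [h] using continuous_const

lemma book_endsLe (hβ : IsChart (Book ι) β p) (hS : ∀ b ∈ Book ι, β b ∈ S ↔ b.1 = 0) :
    EndsLe p Sᶜ ι := by
  intro U hU
  obtain ⟨U', hU', hUs⟩ := hβ.pull hU
  obtain ⟨ε, hε, hε1, hεU⟩ := exists_bookBox hU'
  refine ⟨_, hβ.small (bookBox_mem hε), fun i => bookPage β ε i, ?_, fun i =>
    ⟨?_, bookPage_conn hβ hε1 i⟩⟩
  · rintro y ⟨hyS, b, ⟨hb, hbox⟩, rfl⟩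
    have : b.1 ≠ 0 := fun h => hyS ((hS b hb).2 h)
    obtain ⟨i, hi⟩ := Function.ne_iff.1 this
    exact ⟨i, b, ⟨hb, hbox, hi⟩, rfl⟩
  · rintro y ⟨b, ⟨hb, hbox, hi⟩, rfl⟩
    refine ⟨fun h => hi ?_, hUs b ⟨hb, hεU hbox⟩⟩
    rw [(hS b hb).1 h]; rfl

lemma book_endsGe (hβ : IsChart (Book ι) β p) (hS : ∀ b ∈ Book ι, β b ∈ S ↔ b.1 = 0) :
    EndsGe p Sᶜ ι := by
  classical
  have hmem : ∀ i, ∀ b ∈ Book ι, β b ∈ (β '' (Book ι ∩ {b | b.1 i = 0}))ᶜ ↔ b.1 i ≠ 0 := by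
    intro i b hb
    constructor
    · intro h h0; exact h ⟨b, ⟨hb, h0⟩, rfl⟩
    · rintro h ⟨b', ⟨hb', h0⟩, he⟩
      rw [hβ.inj hb' hb he] at h0
      exact h h0
  refine ⟨fun i => (β '' (Book ι ∩ {b | b.1 i = 0}))ᶜ, _, hβ.nhd, fun i => ?_, ?_, ?_, fun i => ?_⟩
  · rw [isOpen_compl_iff]
    refine IsCompact.isClosed (IsCompact.image_of_continuousOn ?_
      (hβ.cont.mono Set.inter_subset_left))
    exact hβ.compact.inter_right (isClosed_eq (by fun_prop) continuous_const)
  · rintro i j hij y ⟨-, b, hb, rfl⟩ h1 h2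
    rw [hmem i b hb] at h1
    rw [hmem j b hb] at h2
    rcases hb.2.1 i j hij with h | h
    · exact h1 h
    · exact h2 h
  · rintro y ⟨hy, b, hb, rfl⟩
    have : b.1 ≠ 0 := fun h => hy ((hS b hb).2 h)
    obtain ⟨i, hi⟩ := Function.ne_iff.1 this
    exact ⟨i, (hmem i b hb).2 hi⟩
  · rw [mem_closure_iff_nhds]
    intro N hN
    obtain ⟨U', hU', hUs⟩ := hβ.pull hN
    obtain ⟨ε, hε, hε1, hεU⟩ := exists_bookBox hU'
    have hb := single_mem_book i (ε / 2) 0 (by positivity) (by linarith) (by simp)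
    refine ⟨β (Pi.single i (ε / 2), 0), hUs _ ⟨hb, hεU ⟨fun j => ?_, by simpa using hε⟩⟩,
      (hmem i _ hb).2 (by simpa using hε.ne'), fun h => ?_⟩
    · by_cases h : j = i
      · subst h; simp only [Pi.single_eq_same]; rw [abs_of_pos (by positivity)]; linarith
      · simpa [h] using hε
    · have := congrFun ((hS _ hb).1 h) i
      simp at this
      exact hε.ne' this

lemma book_not_sector (hβ : IsChart (Book ι) β p) (hS : ∀ b ∈ Book ι, β b ∈ S ↔ b.1 = 0) :
    ¬ SectorProp p S := by
  classical
  rintro ⟨W', hW, C, C', hC, hC', hcov, hdis, hp1, hp2⟩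
  obtain ⟨U', hU', hUs⟩ := hβ.pull hW
  obtain ⟨ε, hε, hε1, hεU⟩ := exists_bookBox hU'
  have hnb := hβ.small (bookBox_mem (ι := ι) hε)
  obtain ⟨y, ⟨b, ⟨hb, hbox⟩, rfl⟩, hyC, hyS⟩ := mem_closure_iff_nhds.1 hp1 _ hnb
  have : b.1 ≠ 0 := fun h => hyS ((hS b hb).2 h)
  obtain ⟨i, hi⟩ := Function.ne_iff.1 this
  have hpage : ∀ y ∈ bookPage β ε i, y ∈ W' ∧ y ∉ S := by
    rintro _ ⟨b, ⟨hb, hbox, hi⟩, rfl⟩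
    exact ⟨hUs b ⟨hb, hεU hbox⟩, fun h => hi (by rw [(hS b hb).1 h]; rfl)⟩
  have hsub : bookPage β ε i ⊆ C := by
    intro y hy
    by_contra hyC'
    obtain ⟨z, hz, hz1, hz2⟩ := bookPage_conn hβ hε1 i C C' hC hC'
      (fun z hz => hcov z (hpage z hz).1 (hpage z hz).2)
      ⟨β b, ⟨b, ⟨hb, hbox, hi⟩, rfl⟩, hyC⟩
      ⟨y, hy, (hcov y (hpage y hy).1 (hpage y hy).2).resolve_left hyC'⟩
    exact hdis z (hpage z hz).1 (hpage z hz).2 hz1 hz2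
  obtain ⟨y, ⟨b', ⟨hb', hbox'⟩, rfl⟩, hyS', hyC'⟩ := mem_closure_iff_nhds.1 hp2 _ hnb
  apply hyC'
  have h0 := (hS b' hb').1 hyS'
  have hbe : b' = ((Pi.single i 0 : ι → ℝ), b'.2) := by
    refine Prod.ext ?_ rfl
    rw [h0]; simp
  have hc : ContinuousWithinAt β (Book ι) b' := hβ.cont b' hb'
  have hcl : b' ∈ closure {b | b ∈ Book ι ∧ b ∈ bookBox ι ε ∧ b.1 i ≠ 0} := by
    have ht : Filter.Tendsto (fun x : ℝ => ((Pi.single i x : ι → ℝ), b'.2))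
        (nhdsWithin 0 (Set.Ioo 0 ε)) (nhds b') := by
      refine Filter.Tendsto.mono_left ?_ nhdsWithin_le_nhds
      conv_rhs => rw [hbe]
      refine Continuous.tendsto (f := fun x : ℝ => ((Pi.single i x : ι → ℝ), b'.2)) ?_ 0
      refine Continuous.prodMk (continuous_pi fun j => ?_) (by fun_prop)
      by_cases h : j = i
      · subst h; simp only [Pi.single_eq_same]; exact continuous_id
      · simpa [h] using continuous_const
    have : (nhdsWithin (0 : ℝ) (Set.Ioo 0 ε)).NeBot := left_nhdsWithin_Ioo_neBot hε
    refine mem_closure_of_tendsto ht ?_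
    filter_upwards [self_mem_nhdsWithin] with x hx
    refine ⟨single_mem_book i x _ hx.1.le (hx.2.le.trans hε1) hb'.2.2, ⟨fun j => ?_, hbox'.2⟩,
      by simpa using hx.1.ne'⟩
    by_cases h : j = i
    · subst h; simpa [abs_of_pos hx.1] using hx.2
    · simpa [h] using hε
  have := (hc.mono (fun b hb => hb.1 :
    {b | b ∈ Book ι ∧ b ∈ bookBox ι ε ∧ b.1 i ≠ 0} ⊆ Book ι)).mem_closure_image hcl
  exact closure_mono hsub this

end bookends

lemma disc_endsLe {Y : Type*} [TopologicalSpace Y] [T2Space Y] {γ : ℂ → Y} {p : Y}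
    (hγ : IsChart (Metric.closedBall (0 : ℂ) 1) γ p) : EndsLe p {p}ᶜ Unit := by
  intro U hU
  obtain ⟨U', hU', hUs⟩ := hγ.pull hU
  obtain ⟨r, hr, hr1, hrU⟩ := disc_small hU'
  have hconn : IsPreconnected (Metric.closedBall (0 : ℂ) r \ {0}) := by
    have : Metric.closedBall (0 : ℂ) r \ {0} = Complex.exp '' {w | w.re ≤ Real.log r} := by
      ext z
      constructor
      · rintro ⟨h1, h2⟩
        refine ⟨Complex.log z, ?_, Complex.exp_log h2⟩
        rw [mem_closedBall_zero_iff] at h1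
        show (Complex.log z).re ≤ _
        rw [Complex.log_re]
        exact Real.log_le_log (norm_pos_iff.2 h2) h1
      · rintro ⟨w, hw, rfl⟩
        refine ⟨?_, Complex.exp_ne_zero _⟩
        rw [mem_closedBall_zero_iff, Complex.norm_exp]
        exact (Real.le_log_iff_exp_le hr).1 hw
    rw [this]
    refine IsPreconnected.image ?_ _ Complex.continuous_exp.continuousOn
    exact (convex_halfSpace_re_le _).isPreconnected
  refine ⟨_, hγ.small (Metric.closedBall_mem_nhds 0 hr), fun _ =>
    γ '' (Metric.closedBall (0 : ℂ) r \ {0}), ?_, fun _ => ⟨?_, ?_⟩⟩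
  · rintro y ⟨hy, z, ⟨hz1, hz2⟩, rfl⟩
    refine ⟨(), z, ⟨hz2, fun h => hy ?_⟩, rfl⟩
    rw [Set.mem_singleton_iff.1 h]; exact hγ.map_zero
  · rintro y ⟨z, ⟨hz, hz0⟩, rfl⟩
    refine ⟨fun h => hz0 ?_, hUs z (hrU hz)⟩
    exact hγ.inj (hrU hz).1 hγ.zero_mem (Eq.trans h hγ.map_zero.symm)
  · exact hconn.image _ (hγ.cont.mono fun z hz => (hrU hz.1).1)


/-! ### The dunce hat as a quotient of a triangle in the plane -/

/-- The standard triangle in the plane. -/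
def Tri : Set (ℝ × ℝ) := {x | 0 ≤ x.1 ∧ 0 ≤ x.2 ∧ x.1 + x.2 ≤ 1}

/-- `Q` presents `Y` as dunce hat. -/
structure DHMap {Y : Type*} [TopologicalSpace Y] (Q : ℝ × ℝ → Y) : Prop where
  cont : ContinuousOn Q Tri
  surj : ∀ y, ∃ x ∈ Tri, Q x = y
  int : ∀ x y : ℝ × ℝ, y ∈ Tri → 0 < x.1 → 0 < x.2 → x.1 + x.2 < 1 → Q x = Q y → x = y
  e1 : ∀ t ∈ Set.Icc (0 : ℝ) 1, Q (1 - t, t) = Q (t, 0)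
  e2 : ∀ t ∈ Set.Icc (0 : ℝ) 1, Q (0, t) = Q (t, 0)
  edge : ∀ s ∈ Set.Icc (0 : ℝ) 1, ∀ t ∈ Set.Icc (0 : ℝ) 1, Q (s, 0) = Q (t, 0) →
    s = t ∨ (s = 0 ∧ t = 1) ∨ (s = 1 ∧ t = 0)

open scoped Classical in
/-- invariant separating points of the dunce hat -/
noncomputable def dhInv (x : stdSimplex ℝ (Fin 3)) : ℝ × ℝ :=
  if x.val 0 ≠ 0 ∧ x.val 1 ≠ 0 ∧ x.val 2 ≠ 0 then (x.val 1, x.val 2)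
  else (-1, if (if x.val 2 = 0 then x.val 1 else x.val 2) = 1 then 0 else
    (if x.val 2 = 0 then x.val 1 else x.val 2))

lemma dhInv_resp (x y : stdSimplex ℝ (Fin 3)) (h : dhRel x y) : dhInv x = dhInv y := by
  obtain ⟨t, h0, h1, ⟨hx, hy⟩ | ⟨hx, hy⟩⟩ := h
  · unfold dhInv
    rw [hx, hy]
    simp [epath]
    by_cases ht : t = 0 <;> simp [ht]
  · unfold dhInv
    rw [hx, hy]
    simp [epath]
    by_cases ht : t = 0 <;> simp [ht]

/-- the point of the simplex -/
noncomputable def triPt (x : ℝ × ℝ) : stdSimplex ℝ (Fin 3) := by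
  classical
  exact if h : x ∈ Tri then ⟨![1 - x.1 - x.2, x.1, x.2], by
    refine ⟨fun i => ?_, ?_⟩
    · fin_cases i
      · have := h.2.2; simp; linarith
      · exact h.1
      · exact h.2.1
    · simp [Fin.sum_univ_three]
      ring⟩
  else ⟨![1, 0, 0], by
    refine ⟨fun i => ?_, ?_⟩
    · fin_cases i <;> simp
    · simp [Fin.sum_univ_three]⟩

lemma triPt_val {x : ℝ × ℝ} (h : x ∈ Tri) :
    (triPt x).val = ![1 - x.1 - x.2, x.1, x.2] := by
  unfold triPt; simp [h]

lemma dunce_map {Y : Type*} [TopologicalSpace Y] (Φ : Y ≃ₜ DunceHat) :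
    DHMap (fun x => Φ.symm (Quot.mk dhRel (triPt x) : DunceHat)) := by
  have key : ∀ x y, Φ.symm (Quot.mk dhRel (triPt x) : DunceHat) =
      Φ.symm (Quot.mk dhRel (triPt y) : DunceHat) → dhInv (triPt x) = dhInv (triPt y) := by
    intro x y h
    have h2 : (Quot.mk dhRel (triPt x) : DunceHat) = Quot.mk dhRel (triPt y) := Φ.symm.injective h
    exact congrArg (Quot.lift dhInv dhInv_resp) h2
  have hmem1 : ∀ t ∈ Set.Icc (0 : ℝ) 1, ((t, 0) : ℝ × ℝ) ∈ Tri := by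
    intro t ht; exact ⟨ht.1, le_refl _, by simpa using ht.2⟩
  have hmem2 : ∀ t ∈ Set.Icc (0 : ℝ) 1, ((0, t) : ℝ × ℝ) ∈ Tri := by
    intro t ht; exact ⟨le_refl _, ht.1, by simpa using ht.2⟩
  have hmem3 : ∀ t ∈ Set.Icc (0 : ℝ) 1, ((1 - t, t) : ℝ × ℝ) ∈ Tri := by
    intro t ht; exact ⟨sub_nonneg.2 ht.2, ht.1, by simp⟩
  refine ⟨?_, ?_, ?_, ?_, ?_, ?_⟩
  · refine Φ.symm.continuous.comp_continuousOn ?_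
    have : Continuous (fun z => (Quot.mk dhRel z : DunceHat)) := continuous_quot_mk
    refine this.comp_continuousOn ?_
    refine continuousOn_iff_continuous_domRestrict.2 ?_
    refine continuous_induced_rng.2 ?_
    have : (Subtype.val ∘ Tri.domRestrict triPt) =
        fun z : Tri => ![1 - z.val.1 - z.val.2, z.val.1, z.val.2] := by
      funext z
      exact triPt_val z.2
    rw [this]
    refine continuous_pi fun i => ?_
    fin_cases i <;> simp <;> fun_prop
  · intro y
    obtain ⟨z, hz⟩ := Quot.exists_rep (Φ y : Quot dhRel)
    have hs := z.2.2
    rw [Fin.sum_univ_three] at hs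
    have hT : (z.val 1, z.val 2) ∈ Tri := by
      refine ⟨z.2.1 1, z.2.1 2, ?_⟩
      have := z.2.1 0
      simp only
      linarith
    refine ⟨(z.val 1, z.val 2), hT, ?_⟩
    have : triPt (z.val 1, z.val 2) = z := by
      apply Subtype.ext
      rw [triPt_val hT]
      funext i
      fin_cases i
      · simp; linarith
      · rfl
      · rfl
    simp only [this]
    exact (Homeomorph.symm_apply_eq Φ).2 hz
  · intro x y hy h1 h2 h3 h
    have := key x y h
    have hx : x ∈ Tri := ⟨h1.le, h2.le, h3.le⟩
    unfold dhInv at this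
    rw [triPt_val hx, triPt_val hy] at this
    have h4 : 1 - x.1 - x.2 ≠ 0 := by intro h; linarith
    simp [h4, h1.ne', h2.ne'] at this
    split_ifs at this with h5 
    · simpa using this
    all_goals
      have h6 := congrArg Prod.fst this
      simp only at h6
      linarith
  · intro t ht
    congr 1
    refine (Quot.sound ⟨t, ht.1, ht.2, Or.inl ⟨?_, ?_⟩⟩).symm
    · rw [triPt_val (hmem1 t ht)]
      funext i; fin_cases i <;> simp [epath]
    · rw [triPt_val (hmem3 t ht)]
      funext i; fin_cases i <;> simp [epath]
  · intro t ht
    congr 1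
    refine (Quot.sound ⟨t, ht.1, ht.2, Or.inr ⟨?_, ?_⟩⟩).symm
    · rw [triPt_val (hmem1 t ht)]
      funext i; fin_cases i <;> simp [epath]
    · rw [triPt_val (hmem2 t ht)]
      funext i; fin_cases i <;> simp [epath]
  · intro s hs t ht h
    have := key _ _ h
    unfold dhInv at this
    rw [triPt_val (hmem1 s hs), triPt_val (hmem1 t ht)] at this
    simp at this
    split_ifs at this with h5 h6 h6
    · left; linarith
    · right; right; exact ⟨h5, this.symm⟩
    · right; left; exact ⟨this, h6⟩
    · left; exact this


/-- The singular circle. -/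
def dhS {Y : Type*} (Q : ℝ × ℝ → Y) : Set Y := (fun t => Q (t, 0)) '' Set.Icc 0 1

lemma isCompact_Tri : IsCompact Tri := by
  refine Metric.isCompact_of_isClosed_isBounded ?_ ?_
  · have : Tri = {x | 0 ≤ x.1} ∩ {x | 0 ≤ x.2} ∩ {x | x.1 + x.2 ≤ 1} := by
      ext x; simp [Tri, and_assoc]
    rw [this]
    exact ((isClosed_le continuous_const continuous_fst).inter
      (isClosed_le continuous_const continuous_snd)).inter
      (isClosed_le (by fun_prop) continuous_const)
  · refine (Metric.isBounded_closedBall (x := (0 : ℝ × ℝ)) (r := 1)).subset ?_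
    rintro x ⟨h1, h2, h3⟩
    rw [mem_closedBall_zero_iff, Prod.norm_def, Real.norm_eq_abs, Real.norm_eq_abs,
      abs_of_nonneg h1, abs_of_nonneg h2]
    exact max_le (by linarith) (by linarith)

section dh
variable {Y : Type*} [TopologicalSpace Y] [T2Space Y] {Q : ℝ × ℝ → Y}

lemma DHMap.isClosed_image (hQ : DHMap Q) {A : Set (ℝ × ℝ)} (hA : IsClosed A) :
    IsClosed (Q '' (Tri ∩ A)) :=
  ((isCompact_Tri.inter_right hA).image_of_continuousOn
    (hQ.cont.mono Set.inter_subset_left)).isClosed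

lemma DHMap.nhd (hQ : DHMap Q) {p : Y} {N : Set Y}
    (h : ∀ x ∈ Tri, Q x = p → ∃ U ∈ nhds x, ∀ z ∈ U, z ∈ Tri → Q z ∈ N) : N ∈ nhds p := by
  have hop : IsOpen (Q '' (Tri ∩ (interior {z | z ∈ Tri → Q z ∈ N})ᶜ))ᶜ :=
    (hQ.isClosed_image isOpen_interior.isClosed_compl).isOpen_compl
  refine Filter.mem_of_superset (hop.mem_nhds ?_) ?_
  · rintro ⟨x, ⟨hx, hx2⟩, hxp⟩
    obtain ⟨U, hU, hUN⟩ := h x hx hxp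
    exact hx2 (mem_interior_iff_mem_nhds.2 (Filter.mem_of_superset hU hUN))
  · intro y hy
    obtain ⟨x, hx, rfl⟩ := hQ.surj y
    by_contra hc
    exact hy ⟨x, ⟨hx, fun h => hc (interior_subset h hx)⟩, rfl⟩

omit [T2Space Y] in
lemma DHMap.mem_S (hQ : DHMap Q) {x : ℝ × ℝ} (hx : x ∈ Tri) :
    Q x ∈ dhS Q ↔ x.1 = 0 ∨ x.2 = 0 ∨ x.1 + x.2 = 1 := by
  constructor
  · rintro ⟨t, ht, h⟩
    by_contra hc
    push Not at hc
    have := hQ.int x (t, 0) ⟨ht.1, le_refl _, by simpa using ht.2⟩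
      (lt_of_le_of_ne hx.1 hc.1.symm) (lt_of_le_of_ne hx.2.1 hc.2.1.symm)
      (lt_of_le_of_ne hx.2.2 hc.2.2) h.symm
    exact hc.2.1 (by rw [this])
  · obtain ⟨a, b⟩ := x
    obtain ⟨h1, h2, h3⟩ := hx
    simp only at h1 h2 h3
    rintro (h | h | h)
    · simp only at h; subst h
      exact ⟨b, ⟨h2, by linarith⟩, (hQ.e2 b ⟨h2, by linarith⟩).symm⟩
    · simp only at h; subst h
      exact ⟨a, ⟨h1, by linarith⟩, rfl⟩
    · simp only at h
      have : a = 1 - b := by linarith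
      subst this
      exact ⟨b, ⟨h2, by linarith⟩, (hQ.e1 b ⟨h2, by linarith⟩).symm⟩

lemma DHMap.closed (hQ : DHMap Q) : IsClosed (dhS Q) := by
  refine (IsCompact.image_of_continuousOn isCompact_Icc ?_).isClosed
  refine hQ.cont.comp (by fun_prop) fun t ht => ⟨ht.1, le_refl _, by simpa using ht.2⟩

omit [T2Space Y] in
lemma DHMap.exists_int (hQ : DHMap Q) {p : Y} (hp : p ∉ dhS Q) :
    ∃ x ∈ Tri, 0 < x.1 ∧ 0 < x.2 ∧ x.1 + x.2 < 1 ∧ Q x = p := by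
  obtain ⟨x, hx, rfl⟩ := hQ.surj p
  rw [hQ.mem_S hx] at hp
  push Not at hp
  exact ⟨x, hx, lt_of_le_of_ne hx.1 hp.1.symm, lt_of_le_of_ne hx.2.1 hp.2.1.symm,
      lt_of_le_of_ne hx.2.2 hp.2.2, rfl⟩

lemma DHMap.disc (hQ : DHMap Q) {p : Y} (hp : p ∉ dhS Q) :
    ∃ γ : ℂ → Y, IsChart (Metric.closedBall (0 : ℂ) 1) γ p := by
  obtain ⟨⟨a, b⟩, hx, h1, h2, h3, rfl⟩ := hQ.exists_int hp
  simp only at h1 h2 h3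
  obtain ⟨δ, hδ, hδ1, hδ2, hδ3⟩ : ∃ δ : ℝ, 0 < δ ∧ δ < a ∧ δ < b ∧ 2 * δ < 1 - a - b := by
    refine ⟨min a (min b (1 - a - b)) / 4, ?_, ?_, ?_, ?_⟩
    · have : 0 < min a (min b (1 - a - b)) := lt_min h1 (lt_min h2 (by linarith))
      positivity
    · have := min_le_left a (min b (1 - a - b)); linarith
    · have := (min_le_right a (min b (1 - a - b))).trans (min_le_left _ _); linarith
    · have := (min_le_right a (min b (1 - a - b))).trans (min_le_right _ _); linarith
  have hb : ∀ z ∈ Metric.closedBall (0 : ℂ) 1, 0 < a + δ * z.re ∧ 0 < b + δ * z.im ∧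
      (a + δ * z.re) + (b + δ * z.im) < 1 := by
    intro z hz
    rw [mem_closedBall_zero_iff] at hz
    have h4 := abs_le.1 ((Complex.abs_re_le_norm z).trans hz)
    have h5 := abs_le.1 ((Complex.abs_im_le_norm z).trans hz)
    refine ⟨?_, ?_, ?_⟩ <;> nlinarith
  have hm : ∀ z ∈ Metric.closedBall (0 : ℂ) 1, (a + δ * z.re, b + δ * z.im) ∈ Tri :=
    fun z hz => ⟨(hb z hz).1.le, (hb z hz).2.1.le, (hb z hz).2.2.le⟩
  refine ⟨fun z => Q (a + δ * z.re, b + δ * z.im), ⟨isCompact_closedBall _ _, by simp, ?_, ?_,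
    by simp, ?_⟩⟩
  · exact hQ.cont.comp (Continuous.continuousOn (by fun_prop)) hm
  · intro z hz w hw h
    have := hQ.int _ _ (hm w hw) (hb z hz).1 (hb z hz).2.1 (hb z hz).2.2 h
    simp only [Prod.mk.injEq, add_right_inj, mul_eq_mul_left_iff, hδ.ne', or_false] at this
    exact Complex.ext this.1 this.2
  · refine hQ.nhd fun x hx hxp => ?_
    have := hQ.int (a, b) x hx h1 h2 h3 hxp.symm
    subst this
    refine ⟨{z | ‖(⟨(z.1 - a) / δ, (z.2 - b) / δ⟩ : ℂ)‖ < 1}, ?_, ?_⟩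
    · refine IsOpen.mem_nhds (isOpen_lt ?_ continuous_const) (by
        have : (⟨0, 0⟩ : ℂ) = 0 := rfl
        simp [this])
      have : ∀ z : ℝ × ℝ, (⟨(z.1 - a) / δ, (z.2 - b) / δ⟩ : ℂ) =
        (((z.1 - a) / δ : ℝ) : ℂ) + (((z.2 - b) / δ : ℝ) : ℂ) * Complex.I := fun z =>
          Complex.mk_eq_add_mul_I _ _
      simp only [this]
      fun_prop
    · intro z hz _
      refine ⟨⟨(z.1 - a) / δ, (z.2 - b) / δ⟩, ?_, ?_⟩
      · rw [mem_closedBall_zero_iff]; exact le_of_lt hz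
      · simp only
        congr 1
        ext <;> field_simp <;> ring

lemma DHMap.conn (hQ : DHMap Q) {A : Set Y} (hA : A.Finite) :
    IsPreconnected ((dhS Q)ᶜ \ A) := by
  set e : ℝ × ℝ → ℝ × ℝ := fun z => (Real.exp z.1 / (1 + Real.exp z.1 + Real.exp z.2),
    Real.exp z.2 / (1 + Real.exp z.1 + Real.exp z.2)) with he
  have hden : ∀ z : ℝ × ℝ, 0 < 1 + Real.exp z.1 + Real.exp z.2 := fun z => by positivity
  have hint : ∀ z, 0 < (e z).1 ∧ 0 < (e z).2 ∧ (e z).1 + (e z).2 < 1 := by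
    intro z
    have := hden z
    refine ⟨by simp only [he]; positivity, by simp only [he]; positivity, ?_⟩
    simp only [he]
    rw [← add_div, div_lt_one this]
    linarith
  have hT : ∀ z, e z ∈ Tri := fun z => ⟨(hint z).1.le, (hint z).2.1.le, (hint z).2.2.le⟩
  have hlog : ∀ z : ℝ × ℝ, Real.log ((e z).1 / (1 - (e z).1 - (e z).2)) = z.1 ∧
      Real.log ((e z).2 / (1 - (e z).1 - (e z).2)) = z.2 := by
    intro z
    have h := hden z
    have h0 : 1 - (e z).1 - (e z).2 = 1 / (1 + Real.exp z.1 + Real.exp z.2) := by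
      simp only [he]; field_simp; ring
    constructor
    · rw [h0]; simp only [he]
      rw [div_div_div_cancel_right₀ h.ne', div_one, Real.log_exp]
    · rw [h0]; simp only [he]
      rw [div_div_div_cancel_right₀ h.ne', div_one, Real.log_exp]
  have hinj : Function.Injective (Q ∘ e) := by
    intro z w h
    have h1 := hQ.int _ _ (hT w) (hint z).1 (hint z).2.1 (hint z).2.2 h
    refine Prod.ext ?_ ?_
    · rw [← (hlog z).1, ← (hlog w).1, h1]
    · rw [← (hlog z).2, ← (hlog w).2, h1]
  have hrange : (dhS Q)ᶜ \ A = (Q ∘ e) '' ((Q ∘ e) ⁻¹' A)ᶜ := by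
    ext y
    constructor
    · rintro ⟨hy, hyA⟩
      obtain ⟨⟨a, b⟩, hx, h1, h2, h3, rfl⟩ := hQ.exists_int hy
      simp only at h1 h2 h3
      have h4 : 0 < 1 - a - b := by linarith
      have : e (Real.log (a / (1 - a - b)), Real.log (b / (1 - a - b))) = (a, b) := by
        simp only [he]
        rw [Real.exp_log (by positivity), Real.exp_log (by positivity)]
        have h5 : 1 + a / (1 - a - b) + b / (1 - a - b) = 1 / (1 - a - b) := by
          field_simp; ring
        rw [h5, div_div_div_cancel_right₀ h4.ne', div_div_div_cancel_right₀ h4.ne']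
        simp
      refine ⟨(Real.log (a / (1 - a - b)), Real.log (b / (1 - a - b))), ?_, ?_⟩
      · rw [Set.mem_compl_iff, Set.mem_preimage, Function.comp, this]; exact hyA
      · rw [Function.comp, this]
    · rintro ⟨z, hz, rfl⟩
      refine ⟨fun h => ?_, hz⟩
      rw [Function.comp, hQ.mem_S (hT z)] at h
      have := hint z
      rcases h with h | h | h <;> linarith
  rw [hrange]
  refine IsPreconnected.image ?_ _ ?_
  · refine (Set.Countable.isConnected_compl_of_one_lt_rank ?_ ?_).isPreconnected
    · rw [rank_prod']; simp; norm_num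
    · exact (hA.preimage hinj.injOn).countable
  · refine hQ.cont.comp (Continuous.continuousOn ?_) fun z _ => hT z
    simp only [he]
    refine Continuous.prodMk ?_ ?_
    · exact Continuous.div (by fun_prop) (by fun_prop) fun z => (hden z).ne'
    · exact Continuous.div (by fun_prop) (by fun_prop) fun z => (hden z).ne'

omit [T2Space Y] in
lemma DHMap.corner (hQ : DHMap Q) : Q (1, 0) = Q (0, 0) := by
  simpa using hQ.e1 0 (by simp)

/-- preimages of points on the singular set -/
lemma DHMap.fib (hQ : DHMap Q) {t : ℝ} (ht : t ∈ Set.Ioo (0 : ℝ) 1) {x : ℝ × ℝ} (hx : x ∈ Tri)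
    (h : Q x = Q (t, 0)) : x = (t, 0) ∨ x = (0, t) ∨ x = (1 - t, t) := by
  have htI : t ∈ Set.Icc (0 : ℝ) 1 := ⟨ht.1.le, ht.2.le⟩
  have hs : Q x ∈ dhS Q := by rw [h]; exact ⟨t, htI, rfl⟩
  have hed : ∀ s ∈ Set.Icc (0 : ℝ) 1, Q (s, 0) = Q (t, 0) → s = t := by
    intro s hs h
    rcases hQ.edge s hs t htI h with h | h | h
    · exact h
    · exact absurd h.2 ht.2.ne
    · exact absurd h.2 ht.1.ne'
  obtain ⟨a, b⟩ := x
  obtain ⟨h1, h2, h3⟩ := id hx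
  simp only at h1 h2 h3
  rcases (hQ.mem_S hx).1 hs with h' | h' | h' <;> simp only at h'
  · subst h'
    rw [hQ.e2 b ⟨h2, by linarith⟩] at h
    right; left; rw [hed b ⟨h2, by linarith⟩ h]
  · subst h'
    left; rw [hed a ⟨h1, by linarith⟩ h]
  · have : a = 1 - b := by linarith
    subst this
    rw [hQ.e1 b ⟨h2, by linarith⟩] at h
    right; right; rw [hed b ⟨h2, by linarith⟩ h]

lemma DHMap.isOpen_image (hQ : DHMap Q) {U : Set (ℝ × ℝ)} (hU : IsOpen U)
    (hint : ∀ x ∈ U, 0 < x.1 ∧ 0 < x.2 ∧ x.1 + x.2 < 1) : IsOpen (Q '' U) := by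
  rw [isOpen_iff_mem_nhds]
  rintro _ ⟨x, hx, rfl⟩
  refine hQ.nhd fun x' hx' h => ?_
  obtain ⟨h1, h2, h3⟩ := hint x hx
  have := hQ.int x x' hx' h1 h2 h3 h.symm
  subst this
  exact ⟨U, hU.mem_nhds hx, fun z hz _ => ⟨z, hz, rfl⟩⟩

lemma DHMap.sector (hQ : DHMap Q) : SectorProp (Q (0, 0)) (dhS Q) := by
  set U : Set (ℝ × ℝ) := {x | 0 < x.1 ∧ 0 < x.2 ∧ x.1 + x.2 < 1 / 3} with hU
  set U' : Set (ℝ × ℝ) := {x | 0 < x.1 ∧ 0 < x.2 ∧ x.1 + x.2 < 1 ∧ (2 / 3 < x.1 ∨ 2 / 3 < x.2)}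
    with hU'
  set D : Set (ℝ × ℝ) := {x | x.1 ≤ 2 / 3} ∩ {x | x.2 ≤ 2 / 3} ∩ {x | 1 / 3 ≤ x.1 + x.2} with hD
  have hfib : ∀ x ∈ Tri, Q x = Q (0, 0) → x = (0, 0) ∨ x = (1, 0) ∨ x = (0, 1) := by
    rintro ⟨a, b⟩ hx h
    have hs : Q (a, b) ∈ dhS Q := by rw [h]; exact ⟨0, by simp, rfl⟩
    have hed : ∀ s ∈ Set.Icc (0 : ℝ) 1, Q (s, 0) = Q (0, 0) → s = 0 ∨ s = 1 := by
      intro s hs h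
      rcases hQ.edge s hs 0 (by simp) h with h | h | h
      · exact Or.inl h
      · exact Or.inl h.1
      · exact Or.inr h.1
    obtain ⟨h1, h2, h3⟩ := id hx
    simp only at h1 h2 h3
    rcases (hQ.mem_S hx).1 hs with h' | h' | h' <;> simp only at h'
    · subst h'
      rw [hQ.e2 b ⟨h2, by linarith⟩] at h
      rcases hed b ⟨h2, by linarith⟩ h with rfl | rfl <;> simp
    · subst h'
      rcases hed a ⟨h1, by linarith⟩ h with rfl | rfl <;> simp
    · have : a = 1 - b := by linarith
      subst this
      rw [hQ.e1 b ⟨h2, by linarith⟩] at h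
      rcases hed b ⟨h2, by linarith⟩ h with rfl | rfl <;> simp
  have hDc : IsClosed D := ((isClosed_le continuous_fst continuous_const).inter
    (isClosed_le continuous_snd continuous_const)).inter (isClosed_le continuous_const (by fun_prop))
  have hUT : ∀ x ∈ U, x ∈ Tri := fun x hx => ⟨hx.1.le, hx.2.1.le, by linarith [hx.2.2]⟩
  have hUT' : ∀ x ∈ U', x ∈ Tri := fun x hx => ⟨hx.1.le, hx.2.1.le, hx.2.2.1.le⟩
  refine ⟨(Q '' (Tri ∩ D))ᶜ, (hQ.isClosed_image hDc).isOpen_compl.mem_nhds ?_, Q '' U, Q '' U',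
    hQ.isOpen_image ?_ ?_, hQ.isOpen_image ?_ ?_, ?_, ?_, ?_, ?_⟩
  · rintro ⟨x, ⟨hx, hxD⟩, h⟩
    obtain ⟨⟨h1, h2⟩, h3⟩ := hxD
    simp only [Set.mem_ofPred_eq] at h1 h2 h3
    rcases hfib x hx h with rfl | rfl | rfl
    · norm_num at h3
    · norm_num at h1
    · norm_num at h2
  · exact (isOpen_lt continuous_const continuous_fst).inter
      ((isOpen_lt continuous_const continuous_snd).inter
        (isOpen_lt (continuous_fst.add continuous_snd) continuous_const))
  · rintro x ⟨h1, h2, h3⟩; exact ⟨h1, h2, by linarith⟩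
  · exact (isOpen_lt continuous_const continuous_fst).inter
      ((isOpen_lt continuous_const continuous_snd).inter
        ((isOpen_lt (continuous_fst.add continuous_snd) continuous_const).inter
          ((isOpen_lt continuous_const continuous_fst).union
            (isOpen_lt continuous_const continuous_snd))))
  · rintro x ⟨h1, h2, h3, -⟩; exact ⟨h1, h2, h3⟩
  · intro y hyW hyS
    obtain ⟨x, hx, h1, h2, h3, rfl⟩ := hQ.exists_int hyS
    by_contra hc
    push Not at hc
    apply hyW
    refine ⟨x, ⟨hx, ⟨?_, ?_⟩, ?_⟩, rfl⟩
    · by_contra h; exact hc.2 ⟨x, ⟨h1, h2, h3, Or.inl (not_le.1 h)⟩, rfl⟩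
    · by_contra h; exact hc.2 ⟨x, ⟨h1, h2, h3, Or.inr (not_le.1 h)⟩, rfl⟩
    · by_contra h; exact hc.1 ⟨x, ⟨h1, h2, not_le.1 h⟩, rfl⟩
  · rintro _ - - ⟨x, hx, rfl⟩ ⟨x', hx', h⟩
    have := hQ.int x x' (hUT' x' hx') hx.1 hx.2.1 (by linarith [hx.2.2]) h.symm
    subst this
    obtain ⟨h1, h2, h3⟩ := hx
    rcases hx'.2.2.2 with h | h <;> linarith
  · rw [mem_closure_iff_nhds]
    intro N hN
    have hc : ContinuousWithinAt Q Tri (0, 0) := hQ.cont _ ⟨le_refl _, le_refl _, by simp⟩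
    obtain ⟨N', hN', hNN⟩ := mem_nhdsWithin_iff_exists_mem_nhds_inter.1 (hc hN)
    have ht : Filter.Tendsto (fun s : ℝ => (s, s)) (nhdsWithin 0 (Set.Ioi 0)) (nhds (0, 0)) := by
      refine Filter.Tendsto.mono_left ?_ nhdsWithin_le_nhds
      exact Continuous.tendsto (f := fun s : ℝ => (s, s)) (by fun_prop) 0
    have hI : ∀ᶠ s in nhdsWithin (0 : ℝ) (Set.Ioi 0), s ∈ Set.Ioo (0 : ℝ) (1 / 6) :=
      Ioo_mem_nhdsGT (by norm_num)
    obtain ⟨s, hs1, hs2⟩ := ((ht.eventually_mem hN').and hI).exists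
    have hsU : ((s, s) : ℝ × ℝ) ∈ U := ⟨hs2.1, hs2.1, by have := hs2.2; simp only; linarith⟩
    refine ⟨Q (s, s), hNN ⟨hs1, hUT _ hsU⟩, ⟨_, hsU, rfl⟩, fun h => ?_⟩
    obtain ⟨h1, h2⟩ := hs2
    rcases (hQ.mem_S (hUT _ hsU)).1 h with h | h | h <;> simp only at h <;> linarith
  · rw [mem_closure_iff_nhds]
    intro N hN
    rw [← hQ.corner] at hN
    have hc : ContinuousWithinAt Q Tri (1, 0) := hQ.cont _ ⟨zero_le_one, le_refl _, by simp⟩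
    obtain ⟨N', hN', hNN⟩ := mem_nhdsWithin_iff_exists_mem_nhds_inter.1 (hc hN)
    have ht : Filter.Tendsto (fun s : ℝ => (1 - s, (0 : ℝ))) (nhdsWithin 0 (Set.Ioi 0))
        (nhds (1, 0)) := by
      refine Filter.Tendsto.mono_left ?_ nhdsWithin_le_nhds
      simpa using Continuous.tendsto (f := fun s : ℝ => (1 - s, (0 : ℝ))) (by fun_prop) 0
    have hI : ∀ᶠ s in nhdsWithin (0 : ℝ) (Set.Ioi 0), s ∈ Set.Ioo (0 : ℝ) (1 / 6) :=
      Ioo_mem_nhdsGT (by norm_num)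
    obtain ⟨s, hs1, hs2⟩ := ((ht.eventually_mem hN').and hI).exists
    obtain ⟨h1, h2⟩ := hs2
    have hsT : ((1 - s, 0) : ℝ × ℝ) ∈ Tri :=
      ⟨by simp only; linarith, le_refl _, by simp only; linarith⟩
    refine ⟨Q (1 - s, 0), hNN ⟨hs1, hsT⟩, ⟨1 - s, ⟨by linarith, by linarith⟩, rfl⟩, fun h => ?_⟩
    have hcl : closure (Q '' U) ⊆ Q '' (Tri ∩ {x | x.1 + x.2 ≤ 1 / 3}) := by
      refine closure_minimal ?_ (hQ.isClosed_image (isClosed_le (by fun_prop) continuous_const))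
      rintro _ ⟨x, hx, rfl⟩
      exact ⟨x, ⟨hUT x hx, hx.2.2.le⟩, rfl⟩
    obtain ⟨x, ⟨hx, hx2⟩, hxe⟩ := hcl h
    have hx2' : x.1 + x.2 ≤ 1 / 3 := hx2
    rcases hQ.fib (t := 1 - s) ⟨by linarith, by linarith⟩ hx hxe with rfl | rfl | rfl <;>
      simp only at hx2' <;> linarith

end dh


lemma isOpen_three {f g : ℝ × ℝ → ℝ} (hf : Continuous f) (hg : Continuous g) {δ : ℝ} :
    IsOpen {z | f z < δ ∧ -δ < g z ∧ g z < δ} :=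
  (isOpen_lt hf continuous_const).inter ((isOpen_lt continuous_const hg).inter
    (isOpen_lt hg continuous_const))

section dh3
variable {Y : Type*} [TopologicalSpace Y] [T2Space Y] {Q : ℝ × ℝ → Y}

/-- the three pages at an edge point -/
def dhPage (t : ℝ) (i : Fin 3) (x y : ℝ) : ℝ × ℝ :=
  ![(t + y, x), (x, t + y), (1 - t - y - x, t + y)] i

lemma dhPage_inj {t δ : ℝ} (h1 : 4 * δ ≤ t) (h2 : 4 * δ ≤ 1 - t) (hδ : 0 < δ) {i j : Fin 3}
    {x y x' y' : ℝ} (hx : 0 ≤ x) (hx1 : x ≤ δ) (hy : -δ ≤ y) (hy1 : y ≤ δ)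
    (hx' : 0 ≤ x') (hx1' : x' ≤ δ) (hy' : -δ ≤ y') (hy1' : y' ≤ δ)
    (h : dhPage t i x y = dhPage t j x' y') : i = j ∧ x = x' ∧ y = y' := by
  fin_cases i <;> fin_cases j <;> simp [dhPage] at h ⊢ <;> obtain ⟨h3, h4⟩ := h <;>
    first
    | (exfalso; linarith)
    | (constructor <;> linarith)

lemma dhPage_int {t δ : ℝ} (h1 : 4 * δ ≤ t) (h2 : 4 * δ ≤ 1 - t) (hδ : 0 < δ) {i : Fin 3}
    {x y : ℝ} (hx : 0 < x) (hx1 : x ≤ δ) (hy : -δ ≤ y) (hy1 : y ≤ δ) :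
    0 < (dhPage t i x y).1 ∧ 0 < (dhPage t i x y).2 ∧
      (dhPage t i x y).1 + (dhPage t i x y).2 < 1 := by
  fin_cases i <;> simp [dhPage] <;> refine ⟨?_, ?_, ?_⟩ <;> linarith

lemma dhPage_tri {t δ : ℝ} (h1 : 4 * δ ≤ t) (h2 : 4 * δ ≤ 1 - t) (hδ : 0 < δ) {i : Fin 3}
    {x y : ℝ} (hx : 0 ≤ x) (hx1 : x ≤ δ) (hy : -δ ≤ y) (hy1 : y ≤ δ) :
    dhPage t i x y ∈ Tri := by
  fin_cases i <;> simp [dhPage, Tri] <;> refine ⟨?_, ?_, ?_⟩ <;> linarith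

omit [T2Space Y] in
lemma DHMap.page_zero (hQ : DHMap Q) {t y : ℝ} (h : t + y ∈ Set.Icc (0 : ℝ) 1) (i : Fin 3) :
    Q (dhPage t i 0 y) = Q (t + y, 0) := by
  fin_cases i
  · simp [dhPage]
  · simpa [dhPage] using hQ.e2 _ h
  · simpa [dhPage, sub_sub] using hQ.e1 _ h

open scoped Classical in
/-- the chart -/
noncomputable def dhBook (Q : ℝ × ℝ → Y) (t δ : ℝ) (b : (Fin 3 → ℝ) × ℝ) : Y :=
  if h : ∃ i, b.1 i ≠ 0 then Q (dhPage t h.choose (δ * b.1 h.choose) (δ * b.2))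
  else Q (t + δ * b.2, 0)

lemma DHMap.book (hQ : DHMap Q) {p : Y} (hp : p ∈ dhS Q) (hp0 : p ≠ Q (0, 0)) :
    ∃ β : (Fin 3 → ℝ) × ℝ → Y, IsChart (Book (Fin 3)) β p ∧
      ∀ b ∈ Book (Fin 3), β b ∈ dhS Q ↔ b.1 = 0 := by
  obtain ⟨t, ht, rfl⟩ := hp
  have ht0 : 0 < t := lt_of_le_of_ne ht.1 (by rintro rfl; exact hp0 rfl)
  have ht1 : t < 1 := lt_of_le_of_ne ht.2 (by rintro rfl; exact hp0 hQ.corner)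
  obtain ⟨δ, hδ, h1, h2⟩ : ∃ δ : ℝ, 0 < δ ∧ 4 * δ ≤ t ∧ 4 * δ ≤ 1 - t := by
    refine ⟨min t (1 - t) / 4, ?_, ?_, ?_⟩
    · have : 0 < min t (1 - t) := lt_min ht0 (by linarith)
      positivity
    · have := min_le_left t (1 - t); linarith
    · have := min_le_right t (1 - t); linarith
  have hbx : ∀ b ∈ Book (Fin 3), ∀ i, 0 ≤ δ * b.1 i ∧ δ * b.1 i ≤ δ := by
    intro b hb i
    exact ⟨mul_nonneg hδ.le (hb.1 i).1, by nlinarith [(hb.1 i).2]⟩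
  have hby : ∀ b ∈ Book (Fin 3), -δ ≤ δ * b.2 ∧ δ * b.2 ≤ δ := by
    intro b hb
    have := abs_le.1 hb.2.2
    constructor <;> nlinarith
  have hpt : ∀ b ∈ Book (Fin 3), ∀ i, dhPage t i (δ * b.1 i) (δ * b.2) ∈ Tri := fun b hb i =>
    dhPage_tri h1 h2 hδ (hbx b hb i).1 (hbx b hb i).2 (hby b hb).1 (hby b hb).2
  have hI : ∀ b ∈ Book (Fin 3), t + δ * b.2 ∈ Set.Icc (0 : ℝ) 1 := fun b hb =>
    ⟨by linarith [(hby b hb).1], by linarith [(hby b hb).2]⟩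
  have hval : ∀ b ∈ Book (Fin 3), ∀ i, (∀ j, j ≠ i → b.1 j = 0) →
      dhBook Q t δ b = Q (dhPage t i (δ * b.1 i) (δ * b.2)) := by
    intro b hb i hi
    unfold dhBook
    split_ifs with h
    · have : h.choose = i := by
        by_contra hc
        exact h.choose_spec (hi _ hc)
      rw [this]
    · push Not at h
      rw [h i, mul_zero, hQ.page_zero (hI b hb)]
  have hpg : ∀ b ∈ Book (Fin 3), ∃ i, (∀ j, j ≠ i → b.1 j = 0) := by
    intro b hb
    by_cases h : ∃ i, b.1 i ≠ 0
    · obtain ⟨i, hi⟩ := h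
      exact ⟨i, fun j hj => (hb.2.1 i j hj.symm).resolve_left hi⟩
    · push Not at h
      exact ⟨0, fun j _ => h j⟩
  have hzero : ∀ b : (Fin 3 → ℝ) × ℝ, ∀ i, (∀ j, j ≠ i → b.1 j = 0) → b.1 i = 0 → b.1 = 0 := by
    intro b i h h0
    funext j
    by_cases hj : j = i
    · rw [hj, h0]; rfl
    · exact h j hj
  have hS : ∀ b ∈ Book (Fin 3), dhBook Q t δ b ∈ dhS Q ↔ b.1 = 0 := by
    intro b hb
    obtain ⟨i, hi⟩ := hpg b hb
    rw [hval b hb i hi]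
    constructor
    · intro h
      by_contra hc
      have hpos : 0 < δ * b.1 i := by
        refine lt_of_le_of_ne (hbx b hb i).1 fun h0 => hc (hzero b i hi ?_)
        exact (mul_eq_zero.1 h0.symm).resolve_left hδ.ne'
      obtain ⟨h3, h4, h5⟩ := dhPage_int (i := i) h1 h2 hδ hpos (hbx b hb i).2 (hby b hb).1 (hby b hb).2
      rcases (hQ.mem_S (hpt b hb i)).1 h with h | h | h <;> linarith
    · intro h
      rw [h]
      simp only [Pi.zero_apply, mul_zero]
      rw [hQ.page_zero (hI b hb)]
      exact ⟨_, hI b hb, rfl⟩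
  have hnb : ∀ i : Fin 3, ∀ x y, 0 ≤ x → x ≤ δ → -δ ≤ y → y ≤ δ →
      Q (dhPage t i x y) ∈ dhBook Q t δ '' Book (Fin 3) := by
    intro i x y h3 h4 h5 h6
    have hb : ((Pi.single i (x / δ) : Fin 3 → ℝ), y / δ) ∈ Book (Fin 3) := by
      refine single_mem_book i _ _ (by positivity) ((div_le_one hδ).2 h4) ?_
      rw [abs_div, abs_of_pos hδ, div_le_one hδ]
      exact abs_le.2 ⟨h5, h6⟩
    refine ⟨_, hb, ?_⟩
    rw [hval _ hb i (fun j hj => by simp [hj])]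
    simp only [Pi.single_eq_same]
    rw [mul_div_cancel₀ _ hδ.ne', mul_div_cancel₀ _ hδ.ne']
  refine ⟨dhBook Q t δ, ⟨Book.isCompact _, zero_mem_book _, ?_, ?_, ?_, ?_⟩, hS⟩
  · have hBk : Book (Fin 3) = ⋃ i : Fin 3, (Book (Fin 3) ∩ {b | ∀ j, j ≠ i → b.1 j = 0}) := by
      ext b
      simp only [Set.mem_iUnion]
      constructor
      · intro hb
        obtain ⟨i, hi⟩ := hpg b hb
        exact ⟨i, hb, hi⟩
      · rintro ⟨i, hb, -⟩; exact hb
    rw [hBk]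
    refine LocallyFinite.continuousOn_iUnion (locallyFinite_of_finite _) ?_ ?_
    · intro i
      refine (Book.isCompact (Fin 3)).isClosed.inter ?_
      have : {b : (Fin 3 → ℝ) × ℝ | ∀ j, j ≠ i → b.1 j = 0} = ⋂ j, ⋂ (_ : j ≠ i), {b | b.1 j = 0} := by
        ext b; simp
      rw [this]
      exact isClosed_iInter fun j => isClosed_iInter fun _ => isClosed_eq (by fun_prop) continuous_const
    · intro i
      refine ContinuousOn.congr (f := fun b => Q (dhPage t i (δ * b.1 i) (δ * b.2))) ?_
        fun b hb => hval b hb.1 i hb.2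
      refine hQ.cont.comp (Continuous.continuousOn ?_) fun b hb => hpt b hb.1 i
      fin_cases i <;> simp only [dhPage] <;> simp <;> constructor <;> fun_prop
  · intro b hb b' hb' h
    obtain ⟨i, hi⟩ := hpg b hb
    obtain ⟨i', hi'⟩ := hpg b' hb'
    by_cases h0 : b.1 = 0
    · have h0' : b'.1 = 0 := (hS b' hb').1 (h ▸ (hS b hb).2 h0)
      rw [hval b hb 0 (fun j _ => by rw [h0]; rfl), hval b' hb' 0 (fun j _ => by rw [h0']; rfl), h0, h0'] at h
      simp only [Pi.zero_apply, mul_zero] at h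
      rw [hQ.page_zero (hI b hb), hQ.page_zero (hI b' hb')] at h
      have e1 := hby b hb
      have e2 := hby b' hb'
      refine Prod.ext (h0.trans h0'.symm) ?_
      rcases hQ.edge _ (hI b hb) _ (hI b' hb') h with h | h | h
      · exact mul_left_cancel₀ hδ.ne' (by linarith)
      · linarith [h.1]
      · linarith [h.1]
    · have hpos : 0 < δ * b.1 i := by
        refine lt_of_le_of_ne (hbx b hb i).1 fun h00 => h0 (hzero b i hi ?_)
        exact (mul_eq_zero.1 h00.symm).resolve_left hδ.ne'
      obtain ⟨h3, h4, h5⟩ := dhPage_int (i := i) h1 h2 hδ hpos (hbx b hb i).2 (hby b hb).1 (hby b hb).2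
      rw [hval b hb i hi, hval b' hb' i' hi'] at h
      have := hQ.int _ _ (hpt b' hb' i') h3 h4 h5 h
      obtain ⟨e1, e2, e3⟩ := dhPage_inj h1 h2 hδ (hbx b hb i).1 (hbx b hb i).2 (hby b hb).1 (hby b hb).2
        (hbx b' hb' i').1 (hbx b' hb' i').2 (hby b' hb').1 (hby b' hb').2 this
      subst e1
      refine Prod.ext (funext fun j => ?_) (mul_left_cancel₀ hδ.ne' e3)
      by_cases hj : j = i
      · rw [hj]; exact mul_left_cancel₀ hδ.ne' e2
      · rw [hi j hj, hi' j hj]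
  · rw [hval 0 (zero_mem_book _) 0 (fun j _ => rfl)]
    simp [dhPage]
  · refine hQ.nhd fun x hx hxp => ?_
    rcases hQ.fib ⟨ht0, ht1⟩ hx hxp with rfl | rfl | rfl
    · refine ⟨{z | z.2 < δ ∧ -δ < z.1 - t ∧ z.1 - t < δ}, ?_, ?_⟩
      · refine IsOpen.mem_nhds (isOpen_three (by fun_prop) (by fun_prop)) ?_
        simp [hδ]
      · rintro z ⟨h3, h4, h5⟩ hz
        have := hnb 0 z.2 (z.1 - t) hz.2.1 h3.le h4.le h5.le
        simpa [dhPage] using this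
    · refine ⟨{z | z.1 < δ ∧ -δ < z.2 - t ∧ z.2 - t < δ}, ?_, ?_⟩
      · refine IsOpen.mem_nhds (isOpen_three (by fun_prop) (by fun_prop)) ?_
        simp [hδ]
      · rintro z ⟨h3, h4, h5⟩ hz
        have := hnb 1 z.1 (z.2 - t) hz.1 h3.le h4.le h5.le
        simpa [dhPage] using this
    · refine ⟨{z | 1 - z.1 - z.2 < δ ∧ -δ < z.2 - t ∧ z.2 - t < δ}, ?_, ?_⟩
      · refine IsOpen.mem_nhds (isOpen_three (by fun_prop) (by fun_prop)) ?_
        simp [hδ]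
      · rintro z ⟨h3, h4, h5⟩ hz
        have := hnb 2 (1 - z.1 - z.2) (z.2 - t) (by linarith [hz.2.2]) h3.le h4.le h5.le
        have e : dhPage t 2 (1 - z.1 - z.2) (z.2 - t) = z := by
          ext <;> simp [dhPage]
        rwa [e] at this

/-- periodic parametrization of the singular circle -/
noncomputable def dhC (Q : ℝ × ℝ → Y) (t : ℝ) : Y := Q (Int.fract t, 0)

omit [T2Space Y] in
lemma DHMap.dhC_cont (hQ : DHMap Q) : Continuous (dhC Q) := by
  refine ContinuousOn.comp_fract'' (f := fun t => Q (t, 0)) ?_ hQ.corner.symm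
  exact hQ.cont.comp (by fun_prop) fun t ht => ⟨ht.1, le_refl _, by simpa using ht.2⟩

omit [T2Space Y] in
lemma DHMap.dhC_eq (hQ : DHMap Q) {s t : ℝ} : dhC Q s = dhC Q t ↔ ∃ n : ℤ, s - t = n := by
  rw [← Int.fract_eq_fract]
  constructor
  · intro h
    rcases hQ.edge _ ⟨Int.fract_nonneg s, (Int.fract_lt_one s).le⟩ _
      ⟨Int.fract_nonneg t, (Int.fract_lt_one t).le⟩ h with h | h | h
    · exact h
    · exact absurd h.2 (Int.fract_lt_one t).ne
    · exact absurd h.1 (Int.fract_lt_one s).ne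
  · intro h; unfold dhC; rw [h]

omit [T2Space Y] in
lemma DHMap.dhC_ne (hQ : DHMap Q) {s t : ℝ} (h1 : 0 < s - t) (h2 : s - t < 1) :
    dhC Q s ≠ dhC Q t := by
  intro h
  obtain ⟨n, hn⟩ := hQ.dhC_eq.1 h
  rw [hn] at h1 h2
  have h3 : 0 < n := by exact_mod_cast h1
  have h4 : n < 1 := by exact_mod_cast h2
  omega

omit [T2Space Y] in
lemma DHMap.dhC_surj (hQ : DHMap Q) {y : Y} (hy : y ∈ dhS Q) (a : ℝ) :
    ∃ s, a ≤ s ∧ s < a + 1 ∧ dhC Q s = y := by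
  obtain ⟨t, ht, rfl⟩ := hy
  have h1 : dhC Q t = Q (t, 0) := by
    rcases eq_or_lt_of_le ht.2 with rfl | h
    · unfold dhC; simp [hQ.corner]
    · unfold dhC; rw [Int.fract_eq_self.2 ⟨ht.1, h⟩]
  refine ⟨a + Int.fract (t - a), by linarith [Int.fract_nonneg (t - a)],
    by linarith [Int.fract_lt_one (t - a)], ?_⟩
  simp only
  rw [← h1, hQ.dhC_eq]
  refine ⟨-⌊t - a⌋, ?_⟩
  unfold Int.fract
  push_cast; ring

omit [T2Space Y] in
lemma DHMap.dhC_mem (_hQ : DHMap Q) (s : ℝ) : dhC Q s ∈ dhS Q :=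
  ⟨_, ⟨Int.fract_nonneg s, (Int.fract_lt_one s).le⟩, rfl⟩

lemma DHMap.arc_closed (hQ : DHMap Q) (a b : ℝ) : IsClosed (dhC Q '' Set.Icc a b) :=
  (isCompact_Icc.image hQ.dhC_cont).isClosed

lemma DHMap.endsGe (hQ : DHMap Q) {p : Y} (hp : p ∈ dhS Q) : EndsGe p (dhS Q \ {p}) Bool := by
  obtain ⟨t, -, -, rfl⟩ := hQ.dhC_surj hp 0
  refine ⟨fun i => if i then (dhC Q '' Set.Icc t (t + 1 / 2))ᶜ else
    (dhC Q '' Set.Icc (t - 1 / 2) t)ᶜ, {dhC Q (t + 1 / 2)}ᶜ, ?_, ?_, ?_, ?_, ?_⟩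
  · refine isOpen_compl_singleton.mem_nhds ?_
    exact (hQ.dhC_ne (by linarith) (by linarith)).symm
  · rintro (_ | _) <;> simp only [if_true, Bool.false_eq_true, if_false] <;>
      exact (hQ.arc_closed _ _).isOpen_compl
  · have key : ∀ y ∈ dhS Q, y ∉ dhC Q '' Set.Icc t (t + 1 / 2) →
        y ∉ dhC Q '' Set.Icc (t - 1 / 2) t → False := by
      intro y hy h1 h2
      obtain ⟨s, hs1, hs2, rfl⟩ := hQ.dhC_surj hy (t - 1 / 2)
      rcases le_total s t with h | h
      · exact h2 ⟨s, ⟨hs1, h⟩, rfl⟩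
      · exact h1 ⟨s, ⟨h, by linarith⟩, rfl⟩
    rintro (_ | _) (_ | _) hij y ⟨⟨hyS, -⟩, -⟩ h1 h2
    · exact hij rfl
    · exact key y hyS (by simpa using h2) (by simpa using h1)
    · exact key y hyS (by simpa using h1) (by simpa using h2)
    · exact hij rfl
  · rintro y ⟨⟨hyS, hyp⟩, hyU⟩
    obtain ⟨s, hs1, hs2, rfl⟩ := hQ.dhC_surj hyS (t - 1 / 2)
    have hs3 : s ≠ t := by rintro rfl; exact hyp rfl
    have hs4 : t - 1 / 2 < s := by
      refine lt_of_le_of_ne hs1 ?_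
      rintro rfl
      exact hyU (hQ.dhC_eq.2 ⟨-1, by push_cast; ring⟩)
    rcases lt_or_gt_of_ne hs3 with h | h
    · refine ⟨true, ?_⟩
      simp only [if_true]
      rintro ⟨s', ⟨h3, h4⟩, he⟩
      exact hQ.dhC_ne (by linarith) (by linarith) he
    · refine ⟨false, ?_⟩
      simp only [Bool.false_eq_true, if_false]
      rintro ⟨s', ⟨h3, h4⟩, he⟩
      exact hQ.dhC_ne (by linarith) (by linarith) he.symm
  · intro i
    rw [mem_closure_iff_nhds]
    intro N hN
    have h1 := hQ.dhC_cont.continuousAt.preimage_mem_nhds hN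
    obtain ⟨ε, hε, hεN⟩ := Metric.mem_nhds_iff.1 h1
    have h2 : 0 < min ε (1 / 2) := by positivity
    have h3 := min_le_left ε (1 / 2)
    have h4 := min_le_right ε (1 / 2)
    cases i
    · refine ⟨dhC Q (t + min ε (1 / 2) / 2), hεN ?_, ?_, hQ.dhC_mem _, ?_⟩
      · rw [Metric.mem_ball, Real.dist_eq, add_sub_cancel_left, abs_of_pos (by linarith)]
        linarith
      · simp only [Bool.false_eq_true, if_false]
        rintro ⟨s', ⟨h5, h6⟩, he⟩
        exact hQ.dhC_ne (by linarith) (by linarith) he.symm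
      · exact hQ.dhC_ne (by linarith) (by linarith)
    · refine ⟨dhC Q (t - min ε (1 / 2) / 2), hεN ?_, ?_, hQ.dhC_mem _, ?_⟩
      · rw [Metric.mem_ball, Real.dist_eq, sub_sub_cancel_left, abs_neg, abs_of_pos (by linarith)]
        linarith
      · simp only [if_true]
        rintro ⟨s', ⟨h5, h6⟩, he⟩
        exact hQ.dhC_ne (by linarith) (by linarith) he
      · exact (hQ.dhC_ne (by linarith) (by linarith)).symm

lemma DHMap.endsLe (hQ : DHMap Q) {p : Y} (hp : p ∈ dhS Q) : EndsLe p (dhS Q \ {p}) Bool := by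
  obtain ⟨t, -, -, rfl⟩ := hQ.dhC_surj hp 0
  intro U hU
  obtain ⟨ε, hε, hεN⟩ := Metric.mem_nhds_iff.1 (hQ.dhC_cont.continuousAt.preimage_mem_nhds hU)
  obtain ⟨δ, hδ, h3, h4⟩ : ∃ δ : ℝ, 0 < δ ∧ δ ≤ ε ∧ δ ≤ 1 / 2 :=
    ⟨min ε (1 / 2), by positivity, min_le_left _ _, min_le_right _ _⟩
  refine ⟨(dhC Q '' Set.Icc (t + δ) (t + 1 - δ))ᶜ, (hQ.arc_closed _ _).isOpen_compl.mem_nhds ?_,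
    fun i => if i then dhC Q '' Set.Ioo (t - δ) t else dhC Q '' Set.Ioo t (t + δ), ?_, ?_⟩
  · rintro ⟨s, ⟨h5, h6⟩, he⟩
    exact hQ.dhC_ne (by linarith) (by linarith) he
  · rintro y ⟨⟨hyS, hyp⟩, hyW⟩
    obtain ⟨s, hs1, hs2, rfl⟩ := hQ.dhC_surj hyS (t - δ)
    have hs3 : s ≠ t := by rintro rfl; exact hyp rfl
    have hs4 : t - δ < s := by
      refine lt_of_le_of_ne hs1 ?_
      rintro rfl
      exact hyW ⟨t + 1 - δ, ⟨by linarith, le_refl _⟩, hQ.dhC_eq.2 ⟨1, by push_cast; ring⟩⟩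
    have hs5 : s < t + δ := by
      by_contra hc
      exact hyW ⟨s, ⟨by linarith, by linarith⟩, rfl⟩
    rcases lt_or_gt_of_ne hs3 with h | h
    · exact ⟨true, by simp only [if_true]; exact ⟨s, ⟨hs4, h⟩, rfl⟩⟩
    · exact ⟨false, by simp only [Bool.false_eq_true, if_false]; exact ⟨s, ⟨h, hs5⟩, rfl⟩⟩
  · rintro (_ | _)
    · simp only [Bool.false_eq_true, if_false]
      refine ⟨?_, isPreconnected_Ioo.image _ hQ.dhC_cont.continuousOn⟩
      rintro _ ⟨s, ⟨h5, h6⟩, rfl⟩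
      refine ⟨⟨hQ.dhC_mem _, hQ.dhC_ne (by linarith) (by linarith)⟩, hεN ?_⟩
      rw [Metric.mem_ball, Real.dist_eq, abs_of_pos (by linarith)]
      linarith
    · simp only [if_true]
      refine ⟨?_, isPreconnected_Ioo.image _ hQ.dhC_cont.continuousOn⟩
      rintro _ ⟨s, ⟨h5, h6⟩, rfl⟩
      refine ⟨⟨hQ.dhC_mem _, (hQ.dhC_ne (by linarith) (by linarith)).symm⟩, hεN ?_⟩
      rw [Metric.mem_ball, Real.dist_eq, abs_of_neg (by linarith)]
      linarith

end dh3

/-- Summary of the topological properties of the dunce hat that we use. -/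
structure DHSpace {Y : Type*} [TopologicalSpace Y] (S : Set Y) (p0 : Y) : Prop where
  closed : IsClosed S
  disc : ∀ p, p ∉ S → ∃ γ : ℂ → Y, IsChart (Metric.closedBall (0 : ℂ) 1) γ p
  book : ∀ p ∈ S, p ≠ p0 → ∃ β : (Fin 3 → ℝ) × ℝ → Y, IsChart (Book (Fin 3)) β p ∧
      ∀ b ∈ Book (Fin 3), β b ∈ S ↔ b.1 = 0
  endsGe : ∀ p ∈ S, EndsGe p (S \ {p}) Bool
  endsLe : ∀ p ∈ S, EndsLe p (S \ {p}) Bool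
  conn : ∀ A : Set Y, A.Finite → IsPreconnected (Sᶜ \ A)
  mem : p0 ∈ S
  sector : SectorProp p0 S

lemma exists_DHSpace {Y : Type*} [TopologicalSpace Y] [T2Space Y] (Φ : Y ≃ₜ DunceHat) :
    ∃ (S : Set Y) (p0 : Y), DHSpace S p0 := by
  have hQ := dunce_map Φ
  exact ⟨_, _, ⟨hQ.closed, fun p hp => hQ.disc hp, fun p hp h => hQ.book hp h,
    fun p hp => hQ.endsGe hp, fun p hp => hQ.endsLe hp, fun A hA => hQ.conn hA,
    ⟨0, by simp, rfl⟩, hQ.sector⟩⟩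


/-! ### The geometric realization -/

section geom
variable [Fintype V] {K : Finset (Finset V)}

open scoped Classical in
/-- support of a point -/
noncomputable def gsupp (y : geomReal K) : Finset V := univ.filter fun v => y.1 v ≠ 0

omit [DecidableEq V] in
lemma mem_gsupp {y : geomReal K} {v : V} : v ∈ gsupp y ↔ y.1 v ≠ 0 := by
  simp [gsupp]

omit [DecidableEq V] in
lemma mem_gsupp_pos {y : geomReal K} {v : V} : v ∈ gsupp y ↔ 0 < y.1 v := by
  rw [mem_gsupp]
  exact ⟨fun h => lt_of_le_of_ne (y.2.1 v) h.symm, fun h => h.ne'⟩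

omit [DecidableEq V] in
lemma gsupp_mem (y : geomReal K) : gsupp y ∈ K := by
  obtain ⟨F, hF, h⟩ := y.2.2.2
  have : gsupp y = F := by
    ext v
    rw [mem_gsupp]
    exact (Set.ext_iff.1 h v).trans Finset.mem_coe
  rw [this]; exact hF

omit [DecidableEq V] in
lemma gsupp_sum (y : geomReal K) : ∑ v ∈ gsupp y, y.1 v = 1 := by
  rw [← y.2.2.1]
  refine Finset.sum_subset (Finset.subset_univ _) fun v _ hv => ?_
  by_contra h
  exact hv (mem_gsupp.2 h)

omit [DecidableEq V] in
lemma gsupp_sum' (y : geomReal K) {F : Finset V} (h : gsupp y ⊆ F) : ∑ v ∈ F, y.1 v = 1 := by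
  rw [← gsupp_sum y]
  refine (Finset.sum_subset h fun v _ hv => ?_).symm
  by_contra h
  exact hv (mem_gsupp.2 h)

omit [DecidableEq V] in
lemma y_le_one (y : geomReal K) (v : V) : y.1 v ≤ 1 := by
  rw [← y.2.2.1]
  exact Finset.single_le_sum (fun i _ => y.2.1 i) (Finset.mem_univ v)

omit [DecidableEq V] in
lemma y_add_le (y : geomReal K) {v w : V} (h : v ≠ w) : y.1 v + y.1 w ≤ 1 := by
  classical
  rw [← y.2.2.1, ← Finset.sum_pair h]
  exact Finset.sum_le_sum_of_subset_of_nonneg (Finset.subset_univ _) fun i _ _ => y.2.1 i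

omit [DecidableEq V] in
/-- criterion for membership -/
lemma geom_mem {f : V → ℝ} {F : Finset V} (hF : F ∈ K) (h1 : ∀ v ∈ F, 0 < f v)
    (h2 : ∀ v, v ∉ F → f v = 0) (h3 : ∑ v ∈ F, f v = 1) : f ∈ geomReal K := by
  refine ⟨fun v => ?_, ?_, F, hF, ?_⟩
  · by_cases h : v ∈ F
    · exact (h1 v h).le
    · rw [h2 v h]
  · rw [← h3]
    exact (Finset.sum_subset (Finset.subset_univ _) fun v _ hv => h2 v hv).symm
  · ext v
    simp only [Set.mem_ofPred_eq, Finset.mem_coe]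
    constructor
    · intro h; by_contra hc; exact h (h2 v hc)
    · intro h; exact (h1 v h).ne'

omit [DecidableEq V] in
lemma gsupp_eq {y : geomReal K} {F : Finset V} (h1 : ∀ v ∈ F, 0 < y.1 v)
    (h2 : ∀ v, v ∉ F → y.1 v = 0) : gsupp y = F := by
  ext v
  rw [mem_gsupp]
  constructor
  · intro h; by_contra hc; exact h (h2 v hc)
  · intro h; exact (h1 v h).ne'

omit [DecidableEq V] in
lemma cont_coord (v : V) : Continuous fun y : geomReal K => y.1 v :=
  (continuous_apply v).comp continuous_subtype_val

omit [DecidableEq V] in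
lemma isOpen_upper {𝒜 : Finset V → Prop} (h : ∀ F G, 𝒜 F → F ⊆ G → G ∈ K → 𝒜 G) :
    IsOpen {y : geomReal K | 𝒜 (gsupp y)} := by
  rw [isOpen_iff_mem_nhds]
  intro y hy
  have : IsOpen (⋂ v ∈ gsupp y, {z : geomReal K | 0 < z.1 v}) :=
    isOpen_biInter_finset fun v _ => isOpen_lt continuous_const (cont_coord v)
  refine Filter.mem_of_superset (this.mem_nhds ?_) ?_
  · simp only [Set.mem_iInter]
    exact fun v hv => mem_gsupp_pos.1 hv
  · intro z hz
    simp only [Set.mem_iInter] at hz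
    exact h _ _ hy (fun v hv => mem_gsupp_pos.2 (hz v hv)) (gsupp_mem z)

omit [DecidableEq V] in
lemma face_ne {F : Finset V} (hK : IsCplx K) (hF : F ∈ K) : F.Nonempty := by
  rw [Finset.nonempty_iff_ne_empty]; rintro rfl; exact hK.1 hF

open scoped Classical in
/-- barycentre -/
lemma exists_bary (hK : IsCplx K) {F : Finset V} (hF : F ∈ K) : ∃ y : geomReal K, gsupp y = F := by
  have hne := face_ne hK hF
  have hc : (0 : ℝ) < F.card := by exact_mod_cast hne.card_pos
  refine ⟨⟨fun v => if v ∈ F then 1 / (F.card : ℝ) else 0, geom_mem hF ?_ ?_ ?_⟩, gsupp_eq ?_ ?_⟩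
  · intro v hv; simp only [hv, if_true]; positivity
  · intro v hv; simp [hv]
  · rw [Finset.sum_congr rfl (g := fun _ => 1 / (F.card : ℝ)) (fun v hv => by simp [hv])]
    rw [Finset.sum_const, nsmul_eq_mul]; field_simp
  · intro v hv; simp only [hv, if_true]; positivity
  · intro v hv; simp [hv]

omit [DecidableEq V] in
/-- segments -/
lemma seg_mem {F : Finset V} (hF : F ∈ K) {q b : geomReal K} (hq : gsupp q ⊆ F)
    (hb : gsupp b = F) {t : ℝ} (ht : 0 < t) (ht1 : t ≤ 1) :
    ∃ y : geomReal K, y.1 = (fun v => (1 - t) * q.1 v + t * b.1 v) ∧ gsupp y = F := by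
  have h1 : ∀ v ∈ F, 0 < (1 - t) * q.1 v + t * b.1 v := by
    intro v hv
    rw [← hb, mem_gsupp_pos] at hv
    have := q.2.1 v
    have h2 : 0 ≤ (1 - t) * q.1 v := mul_nonneg (by linarith) this
    have : 0 < t * b.1 v := by positivity
    linarith
  have h2 : ∀ v, v ∉ F → (1 - t) * q.1 v + t * b.1 v = 0 := by
    intro v hv
    have e1 : q.1 v = 0 := by by_contra h; exact hv (hq (mem_gsupp.2 h))
    have e2 : b.1 v = 0 := by by_contra h; exact hv (hb ▸ (mem_gsupp.2 h))
    rw [e1, e2]; ring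
  refine ⟨⟨_, geom_mem hF h1 h2 ?_⟩, rfl, gsupp_eq h1 h2⟩
  rw [Finset.sum_add_distrib, ← Finset.mul_sum, ← Finset.mul_sum, gsupp_sum' q hq,
    gsupp_sum' b hb.subset]
  ring

lemma mem_closure_cell (hK : IsCplx K) {F : Finset V} (hF : F ∈ K) {q : geomReal K}
    (hq : gsupp q ⊆ F) {N : Set (geomReal K)} (hN : N ∈ nhds q) : ∃ y ∈ N, gsupp y = F := by
  obtain ⟨b, hb⟩ := exists_bary hK hF
  have h := fun t (ht : 0 < t ∧ t ≤ 1) => seg_mem hF hq hb ht.1 ht.2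
  obtain ⟨U, hU, hUN⟩ := mem_nhds_induced _ _ _ |>.1 hN
  have hc : Filter.Tendsto (fun t : ℝ => (fun v => (1 - t) * q.1 v + t * b.1 v))
      (nhdsWithin 0 (Set.Ioi 0)) (nhds q.1) := by
    refine Filter.Tendsto.mono_left ?_ nhdsWithin_le_nhds
    have := Continuous.tendsto (f := fun t : ℝ => (fun v => (1 - t) * q.1 v + t * b.1 v))
      (by fun_prop) 0
    simpa using this
  have hI : ∀ᶠ s in nhdsWithin (0 : ℝ) (Set.Ioi 0), s ∈ Set.Ioo (0 : ℝ) 1 :=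
      Ioo_mem_nhdsGT (by norm_num)
  obtain ⟨t, ht1, ht2⟩ := ((hc.eventually_mem hU).and hI).exists
  obtain ⟨y, hy1, hy2⟩ := h t ⟨ht2.1, ht2.2.le⟩
  refine ⟨y, hUN ?_, hy2⟩
  rw [Set.mem_preimage, hy1]; exact ht1

omit [DecidableEq V] in
/-- convex subsets of an open cell are connected -/
lemma cell_preconn {F : Finset V} (hF : F ∈ K) (v : V) (η : ℝ) :
    IsPreconnected {y : geomReal K | gsupp y = F ∧ η < y.1 v} := by
  rw [← Topology.IsInducing.subtypeVal.isPreconnected_image]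
  refine Convex.isPreconnected ?_
  rw [convex_iff_forall_pos]
  rintro _ ⟨q, ⟨hq, hq1⟩, rfl⟩ _ ⟨b, ⟨hb, hb1⟩, rfl⟩ s t hs ht hst
  obtain ⟨y, hy1, hy2⟩ := seg_mem hF hq.subset hb ht (by linarith)
  have hs' : s = 1 - t := by linarith
  refine ⟨y, ⟨hy2, ?_⟩, ?_⟩
  · rw [hy1, ← hs']
    simp only
    have e1 := mul_lt_mul_of_pos_left hq1 hs
    have e2 := mul_lt_mul_of_pos_left hb1 ht
    have e3 : η = s * η + t * η := by rw [← add_mul, hst, one_mul]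
    rw [e3]; exact add_lt_add e1 e2
  · rw [hy1, ← hs']; rfl

omit [DecidableEq V] in
lemma vert_coord {p : geomReal K} {v : V} (hp : gsupp p = {v}) (w : V) [DecidableEq V] :
    p.1 w = if w = v then 1 else 0 := by
  split_ifs with h
  · have := gsupp_sum p
    rw [hp, Finset.sum_singleton] at this
    rw [h, this]
  · by_contra hc
    have := mem_gsupp.2 hc
    rw [hp, Finset.mem_singleton] at this
    exact h this

lemma eq_vert {p q : geomReal K} {v : V} (hp : gsupp p = {v}) (hq : gsupp q = {v}) : p = q := by
  apply Subtype.ext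
  funext w
  rw [vert_coord hp, vert_coord hq]

lemma vert_nhds {p : geomReal K} {v : V} (hp : gsupp p = {v}) {U : Set (geomReal K)}
    (hU : U ∈ nhds p) : ∃ η : ℝ, 0 ≤ η ∧ η < 1 ∧ ∀ y : geomReal K, η < y.1 v → y ∈ U := by
  obtain ⟨ε, hε, hεU⟩ := Metric.mem_nhds_iff.1 hU
  refine ⟨1 - min ε 1, by linarith [min_le_right ε 1], by
    have : 0 < min ε 1 := by positivity
    linarith, fun y hy => hεU ?_⟩
  have hm := min_le_left ε 1
  rw [Metric.mem_ball, Subtype.dist_eq, dist_pi_lt_iff hε]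
  intro w
  rw [vert_coord hp, Real.dist_eq]
  split_ifs with h
  · rw [h, abs_sub_comm, abs_of_nonneg (by linarith [y_le_one y v])]
    linarith
  · rw [sub_zero, abs_of_nonneg (y.2.1 w)]
    linarith [y_add_le y h]

lemma vert_nhds' {p : geomReal K} {v : V} (hp : gsupp p = {v}) {η : ℝ} (hη : η < 1) :
    {y : geomReal K | η < y.1 v} ∈ nhds p := by
  refine (isOpen_lt continuous_const (cont_coord v)).mem_nhds ?_
  show η < p.1 v
  rw [vert_coord hp]; simpa using hη

omit [DecidableEq V] in
open scoped Classical in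
/-- total version -/
noncomputable def mkY (p : geomReal K) (f : V → ℝ) : geomReal K :=
  if h : f ∈ geomReal K then ⟨f, h⟩ else p

omit [DecidableEq V] in
lemma mkY_val (p : geomReal K) {f : V → ℝ} (h : f ∈ geomReal K) : (mkY p f).1 = f := by
  unfold mkY; simp [h]

omit [DecidableEq V] in
lemma mkY_cont {E : Type*} [TopologicalSpace E] {B : Set E} (p : geomReal K) {f : E → V → ℝ}
    (hf : ContinuousOn f B) (h : ∀ b ∈ B, f b ∈ geomReal K) :
    ContinuousOn (fun b => mkY p (f b)) B := by
  rw [Topology.IsInducing.subtypeVal.continuousOn_iff]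
  exact hf.congr fun b hb => mkY_val p (h b hb)

end geom


lemma complex_mk_cont {E : Type*} [TopologicalSpace E] {f g : E → ℝ} (hf : Continuous f)
    (hg : Continuous g) : Continuous fun x => (⟨f x, g x⟩ : ℂ) := by
  have : ∀ x, (⟨f x, g x⟩ : ℂ) = ((f x : ℝ) : ℂ) + ((g x : ℝ) : ℂ) * Complex.I := fun z =>
    Complex.mk_eq_add_mul_I _ _
  simp only [this]
  fun_prop

/-- A book with two pages is a disc. -/
lemma book_two_disc {ι Y : Type*} [Fintype ι] [TopologicalSpace Y] [T2Space Y]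
    {β : (ι → ℝ) × ℝ → Y} {p : Y} (hβ : IsChart (Book ι) β p) (hc : Fintype.card ι = 2) :
    ∃ γ : ℂ → Y, IsChart (Metric.closedBall (0 : ℂ) 1) γ p := by
  classical
  obtain ⟨i, j, hij, hk⟩ : ∃ i j : ι, i ≠ j ∧ ∀ k, k = i ∨ k = j := by
    rw [← Finset.card_univ, Finset.card_eq_two] at hc
    obtain ⟨i, j, hij, h⟩ := hc
    refine ⟨i, j, hij, fun k => ?_⟩
    have := Finset.mem_univ k
    rw [h] at this
    simpa using this
  set g : ℂ → (ι → ℝ) × ℝ := fun z => (fun k => if k = i then max z.re 0 else max (-z.re) 0, z.im)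
    with hg
  have hgi : ∀ z, (g z).1 i = max z.re 0 := fun z => by simp [hg]
  have hgj : ∀ z, (g z).1 j = max (-z.re) 0 := fun z => by simp [hg, hij.symm]
  have hgB : ∀ z ∈ Metric.closedBall (0 : ℂ) 1, g z ∈ Book ι := by
    intro z hz
    rw [mem_closedBall_zero_iff] at hz
    have h4 := abs_le.1 ((Complex.abs_re_le_norm z).trans hz)
    have h5 := ((Complex.abs_im_le_norm z).trans hz)
    have hor : max z.re 0 = 0 ∨ max (-z.re) 0 = 0 := by
      rcases le_total z.re 0 with h | h
      · left; exact max_eq_right h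
      · right; exact max_eq_right (by linarith)
    refine ⟨fun k => ?_, fun k l hkl => ?_, h5⟩
    · rcases hk k with rfl | rfl
      · rw [hgi]; exact ⟨le_max_right _ _, max_le h4.2 zero_le_one⟩
      · rw [hgj]; exact ⟨le_max_right _ _, max_le (by linarith) zero_le_one⟩
    · rcases hk k with rfl | rfl <;> rcases hk l with rfl | rfl
      · exact absurd rfl hkl
      · rw [hgi, hgj]; exact hor
      · rw [hgi, hgj]; exact hor.symm
      · exact absurd rfl hkl
  have hre : ∀ x : ℝ, max x 0 - max (-x) 0 = x := by
    intro x
    rcases le_total x 0 with h | h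
    · rw [max_eq_right h, max_eq_left (by linarith)]; ring
    · rw [max_eq_left h, max_eq_right (by linarith)]; ring
  have hg0 : g 0 = 0 := by
    refine Prod.ext (funext fun k => ?_) rfl
    simp [hg]
  refine ⟨fun z => β (g z), ⟨isCompact_closedBall _ _, by simp, ?_, ?_, ?_, ?_⟩⟩
  · refine hβ.cont.comp (Continuous.continuousOn ?_) hgB
    refine Continuous.prodMk (continuous_pi fun k => ?_) Complex.continuous_im
    by_cases h : k = i
    · simp only [h, if_true]; exact Complex.continuous_re.max continuous_const
    · simp only [h, if_false]; exact Complex.continuous_re.neg.max continuous_const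
  · intro z hz w hw h
    have e := hβ.inj (hgB z hz) (hgB w hw) h
    refine Complex.ext ?_ (congrArg Prod.snd e)
    rw [← hre z.re, ← hre w.re, ← hgi, ← hgj, ← hgi, ← hgj, e]
  · rw [hg0]; exact hβ.map_zero
  · have hU : {b : (ι → ℝ) × ℝ | ‖(⟨b.1 i - b.1 j, b.2⟩ : ℂ)‖ < 1} ∈ nhds 0 := by
      refine IsOpen.mem_nhds (isOpen_lt ?_ continuous_const) (by
        have : (⟨0, 0⟩ : ℂ) = 0 := rfl
        simp [this])
      exact (complex_mk_cont (by fun_prop) (by fun_prop)).norm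
    refine Filter.mem_of_superset (hβ.small hU) ?_
    rintro _ ⟨b, ⟨hb, hbU⟩, rfl⟩
    refine ⟨⟨b.1 i - b.1 j, b.2⟩, by rw [mem_closedBall_zero_iff]; exact le_of_lt hbU, ?_⟩
    have hi := (hb.1 i).1
    have hj := (hb.1 j).1
    suffices hh : g ⟨b.1 i - b.1 j, b.2⟩ = b from congrArg β hh
    refine Prod.ext (funext fun k => ?_) rfl
    rcases hk k with rfl | rfl
    · rw [hgi]
      rcases hb.2.1 k j hij with h | h <;> simp only [h]
      · exact max_eq_right (by linarith)
      · rw [sub_zero]; exact max_eq_left hi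
    · rw [hgj]
      rcases hb.2.1 i k hij with h | h <;> simp only [h]
      · rw [zero_sub, neg_neg]; exact max_eq_left hj
      · exact max_eq_right (by linarith)

section geom2
variable [Fintype V] {K : Finset (Finset V)}

/-- index set of the triangles at an edge -/
abbrev Wing (K : Finset (Finset V)) (u v : V) : Type :=
  {w : V // w ∉ ({u, v} : Finset V) ∧ insert w ({u, v} : Finset V) ∈ K}

/-- coordinates of the chart at an edge -/
noncomputable def edgeF (p : V → ℝ) (u v : V) (δ : ℝ) (b : (Wing K u v → ℝ) × ℝ) : V → ℝ :=
  fun w => if w = u then p u - δ * (∑ i, b.1 i) / 2 + δ * b.2 else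
    if w = v then p v - δ * (∑ i, b.1 i) / 2 - δ * b.2 else
    if h : w ∉ ({u, v} : Finset V) ∧ insert w ({u, v} : Finset V) ∈ K then δ * b.1 ⟨w, h⟩ else 0

lemma edge_chart (_hK : IsCplx K) (h3 : ∀ F ∈ K, F.card ≤ 3) {u v : V} (huv : u ≠ v)
    {p : geomReal K} (hp : gsupp p = {u, v}) :
    ∃ β : (Wing K u v → ℝ) × ℝ → geomReal K, IsChart (Book (Wing K u v)) β p ∧
      ∀ b ∈ Book (Wing K u v), (b.1 = 0 → gsupp (β b) = {u, v}) ∧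
        (b.1 ≠ 0 → (gsupp (β b)).card = 3) := by
  have hpu : 0 < p.1 u := mem_gsupp_pos.1 (by rw [hp]; simp)
  have hpv : 0 < p.1 v := mem_gsupp_pos.1 (by rw [hp]; simp)
  have hps : p.1 u + p.1 v = 1 := by
    have := gsupp_sum p
    rwa [hp, Finset.sum_pair huv] at this
  have hp0 : ∀ w, w ≠ u → w ≠ v → p.1 w = 0 := by
    intro w h1 h2
    by_contra hc
    have := mem_gsupp.2 hc
    rw [hp] at this
    simp [h1, h2] at this
  have heK : ({u, v} : Finset V) ∈ K := hp ▸ gsupp_mem p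
  obtain ⟨δ, hδ, hδu, hδv⟩ : ∃ δ : ℝ, 0 < δ ∧ 2 * δ ≤ p.1 u ∧ 2 * δ ≤ p.1 v := by
    refine ⟨min (p.1 u) (p.1 v) / 2, by have := lt_min hpu hpv; positivity, ?_, ?_⟩
    · have := min_le_left (p.1 u) (p.1 v); linarith
    · have := min_le_right (p.1 u) (p.1 v); linarith
  set f : (Wing K u v → ℝ) × ℝ → V → ℝ := edgeF (K := K) p.1 u v δ with hf
  have fu : ∀ b, f b u = p.1 u - δ * (∑ i, b.1 i) / 2 + δ * b.2 := fun b => by simp [hf, edgeF]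
  have fv : ∀ b, f b v = p.1 v - δ * (∑ i, b.1 i) / 2 - δ * b.2 := fun b => by
    simp [hf, edgeF, huv.symm]
  have hwne : ∀ i : Wing K u v, i.1 ≠ u ∧ i.1 ≠ v := fun i => by
    have := i.2.1
    simpa using this
  have fw : ∀ b (i : Wing K u v), f b i.1 = δ * b.1 i := fun b i => by
    have h1 := hwne i
    have h2 := i.2
    simp only [hf, edgeF, h1.1, h1.2, if_false]
    rw [dif_pos h2]
  have f0 : ∀ b w, w ∉ ({u, v} : Finset V) → insert w ({u, v} : Finset V) ∉ K → f b w = 0 := by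
    intro b w h1 h2
    have h1' : w ≠ u ∧ w ≠ v := by simpa using h1
    simp only [hf, edgeF, h1'.1, h1'.2, if_false]
    rw [dif_neg (fun h => h2 h.2)]
  have hsum : ∀ b : (Wing K u v → ℝ) × ℝ, ∀ i, (∀ j, j ≠ i → b.1 j = 0) → ∑ k, b.1 k = b.1 i :=
    fun b i h => Finset.sum_eq_single i (fun j _ hj => h j hj) (fun h => absurd (Finset.mem_univ _) h)
  -- face description
  have hA : ∀ b ∈ Book (Wing K u v), b.1 = 0 → (∀ x ∈ ({u, v} : Finset V), 0 < f b x) ∧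
      (∀ x, x ∉ ({u, v} : Finset V) → f b x = 0) ∧ ∑ x ∈ ({u, v} : Finset V), f b x = 1 := by
    intro b hb h0
    have hy := abs_le.1 hb.2.2
    have hS : ∑ i, b.1 i = 0 := by rw [h0]; simp
    refine ⟨?_, ?_, ?_⟩
    · intro x hx
      simp only [Finset.mem_insert, Finset.mem_singleton] at hx
      rcases hx with rfl | rfl
      · rw [fu, hS]; nlinarith
      · rw [fv, hS]; nlinarith
    · intro x hx
      by_cases h : insert x ({u, v} : Finset V) ∈ K
      · have := fw b ⟨x, hx, h⟩
        rw [h0] at this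
        simpa using this
      · exact f0 b x hx h
    · rw [Finset.sum_pair huv, fu, fv, hS]; linarith
  have hB : ∀ b ∈ Book (Wing K u v), ∀ i, b.1 i ≠ 0 →
      (∀ x ∈ insert i.1 ({u, v} : Finset V), 0 < f b x) ∧
      (∀ x, x ∉ insert i.1 ({u, v} : Finset V) → f b x = 0) ∧
      ∑ x ∈ insert i.1 ({u, v} : Finset V), f b x = 1 := by
    intro b hb i hi
    have hy := abs_le.1 hb.2.2
    have hz : ∀ j, j ≠ i → b.1 j = 0 := fun j hj => (hb.2.1 i j hj.symm).resolve_left hi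
    have hS := hsum b i hz
    have hx0 : 0 < b.1 i := lt_of_le_of_ne (hb.1 i).1 hi.symm
    have hx1 := (hb.1 i).2
    refine ⟨?_, ?_, ?_⟩
    · intro x hx
      simp only [Finset.mem_insert, Finset.mem_singleton] at hx
      rcases hx with rfl | rfl | rfl
      · rw [fw]; positivity
      · rw [fu, hS]; nlinarith
      · rw [fv, hS]; nlinarith
    · intro x hx
      rw [Finset.mem_insert, not_or] at hx
      by_cases h : insert x ({u, v} : Finset V) ∈ K
      · have := fw b ⟨x, hx.2, h⟩
        rw [hz _ (fun h => hx.1 (congrArg Subtype.val h))] at this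
        simpa using this
      · exact f0 b x hx.2 h
    · rw [Finset.sum_insert i.2.1, Finset.sum_pair huv, fu, fv, fw, hS]; linarith
  have hmem : ∀ b ∈ Book (Wing K u v), f b ∈ geomReal K := by
    intro b hb
    by_cases h0 : b.1 = 0
    · obtain ⟨h1, h2, h3⟩ := hA b hb h0
      exact geom_mem heK h1 h2 h3
    · obtain ⟨i, hi⟩ := Function.ne_iff.1 h0
      obtain ⟨h1, h2, h3⟩ := hB b hb i hi
      exact geom_mem i.2.2 h1 h2 h3
  refine ⟨fun b => mkY p (f b), ⟨Book.isCompact _, zero_mem_book _, ?_, ?_, ?_, ?_⟩, ?_⟩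
  · refine mkY_cont p (Continuous.continuousOn (continuous_pi fun w => ?_)) hmem
    simp only [hf, edgeF]
    split_ifs <;> fun_prop
  · intro b hb b' hb' h
    have e : f b = f b' := by
      rw [← mkY_val p (hmem b hb), ← mkY_val p (hmem b' hb')]
      exact congrArg Subtype.val h
    refine Prod.ext (funext fun i => ?_) ?_
    · have := congrFun e i.1
      rw [fw, fw] at this
      exact mul_left_cancel₀ hδ.ne' this
    · have e1 := congrFun e u
      have e2 := congrFun e v
      rw [fu, fu] at e1
      rw [fv, fv] at e2
      exact mul_left_cancel₀ hδ.ne' (by linarith)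
  · apply Subtype.ext
    rw [mkY_val p (hmem 0 (zero_mem_book _))]
    funext w
    by_cases h1 : w = u
    · subst h1; rw [fu]; simp
    by_cases h2 : w = v
    · subst h2; rw [fv]; simp
    rw [hp0 w h1 h2]
    exact (hA 0 (zero_mem_book _) rfl).2.1 w (by simp [h1, h2])
  · have hop : IsOpen ({y : geomReal K | |y.1 u - p.1 u| < δ / 2} ∩ {y | |y.1 v - p.1 v| < δ / 2}) :=
      (isOpen_lt ((cont_coord u).sub continuous_const).abs continuous_const).inter
        (isOpen_lt ((cont_coord v).sub continuous_const).abs continuous_const)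
    refine Filter.mem_of_superset (hop.mem_nhds (by simp [hδ])) ?_
    rintro y ⟨hyu, hyv⟩
    have hyu' : |y.1 u - p.1 u| < δ / 2 := hyu
    have hyv' : |y.1 v - p.1 v| < δ / 2 := hyv
    rw [abs_lt] at hyu' hyv'
    have hsub : ({u, v} : Finset V) ⊆ gsupp y := by
      intro x hx
      simp only [Finset.mem_insert, Finset.mem_singleton] at hx
      rw [mem_gsupp_pos]
      rcases hx with rfl | rfl <;> linarith
    have hKx : ∀ x, x ∉ ({u, v} : Finset V) → y.1 x ≠ 0 → gsupp y = insert x {u, v} := by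
      intro x hx hyx
      refine (Finset.eq_of_subset_of_card_le ?_ ?_).symm
      · exact Finset.insert_subset (mem_gsupp.2 hyx) hsub
      · rw [Finset.card_insert_of_notMem hx, Finset.card_pair huv]
        exact h3 _ (gsupp_mem y)
    have hyS : ∑ i : Wing K u v, y.1 i.1 = 1 - y.1 u - y.1 v := by
      have e1 : ∑ i : Wing K u v, y.1 i.1 = ∑ w ∈ univ \ {u, v}, y.1 w := by
        rw [← Finset.sum_subtype (univ.filter fun w => w ∉ ({u, v} : Finset V) ∧
          insert w ({u, v} : Finset V) ∈ K) (by simp) (fun w => y.1 w)]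
        refine Finset.sum_subset ?_ ?_
        · intro w hw
          rw [Finset.mem_filter] at hw
          simpa using hw.2.1
        · intro w hw hw'
          have hw2 : w ∉ ({u, v} : Finset V) := (Finset.mem_sdiff.1 hw).2
          by_contra hc
          apply hw'
          rw [Finset.mem_filter]
          exact ⟨Finset.mem_univ _, hw2, hKx w hw2 hc ▸ gsupp_mem y⟩
      rw [e1]
      have := Finset.sum_sdiff (f := fun w => y.1 w) (Finset.subset_univ ({u, v} : Finset V))
      rw [Finset.sum_pair huv, y.2.2.1] at this
      linarith
    have hsmall : ∀ i : Wing K u v, y.1 i.1 ≤ δ := by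
      intro i
      have : y.1 i.1 ≤ ∑ i : Wing K u v, y.1 i.1 :=
        Finset.single_le_sum (f := fun i : Wing K u v => y.1 i.1) (fun i _ => y.2.1 i.1)
          (Finset.mem_univ i)
      linarith
    have hb : ((fun i => y.1 i.1 / δ, ((y.1 u - p.1 u) - (y.1 v - p.1 v)) / (2 * δ)) :
        (Wing K u v → ℝ) × ℝ) ∈ Book (Wing K u v) := by
      refine ⟨fun i => ⟨div_nonneg (y.2.1 _) hδ.le, (div_le_one hδ).2 (hsmall i)⟩, ?_, ?_⟩
      · intro i j hij
        by_contra hc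
        push Not at hc
        have hi : y.1 i.1 ≠ 0 := fun h => hc.1 (by simp [h])
        have hj : y.1 j.1 ≠ 0 := fun h => hc.2 (by simp [h])
        have h4 := mem_gsupp.2 hj
        rw [hKx i.1 i.2.1 hi, Finset.mem_insert] at h4
        rcases h4 with h4 | h4
        · exact hij (Subtype.ext h4.symm)
        · exact j.2.1 h4
      · simp only
        rw [abs_div, abs_of_pos (show (0 : ℝ) < 2 * δ by positivity), div_le_one (by positivity),
          abs_le]
        constructor <;> linarith
    refine ⟨_, hb, ?_⟩
    apply Subtype.ext
    simp only
    rw [mkY_val p (hmem _ hb)]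
    have hdS : δ * ∑ i : Wing K u v, y.1 i.1 / δ = 1 - y.1 u - y.1 v := by
      rw [← Finset.sum_div, hyS]; field_simp
    have hd2 : δ * (((y.1 u - p.1 u) - (y.1 v - p.1 v)) / (2 * δ)) =
      ((y.1 u - p.1 u) - (y.1 v - p.1 v)) / 2 := by field_simp
    funext x
    by_cases h1 : x = u
    · subst h1
      rw [fu]; simp only; rw [hdS, hd2]; linarith
    by_cases h2 : x = v
    · subst h2
      rw [fv]; simp only; rw [hdS, hd2]; linarith
    have hx : x ∉ ({u, v} : Finset V) := by simp [h1, h2]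
    by_cases h : insert x ({u, v} : Finset V) ∈ K
    · rw [fw _ ⟨x, hx, h⟩]
      simp only
      field_simp
    · rw [f0 _ _ hx h]
      by_contra hc
      exact h (hKx x hx (Ne.symm hc) ▸ gsupp_mem y)
  · intro b hb
    constructor
    · intro h0
      obtain ⟨h1, h2, -⟩ := hA b hb h0
      refine gsupp_eq ?_ ?_ <;> rw [mkY_val p (hmem b hb)]
      · exact h1
      · exact h2
    · intro h0
      obtain ⟨i, hi⟩ := Function.ne_iff.1 h0
      obtain ⟨h1, h2, -⟩ := hB b hb i hi
      have : gsupp (mkY p (f b)) = insert i.1 {u, v} := by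
        refine gsupp_eq ?_ ?_ <;> rw [mkY_val p (hmem b hb)]
        · exact h1
        · exact h2
      rw [this, Finset.card_insert_of_notMem i.2.1, Finset.card_pair huv]

lemma tri_chart (h3 : ∀ F ∈ K, F.card ≤ 3)
    {p : geomReal K} (hp : (gsupp p).card = 3) :
    ∃ γ : ℂ → geomReal K, IsChart (Metric.closedBall (0 : ℂ) 1) γ p := by
  obtain ⟨u, v, w, huv, huw, hvw, hF⟩ := Finset.card_eq_three.1 hp
  have hpu : 0 < p.1 u := mem_gsupp_pos.1 (by rw [hF]; simp)
  have hpv : 0 < p.1 v := mem_gsupp_pos.1 (by rw [hF]; simp)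
  have hpw : 0 < p.1 w := mem_gsupp_pos.1 (by rw [hF]; simp)
  have hsum3 : ∀ g : V → ℝ, ∑ x ∈ ({u, v, w} : Finset V), g x = g u + g v + g w := by
    intro g
    rw [Finset.sum_insert (by simp [huv, huw]), Finset.sum_pair hvw]; ring
  have hps : p.1 u + p.1 v + p.1 w = 1 := by
    have := gsupp_sum p
    rwa [hF, hsum3] at this
  have hFK : ({u, v, w} : Finset V) ∈ K := hF ▸ gsupp_mem p
  obtain ⟨δ, hδ, hδu, hδv, hδw⟩ : ∃ δ : ℝ, 0 < δ ∧ 4 * δ ≤ p.1 u ∧ 4 * δ ≤ p.1 v ∧ 4 * δ ≤ p.1 w := by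
    refine ⟨min (p.1 u) (min (p.1 v) (p.1 w)) / 4,
      by have := lt_min hpu (lt_min hpv hpw); positivity, ?_, ?_, ?_⟩
    · have := min_le_left (p.1 u) (min (p.1 v) (p.1 w)); linarith
    · have := (min_le_right (p.1 u) (min (p.1 v) (p.1 w))).trans (min_le_left _ _); linarith
    · have := (min_le_right (p.1 u) (min (p.1 v) (p.1 w))).trans (min_le_right _ _); linarith
  set f : ℂ → V → ℝ := fun z x => if x = u then p.1 u + δ * z.re else
    if x = v then p.1 v + δ * z.im else if x = w then p.1 w - δ * (z.re + z.im) else 0 with hf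
  have fu : ∀ z, f z u = p.1 u + δ * z.re := fun z => by simp [hf]
  have fv : ∀ z, f z v = p.1 v + δ * z.im := fun z => by simp [hf, huv.symm]
  have fw : ∀ z, f z w = p.1 w - δ * (z.re + z.im) := fun z => by simp [hf, huw.symm, hvw.symm]
  have f0 : ∀ z x, x ∉ ({u, v, w} : Finset V) → f z x = 0 := by
    intro z x hx
    simp only [Finset.mem_insert, Finset.mem_singleton, not_or] at hx
    simp [hf, hx]
  have hmem : ∀ z ∈ Metric.closedBall (0 : ℂ) 1, f z ∈ geomReal K := by
    intro z hz
    rw [mem_closedBall_zero_iff] at hz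
    have h4 := abs_le.1 ((Complex.abs_re_le_norm z).trans hz)
    have h5 := abs_le.1 ((Complex.abs_im_le_norm z).trans hz)
    refine geom_mem hFK ?_ (f0 z) ?_
    · intro x hx
      simp only [Finset.mem_insert, Finset.mem_singleton] at hx
      rcases hx with rfl | rfl | rfl
      · rw [fu]; nlinarith
      · rw [fv]; nlinarith
      · rw [fw]; nlinarith
    · rw [hsum3, fu, fv, fw]; linarith
  refine ⟨fun z => mkY p (f z), ⟨isCompact_closedBall _ _, by simp, ?_, ?_, ?_, ?_⟩⟩
  · refine mkY_cont p (Continuous.continuousOn (continuous_pi fun x => ?_)) hmem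
    simp only [hf]
    split_ifs <;> fun_prop
  · intro z hz z' hz' h
    have e : f z = f z' := by
      rw [← mkY_val p (hmem z hz), ← mkY_val p (hmem z' hz')]
      exact congrArg Subtype.val h
    have e1 := congrFun e u
    have e2 := congrFun e v
    rw [fu, fu] at e1
    rw [fv, fv] at e2
    exact Complex.ext (mul_left_cancel₀ hδ.ne' (by linarith)) (mul_left_cancel₀ hδ.ne' (by linarith))
  · apply Subtype.ext
    rw [mkY_val p (hmem 0 (by simp))]
    funext x
    by_cases hx : x ∈ ({u, v, w} : Finset V)
    · simp only [Finset.mem_insert, Finset.mem_singleton] at hx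
      rcases hx with rfl | rfl | rfl
      · rw [fu]; simp
      · rw [fv]; simp
      · rw [fw]; simp
    · rw [f0 0 x hx]
      by_contra hc
      exact hx (hF ▸ mem_gsupp.2 (Ne.symm hc))
  · have hop : IsOpen {y : geomReal K | gsupp p ⊆ gsupp y} :=
      isOpen_upper (K := K) (𝒜 := fun F => gsupp p ⊆ F) fun F G h1 h2 _ => h1.trans h2
    have hop2 : IsOpen {y : geomReal K |
        ‖(⟨(y.1 u - p.1 u) / δ, (y.1 v - p.1 v) / δ⟩ : ℂ)‖ < 1} := by
      refine isOpen_lt (complex_mk_cont ?_ ?_).norm continuous_const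
      · exact ((cont_coord u).sub continuous_const).div_const _
      · exact ((cont_coord v).sub continuous_const).div_const _
    refine Filter.mem_of_superset ((hop.inter hop2).mem_nhds ⟨Finset.Subset.refl _, ?_⟩) ?_
    · have : (⟨0, 0⟩ : ℂ) = 0 := rfl
      simp [this]
    · rintro y ⟨hy1, hy2⟩
      have hyF : gsupp y = {u, v, w} := by
        rw [← hF]
        refine (Finset.eq_of_subset_of_card_le hy1 ?_).symm
        rw [hp]; exact h3 _ (gsupp_mem y)
      have hys : y.1 u + y.1 v + y.1 w = 1 := by
        have := gsupp_sum y
        rwa [hyF, hsum3] at this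
      have hz : (⟨(y.1 u - p.1 u) / δ, (y.1 v - p.1 v) / δ⟩ : ℂ) ∈ Metric.closedBall (0 : ℂ) 1 := by
        rw [mem_closedBall_zero_iff]; exact le_of_lt hy2
      refine ⟨_, hz, ?_⟩
      apply Subtype.ext
      simp only
      rw [mkY_val p (hmem _ hz)]
      have d1 : δ * ((y.1 u - p.1 u) / δ) = y.1 u - p.1 u := by field_simp
      have d2 : δ * ((y.1 v - p.1 v) / δ) = y.1 v - p.1 v := by field_simp
      funext x
      by_cases hx : x ∈ ({u, v, w} : Finset V)
      · simp only [Finset.mem_insert, Finset.mem_singleton] at hx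
        rcases hx with rfl | rfl | rfl
        · rw [fu]; simp only; linarith
        · rw [fv]; simp only; linarith
        · rw [fw]; simp only; rw [mul_add]; linarith
      · rw [f0 _ x hx]
        by_contra hc
        exact hx (hyF ▸ mem_gsupp.2 (Ne.symm hc))

end geom2

section hh1
variable [Fintype V] {K : Finset (Finset V)} {S : Set (geomReal K)} {p0 : geomReal K}

omit [DecidableEq V] in
lemma DHSpace.not_isolated (D : DHSpace S p0) {p : geomReal K} (hp : p ∈ S) {U : Set (geomReal K)}
    (hU : U ∈ nhds p) : ∃ y ∈ U, y ∈ S ∧ y ≠ p := by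
  obtain ⟨O, U', hU', -, -, -, h⟩ := D.endsGe p hp
  obtain ⟨y, hy, hy'⟩ := mem_closure_iff_nhds.1 (h true) U hU
  exact ⟨y, hy, hy'.2.1, hy'.2.2⟩

lemma DHSpace.tri (D : DHSpace S p0) (h3 : ∀ F ∈ K, F.card ≤ 3) {q : geomReal K} (hq : q ∈ S) :
    (gsupp q).card ≠ 3 := by
  have key : ∀ q ∈ S, q ≠ p0 → (gsupp q).card ≠ 3 := by
    intro q hq hne hc
    obtain ⟨γ, hγ⟩ := tri_chart h3 hc
    obtain ⟨β, hβ, -⟩ := D.book q hq hne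
    have := book_disc hβ hγ
    simp at this
  by_cases hne : q = p0
  · intro hc
    have hop : IsOpen {y : geomReal K | (gsupp y).card = 3} := by
      refine isOpen_upper (𝒜 := fun F => F.card = 3) ?_
      intro F G hF hFG hG
      have := card_le_card hFG
      have := h3 G hG
      omega
    obtain ⟨y, hy, hyS, hyne⟩ := D.not_isolated hq (hop.mem_nhds hc)
    exact key y hyS (hne ▸ hyne) hy
  · exact key q hq hne

omit [DecidableEq V] in
lemma supp_nhds (q : geomReal K) : {y : geomReal K | gsupp q ⊆ gsupp y} ∈ nhds q := by
  have hop : IsOpen {y : geomReal K | gsupp q ⊆ gsupp y} :=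
    isOpen_upper (𝒜 := fun F => gsupp q ⊆ F) fun F G hF hFG _ => hF.trans hFG
  exact hop.mem_nhds (Subset.refl _)

lemma DHSpace.edge_near (D : DHSpace S p0) (h3 : ∀ F ∈ K, F.card ≤ 3) {q : geomReal K} (hq : q ∈ S)
    (hc : (gsupp q).card = 2) : ∃ y ∈ S, y ≠ p0 ∧ gsupp y = gsupp q := by
  by_cases hne : q = p0
  · obtain ⟨y, hy, hyS, hyne⟩ := D.not_isolated hq (supp_nhds q)
    refine ⟨y, hyS, hne ▸ hyne, ?_⟩
    have h1 := D.tri h3 hyS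
    have h2 := h3 _ (gsupp_mem y)
    exact (eq_of_subset_of_card_le hy (by omega)).symm
  · exact ⟨q, hq, hne, rfl⟩

lemma DHSpace.edge_two (D : DHSpace S p0) (hK : IsCplx K) (h3 : ∀ F ∈ K, F.card ≤ 3) {u v : V}
    (huv : u ≠ v) {p : geomReal K} (hp : gsupp p = {u, v}) (hS : p ∉ S) :
    Fintype.card (Wing K u v) = 2 := by
  obtain ⟨β, hβ, -⟩ := edge_chart hK h3 huv hp
  obtain ⟨γ, hγ⟩ := D.disc p hS
  exact book_disc hβ hγ

lemma DHSpace.edge_S_ne (D : DHSpace S p0) (hK : IsCplx K) (h3 : ∀ F ∈ K, F.card ≤ 3) {u v : V}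
    (huv : u ≠ v) {p : geomReal K} (hp : gsupp p = {u, v}) (hS : p ∈ S) :
    Fintype.card (Wing K u v) ≠ 2 := by
  intro hc
  obtain ⟨y, hyS, hyne, hy⟩ := D.edge_near h3 hS (by rw [hp]; exact card_pair huv)
  obtain ⟨β, hβ, -⟩ := edge_chart hK h3 huv (hy.trans hp)
  obtain ⟨γ, hγ⟩ := book_two_disc hβ hc
  obtain ⟨β', hβ', -⟩ := D.book y hyS hyne
  have := book_disc hβ' hγ
  simp at this

lemma DHSpace.edge_all (D : DHSpace S p0) (hK : IsCplx K) (h3 : ∀ F ∈ K, F.card ≤ 3)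
    {p q : geomReal K} (hp : (gsupp p).card = 2) (hS : p ∈ S) (hq : gsupp q = gsupp p) : q ∈ S := by
  obtain ⟨u, v, huv, e⟩ := card_eq_two.1 hp
  by_contra h
  exact D.edge_S_ne hK h3 huv e hS (D.edge_two hK h3 huv (hq.trans e) h)

lemma DHSpace.edge_hS (D : DHSpace S p0) (hK : IsCplx K) (h3 : ∀ F ∈ K, F.card ≤ 3) {u v : V}
    (huv : u ≠ v) {p : geomReal K} (hp : gsupp p = {u, v}) (hS : p ∈ S) :
    ∃ β, IsChart (Book (Wing K u v)) β p ∧ ∀ b ∈ Book (Wing K u v), β b ∈ S ↔ b.1 = 0 := by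
  obtain ⟨β, hβ, h⟩ := edge_chart hK h3 huv hp
  refine ⟨β, hβ, fun b hb => ⟨fun hbS => ?_, fun hb0 => ?_⟩⟩
  · by_contra hne
    exact D.tri h3 hbS ((h b hb).2 hne)
  · exact D.edge_all hK h3 (by rw [hp]; exact card_pair huv) hS (((h b hb).1 hb0).trans hp.symm)

lemma DHSpace.edge_three (D : DHSpace S p0) (hK : IsCplx K) (h3 : ∀ F ∈ K, F.card ≤ 3) {u v : V}
    (huv : u ≠ v) {p : geomReal K} (hp : gsupp p = {u, v}) (hS : p ∈ S) :
    Fintype.card (Wing K u v) = 3 := by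
  obtain ⟨y, hyS, hyne, hy⟩ := D.edge_near h3 hS (by rw [hp]; exact card_pair huv)
  obtain ⟨β, hβ, h⟩ := D.edge_hS hK h3 huv (hy.trans hp) hyS
  obtain ⟨β', hβ', h'⟩ := D.book y hyS hyne
  obtain ⟨f⟩ := ends_emb (book_endsGe hβ h) (book_endsLe hβ' h')
  obtain ⟨g⟩ := ends_emb (book_endsGe hβ' h') (book_endsLe hβ h)
  have h1 := Fintype.card_le_of_embedding f
  have h2 := Fintype.card_le_of_embedding g
  simp only [Fintype.card_fin] at h1 h2
  omega

lemma DHSpace.p0_vert (D : DHSpace S p0) (hK : IsCplx K) (h3 : ∀ F ∈ K, F.card ≤ 3) :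
    ∃ v0, gsupp p0 = {v0} := by
  have h1 := h3 _ (gsupp_mem p0)
  have h2 := D.tri h3 D.mem
  have h4 : 0 < (gsupp p0).card := card_pos.2 (face_ne hK (gsupp_mem p0))
  have h5 : (gsupp p0).card ≠ 2 := by
    intro hc
    obtain ⟨u, v, huv, e⟩ := card_eq_two.1 hc
    obtain ⟨β, hβ, h⟩ := D.edge_hS hK h3 huv e D.mem
    exact book_not_sector hβ h D.sector
  exact card_eq_one.1 (by omega)

end hh1

section hh2
variable [Fintype V] {K : Finset (Finset V)} {S : Set (geomReal K)} {p0 : geomReal K}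

/-- the open cell of a face meets the singular set -/
def SingF (S : Set (geomReal K)) (e : Finset V) : Prop := ∃ q ∈ S, gsupp q = e

lemma DHSpace.star_edge (D : DHSpace S p0) (h3 : ∀ F ∈ K, F.card ≤ 3) {p y : geomReal K} {v : V}
    (hp : gsupp p = {v}) (hy : y ∈ S) (hne : y ≠ p) (hv : 0 < y.1 v) :
    ∃ x, x ≠ v ∧ gsupp y = {v, x} := by
  have h1 := D.tri h3 hy
  have h2 := h3 _ (gsupp_mem y)
  have hv' : v ∈ gsupp y := mem_gsupp_pos.2 hv
  have h4 : gsupp y ≠ {v} := fun h => hne (eq_vert h hp)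
  have h5 : (gsupp y).card = 2 := by
    have : 0 < (gsupp y).card := card_pos.2 ⟨v, hv'⟩
    have : (gsupp y).card ≠ 1 := by
      intro h
      obtain ⟨a, ha⟩ := card_eq_one.1 h
      rw [ha, mem_singleton] at hv'
      exact h4 (hv' ▸ ha)
    omega
  have h6 : ((gsupp y).erase v).card = 1 := by rw [card_erase_of_mem hv', h5]
  obtain ⟨x, hx⟩ := card_eq_one.1 h6
  have hx' : x ∈ (gsupp y).erase v := by rw [hx]; simp
  refine ⟨x, (mem_erase.1 hx').1, ?_⟩
  rw [← insert_erase hv', hx]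

lemma DHSpace.two_sing (D : DHSpace S p0) (hK : IsCplx K) (h3 : ∀ F ∈ K, F.card ≤ 3)
    {p : geomReal K} {v : V} (hp : gsupp p = {v}) (hpS : p ∈ S) :
    Nat.card {x : V // x ≠ v ∧ SingF S {v, x}} = 2 := by
  set ι := {x : V // x ≠ v ∧ SingF S {v, x}} with hι
  have hcov : ∀ y ∈ S \ {p}, 0 < y.1 v → ∃ i : ι, gsupp y = {v, i.1} := by
    rintro y ⟨hyS, hyp⟩ hv
    obtain ⟨x, hx, e⟩ := D.star_edge h3 hp hyS hyp hv
    exact ⟨⟨x, hx, y, hyS, e⟩, e⟩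
  have hin : ∀ (i : ι) (y : geomReal K), gsupp y = {v, i.1} → y ∈ S \ {p} := by
    rintro ⟨x, hx, q, hq, e⟩ y hy
    refine ⟨D.edge_all hK h3 (by rw [e]; exact card_pair hx.symm) hq (hy.trans e.symm), ?_⟩
    rintro rfl
    have : ({v} : Finset V).card = ({v, x} : Finset V).card := by rw [← hp, hy]
    rw [card_pair hx.symm] at this
    simp at this
  have hKe : ∀ i : ι, ({v, i.1} : Finset V) ∈ K := by
    rintro ⟨x, hx, q, hq, e⟩
    rw [← e]; exact gsupp_mem q
  have hge : EndsGe p (S \ {p}) ι := by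
    refine ⟨fun i => {y | 0 < y.1 i.1}, {y | 0 < y.1 v}, vert_nhds' hp one_pos, ?_, ?_, ?_, ?_⟩
    · intro i
      exact isOpen_lt continuous_const (cont_coord i.1)
    · rintro i j hij y ⟨hy, hv⟩ hi hj
      obtain ⟨k, hk⟩ := hcov y hy hv
      have h1 : i.1 ∈ gsupp y := mem_gsupp_pos.2 hi
      have h2 : j.1 ∈ gsupp y := mem_gsupp_pos.2 hj
      rw [hk, mem_insert, mem_singleton] at h1 h2
      have h1' := h1.resolve_left i.2.1
      have h2' := h2.resolve_left j.2.1
      exact hij (Subtype.ext (h1'.trans h2'.symm))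
    · rintro y ⟨hy, hv⟩
      obtain ⟨k, hk⟩ := hcov y hy hv
      exact ⟨k, mem_gsupp_pos.1 (by rw [hk]; simp)⟩
    · intro i
      rw [mem_closure_iff_nhds]
      intro N hN
      obtain ⟨y, hyN, hy⟩ := mem_closure_cell hK (hKe i) (q := p) (by rw [hp]; simp) hN
      exact ⟨y, hyN, mem_gsupp_pos.1 (by rw [hy]; simp), hin i y hy⟩
  have hle : EndsLe p (S \ {p}) ι := by
    intro U hU
    obtain ⟨η, h0, h1, hηU⟩ := vert_nhds hp hU
    refine ⟨{y | η < y.1 v}, vert_nhds' hp h1, fun i => {y | gsupp y = {v, i.1} ∧ η < y.1 v}, ?_, ?_⟩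
    · rintro y ⟨hy, hv⟩
      obtain ⟨k, hk⟩ := hcov y hy (lt_of_le_of_lt h0 hv)
      exact ⟨k, hk, hv⟩
    · intro i
      exact ⟨fun y hy => ⟨hin i y hy.1, hηU y hy.2⟩, cell_preconn (hKe i) v η⟩
  obtain ⟨f⟩ := ends_emb hge (D.endsLe p hpS)
  obtain ⟨g⟩ := ends_emb (D.endsGe p hpS) hle
  have h1 := Nat.card_le_card_of_injective f f.injective
  have h2 := Nat.card_le_card_of_injective g g.injective
  simp only [Nat.card_eq_fintype_card (α := Bool), Fintype.card_bool] at h1 h2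
  omega

lemma DHSpace.sing_closed (D : DHSpace S p0) (hK : IsCplx K) (h3 : ∀ F ∈ K, F.card ≤ 3)
    {p : geomReal K} {v x : V} (hx : x ≠ v) (hp : gsupp p = {v}) (hs : SingF S {v, x}) : p ∈ S := by
  by_contra h
  obtain ⟨q, hq, e⟩ := hs
  obtain ⟨y, hyN, hy⟩ := mem_closure_cell hK (e ▸ gsupp_mem q) (q := p) (F := {v, x}) (by rw [hp]; simp)
    (D.closed.isOpen_compl.mem_nhds h)
  exact hyN (D.edge_all hK h3 (by rw [e]; exact card_pair hx.symm) hq (hy.trans e.symm))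

lemma disc_not_isolated {Y : Type*} [TopologicalSpace Y] {γ : ℂ → Y} {p : Y}
    (hγ : IsChart (Metric.closedBall (0 : ℂ) 1) γ p) {U : Set Y} (hU : U ∈ nhds p) :
    ∃ y ∈ U, y ≠ p := by
  have h := hγ.cont 0 hγ.zero_mem
  have h' : γ ⁻¹' U ∈ nhdsWithin 0 (Metric.closedBall (0 : ℂ) 1) := h (by rw [hγ.map_zero]; exact hU)
  obtain ⟨ε, hε, hs⟩ := Metric.mem_nhdsWithin_iff.1 h'
  have hpos : 0 < min (ε / 2) 1 := by positivity
  have hmem : ((min (ε / 2) 1 : ℝ) : ℂ) ∈ Metric.closedBall (0 : ℂ) 1 := by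
    rw [mem_closedBall_zero_iff, Complex.norm_real, Real.norm_of_nonneg hpos.le]
    exact min_le_right _ _
  refine ⟨γ ((min (ε / 2) 1 : ℝ) : ℂ), hs ⟨?_, hmem⟩, ?_⟩
  · rw [mem_ball_zero_iff, Complex.norm_real, Real.norm_of_nonneg hpos.le]
    exact lt_of_le_of_lt (min_le_left _ _) (by linarith)
  · intro e
    have := hγ.inj hmem hγ.zero_mem (e.trans hγ.map_zero.symm)
    rw [Complex.ofReal_eq_zero] at this
    exact hpos.ne' this

lemma DHSpace.reg_edge (D : DHSpace S p0)
    {p : geomReal K} {v : V} (hp : gsupp p = {v}) (hpS : p ∉ S) (hK : IsCplx K) :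
    ∃ x, x ≠ v ∧ ({v, x} : Finset V) ∈ K := by
  obtain ⟨γ, hγ⟩ := D.disc p hpS
  obtain ⟨y, hy, hne⟩ := disc_not_isolated hγ (vert_nhds' hp (η := 0) one_pos)
  have hv : v ∈ gsupp y := mem_gsupp_pos.2 hy
  have h4 : ∃ x ∈ gsupp y, x ≠ v := by
    by_contra! h
    exact hne (eq_vert (eq_singleton_iff_unique_mem.2 ⟨hv, h⟩) hp)
  obtain ⟨x, hx, hxv⟩ := h4
  refine ⟨x, hxv, hK.2 _ (gsupp_mem y) _ ?_ (by simp)⟩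
  intro a ha
  rw [mem_insert, mem_singleton] at ha
  rcases ha with rfl | rfl <;> assumption

omit [Fintype V] in
lemma mem_verts {L : Finset (Finset V)} {x : V} : x ∈ verts L ↔ ∃ G ∈ L, x ∈ G := by
  simp [verts, Finset.mem_sup]

omit [Fintype V] in
lemma mem_link {v : V} {G : Finset V} :
    G ∈ link K {v} ↔ G ∈ K ∧ v ∉ G ∧ insert v G ∈ K := by
  unfold link
  rw [mem_filter, disjoint_singleton_right, union_comm, ← insert_eq]

lemma mem_verts_link (hK : IsCplx K) {v x : V} :
    x ∈ verts (link K {v}) ↔ x ≠ v ∧ ({v, x} : Finset V) ∈ K := by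
  rw [mem_verts]
  constructor
  · rintro ⟨G, hG, hx⟩
    obtain ⟨h1, h2, h4⟩ := mem_link.1 hG
    refine ⟨fun h => h2 (h ▸ hx), hK.2 _ h4 _ ?_ (by simp)⟩
    intro a ha
    rw [mem_insert, mem_singleton] at ha
    rcases ha with rfl | rfl
    · simp
    · simp [hx]
  · rintro ⟨h1, h2⟩
    refine ⟨{x}, mem_link.2 ⟨hK.2 _ h2 _ (by simp) (by simp), by simpa using h1.symm, h2⟩, by simp⟩

lemma link_deg (hK : IsCplx K) {v x : V} (hx : x ≠ v) :
    ((link K {v}).filter fun e => e.card = 2 ∧ x ∈ e).card = Fintype.card (Wing K v x) := by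
  symm
  rw [← Finset.card_univ]
  refine Finset.card_bij (fun w _ => {x, w.1}) ?_ ?_ ?_
  · rintro ⟨w, hw, hwK⟩ -
    simp only [mem_insert, mem_singleton, not_or] at hw
    have e : insert v ({x, w} : Finset V) = insert w {v, x} := by ext a; simp; tauto
    rw [mem_filter, mem_link, e]
    refine ⟨⟨hK.2 _ hwK _ ?_ (by simp), ?_, hwK⟩, card_pair (Ne.symm hw.2), by simp⟩
    · exact (subset_insert v _).trans e.subset
    · simp only [mem_insert, mem_singleton, not_or]; exact ⟨hx.symm, Ne.symm hw.1⟩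
  · rintro ⟨w, hw, hwK⟩ - ⟨w', hw', hwK'⟩ - e
    simp only [mem_insert, mem_singleton, not_or] at hw hw'
    have : w ∈ ({x, w'} : Finset V) := by rw [← e]; simp
    simp only [mem_insert, mem_singleton] at this
    exact Subtype.ext (this.resolve_left hw.2)
  · intro e he
    rw [mem_filter, mem_link] at he
    obtain ⟨⟨h1, h2, h4⟩, h5, h6⟩ := he
    have h7 : (e.erase x).card = 1 := by rw [card_erase_of_mem h6, h5]
    obtain ⟨w, hw⟩ := card_eq_one.1 h7
    have hw' : w ∈ e.erase x := by rw [hw]; simp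
    have e1 : e = {x, w} := by rw [← insert_erase h6, hw]
    have e2 : insert v e = insert w {v, x} := by rw [e1]; ext a; simp; tauto
    refine ⟨⟨w, ?_, e2 ▸ h4⟩, mem_univ _, e1.symm⟩
    simp only [mem_insert, mem_singleton, not_or]
    exact ⟨fun h => h2 (h ▸ (mem_erase.1 hw').2), (mem_erase.1 hw').1⟩

lemma DHSpace.circle (D : DHSpace S p0) (hK : IsCplx K) (h3 : ∀ F ∈ K, F.card ≤ 3)
    {p : geomReal K} {v : V} (hp : gsupp p = {v}) (hpS : p ∉ S) : IsCircle (link K {v}) := by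
  refine ⟨?_, ?_, ?_, ?_⟩
  · intro F hF
    obtain ⟨h1, h2, h4⟩ := mem_link.1 hF
    have := h3 _ h4
    rw [card_insert_of_notMem h2] at this
    omega
  · obtain ⟨x, hx⟩ := D.reg_edge hp hpS hK
    exact ⟨x, (mem_verts_link hK).2 hx⟩
  · intro x hx
    obtain ⟨hxv, hxK⟩ := (mem_verts_link hK).1 hx
    rw [link_deg hK hxv]
    obtain ⟨q, hq⟩ := exists_bary hK hxK
    refine D.edge_two hK h3 hxv.symm hq fun hqS => hpS (D.sing_closed hK h3 hxv hp ⟨q, hqS, hq⟩)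
  · intro u hu w hw
    by_contra hcon
    set R : Set V := {x | Relation.ReflTransGen (fun a b => ({a, b} : Finset V) ∈ link K {v}) u x}
    obtain ⟨huv, huK⟩ := (mem_verts_link hK).1 hu
    obtain ⟨hwv, hwK⟩ := (mem_verts_link hK).1 hw
    have hRv : ∀ x ∈ R, x ≠ v := by
      intro x hx
      rcases Relation.ReflTransGen.cases_tail hx with h | ⟨c, -, h⟩
      · rwa [h]
      · have := (mem_link.1 h).2.1
        intro h'
        exact this (by simp [h'])
    obtain ⟨γ, hγ⟩ := D.disc p hpS
    have hcl : ∀ x, x ≠ v → ({v, x} : Finset V) ∈ K → ∀ N ∈ nhds p, ∃ y ∈ N, y ∈ ({p}ᶜ : Set _) ∧ 0 < y.1 x := by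
      intro x hx hxK N hN
      obtain ⟨y, hyN, hy⟩ := mem_closure_cell hK hxK (q := p) (by rw [hp]; simp) hN
      refine ⟨y, hyN, ?_, mem_gsupp_pos.1 (by rw [hy]; simp)⟩
      rintro rfl
      have : ({v} : Finset V).card = ({v, x} : Finset V).card := by rw [← hp, hy]
      rw [card_pair hx.symm] at this
      simp at this
    have hge : EndsGe p ({p}ᶜ : Set (geomReal K)) Bool := by
      refine ⟨fun i => if i then {y | ∃ x ∈ R, 0 < y.1 x} else {y | ∃ x, x ∉ R ∧ x ≠ v ∧ 0 < y.1 x},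
        {y | 0 < y.1 v}, vert_nhds' hp one_pos, ?_, ?_, ?_, ?_⟩
      · intro i
        cases i
        · have : {y : geomReal K | ∃ x, x ∉ R ∧ x ≠ v ∧ 0 < y.1 x} =
            ⋃ x ∈ {x | x ∉ R ∧ x ≠ v}, {y : geomReal K | 0 < y.1 x} := by
            ext y; simp [and_assoc]
          simp only [Bool.false_eq_true, if_false]
          rw [this]
          exact isOpen_biUnion fun x _ => isOpen_lt continuous_const (cont_coord x)
        · have : {y : geomReal K | ∃ x ∈ R, 0 < y.1 x} =
            ⋃ x ∈ R, {y : geomReal K | 0 < y.1 x} := by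
            ext y; simp
          simp only [if_true]
          rw [this]
          exact isOpen_biUnion fun x _ => isOpen_lt continuous_const (cont_coord x)
      · have key : ∀ y : geomReal K, 0 < y.1 v → (∃ x ∈ R, 0 < y.1 x) →
            (∃ x, x ∉ R ∧ x ≠ v ∧ 0 < y.1 x) → False := by
          rintro y hv ⟨x, hxR, hx⟩ ⟨x', hxR', hxv', hx'⟩
          apply hxR'
          refine Relation.ReflTransGen.tail hxR ?_
          rw [mem_link]
          have a1 := mem_gsupp_pos.2 hx
          have a2 := mem_gsupp_pos.2 hx'
          have a3 := mem_gsupp_pos.2 hv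
          refine ⟨hK.2 _ (gsupp_mem y) _ ?_ (by simp), ?_, hK.2 _ (gsupp_mem y) _ ?_ (by simp)⟩
          · simp [insert_subset_iff, a1, a2]
          · simp [hxv'.symm, (hRv x hxR).symm]
          · simp [insert_subset_iff, a1, a2, a3]
        rintro i j hij y ⟨-, hv⟩ hi hj
        cases i <;> cases j
        · exact hij rfl
        · exact key y hv (by simpa using hj) (by simpa using hi)
        · exact key y hv (by simpa using hi) (by simpa using hj)
        · exact hij rfl
      · rintro y ⟨hne, hyv⟩
        have hv : v ∈ gsupp y := mem_gsupp_pos.2 hyv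
        have h4 : ∃ x ∈ gsupp y, x ≠ v := by
          by_contra! h
          exact hne (eq_vert (eq_singleton_iff_unique_mem.2 ⟨hv, h⟩) hp)
        obtain ⟨x, hx, hxv⟩ := h4
        by_cases hxR : x ∈ R
        · refine ⟨true, ?_⟩
          simp only [if_true]
          exact ⟨x, hxR, mem_gsupp_pos.1 hx⟩
        · refine ⟨false, ?_⟩
          simp only [Bool.false_eq_true, if_false]
          exact ⟨x, hxR, hxv, mem_gsupp_pos.1 hx⟩
      · intro i
        rw [mem_closure_iff_nhds]
        intro N hN
        cases i
        · obtain ⟨y, h1, h2, h4⟩ := hcl w hwv hwK N hN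
          refine ⟨y, h1, ?_, h2⟩
          simp only [Bool.false_eq_true, if_false]
          exact ⟨w, hcon, hwv, h4⟩
        · obtain ⟨y, h1, h2, h4⟩ := hcl u huv huK N hN
          refine ⟨y, h1, ?_, h2⟩
          simp only [if_true]
          exact ⟨u, Relation.ReflTransGen.refl, h4⟩
    obtain ⟨f⟩ := ends_emb hge (disc_endsLe hγ)
    have := Fintype.card_le_of_embedding f
    simp at this

end hh2

section hh3
variable [Fintype V] {K : Finset (Finset V)} {S : Set (geomReal K)} {p0 : geomReal K}

lemma DHSpace.edge_tri (D : DHSpace S p0) (hK : IsCplx K) (h3 : ∀ F ∈ K, F.card ≤ 3)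
    {e : Finset V} (he : e ∈ K) (hc : e.card = 2) : ∃ T ∈ K, T.card = 3 ∧ e ⊆ T := by
  obtain ⟨u, v, huv, rfl⟩ := card_eq_two.1 hc
  obtain ⟨q, hq⟩ := exists_bary hK he
  have : 0 < Fintype.card (Wing K u v) := by
    by_cases h : q ∈ S
    · rw [D.edge_three hK h3 huv hq h]; norm_num
    · rw [D.edge_two hK h3 huv hq h]; norm_num
  obtain ⟨w, hw, hwK⟩ := Fintype.card_pos_iff.1 this
  refine ⟨_, hwK, ?_, subset_insert _ _⟩
  rw [card_insert_of_notMem hw, hc]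

lemma DHSpace.not_sing (D : DHSpace S p0) (hK : IsCplx K) (h3 : ∀ F ∈ K, F.card ≤ 3)
    {y : geomReal K} (hc : 2 ≤ (gsupp y).card) : y ∈ S ↔ SingF S (gsupp y) := by
  constructor
  · intro h; exact ⟨y, h, rfl⟩
  · rintro ⟨q, hq, e⟩
    have h1 := D.tri h3 hq
    have h2 := h3 _ (gsupp_mem q)
    rw [← e] at hc
    exact D.edge_all hK h3 (by omega) hq e.symm

lemma DHSpace.tri_conn (D : DHSpace S p0) (hK : IsCplx K) (h3 : ∀ F ∈ K, F.card ≤ 3)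
    (𝒟 : Finset (Finset V)) (hD : ∃ T ∈ 𝒟, T ∈ K ∧ T.card = 3)
    (hcl : ∀ e T T', e.card = 2 → ¬ SingF S e → T ∈ K → T.card = 3 → T' ∈ K → T'.card = 3 →
      e ⊆ T → e ⊆ T' → T ∈ 𝒟 → T' ∈ 𝒟) : ∀ T ∈ K, T.card = 3 → T ∈ 𝒟 := by
  intro T' hT'K hT'c
  by_contra hT'
  obtain ⟨T, hT, hTK, hTc⟩ := hD
  set A : Set (geomReal K) := {y | (gsupp y).card = 1} with hA
  have hAf : A.Finite := by
    refine Set.Finite.of_finite_image (f := gsupp) (Set.toFinite _) ?_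
    intro y hy z hz e
    obtain ⟨v, hv⟩ := card_eq_one.1 hy
    exact eq_vert hv (e ▸ hv)
  have hcon := D.conn A hAf
  have hb : ∀ y : geomReal K, (gsupp y).card = 3 → y ∈ Sᶜ \ A := by
    intro y hy
    refine ⟨fun h => D.tri h3 h hy, fun h => ?_⟩
    have : (gsupp y).card = 1 := h
    omega
  have ho1 : IsOpen {y : geomReal K | 2 ≤ (gsupp y).card ∧
      ∀ T ∈ K, T.card = 3 → gsupp y ⊆ T → T ∈ 𝒟} := by
    refine isOpen_upper (𝒜 := fun F => 2 ≤ F.card ∧ ∀ T ∈ K, T.card = 3 → F ⊆ T → T ∈ 𝒟) ?_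
    rintro F G ⟨h1, h2⟩ hFG -
    exact ⟨h1.trans (card_le_card hFG), fun T h h' h'' => h2 T h h' (hFG.trans h'')⟩
  have ho2 : IsOpen {y : geomReal K | 2 ≤ (gsupp y).card ∧
      ∀ T ∈ K, T.card = 3 → gsupp y ⊆ T → T ∉ 𝒟} := by
    refine isOpen_upper (𝒜 := fun F => 2 ≤ F.card ∧ ∀ T ∈ K, T.card = 3 → F ⊆ T → T ∉ 𝒟) ?_
    rintro F G ⟨h1, h2⟩ hFG -
    exact ⟨h1.trans (card_le_card hFG), fun T h h' h'' => h2 T h h' (hFG.trans h'')⟩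
  have hX2 : ∀ y ∈ Sᶜ \ A, 2 ≤ (gsupp y).card := by
    rintro y ⟨-, hy⟩
    have : 0 < (gsupp y).card := card_pos.2 (face_ne hK (gsupp_mem y))
    have : (gsupp y).card ≠ 1 := hy
    omega
  refine absurd (hcon _ _ ho1 ho2 ?_ ?_ ?_) ?_
  · intro y hy
    have h2 := hX2 y hy
    have h4 := h3 _ (gsupp_mem y)
    by_cases h : (gsupp y).card = 2
    · have hs : ¬ SingF S (gsupp y) := fun hs => hy.1 ((D.not_sing hK h3 h2).2 hs)
      by_cases hex : ∃ T ∈ K, T.card = 3 ∧ gsupp y ⊆ T ∧ T ∈ 𝒟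
      · obtain ⟨T1, a1, a2, a3, a4⟩ := hex
        left
        exact ⟨h2, fun T2 b1 b2 b3 => hcl _ T1 T2 h hs a1 a2 b1 b2 a3 b3 a4⟩
      · right
        push Not at hex
        exact ⟨h2, hex⟩
    · have h5 : (gsupp y).card = 3 := by omega
      have : ∀ T ∈ K, T.card = 3 → gsupp y ⊆ T → T = gsupp y := fun T _ b c =>
        (eq_of_subset_of_card_le c (by omega)).symm
      by_cases hin : gsupp y ∈ 𝒟
      · left
        exact ⟨h2, fun T a b c => by rw [this T a b c]; exact hin⟩
      · right
        exact ⟨h2, fun T a b c => by rw [this T a b c]; exact hin⟩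
  · obtain ⟨y, hy⟩ := exists_bary hK hTK
    refine ⟨y, hb y (hy ▸ hTc), by rw [hy, hTc]; norm_num, fun T1 _ b c => ?_⟩
    rw [hy] at c
    rwa [← eq_of_subset_of_card_le c (by omega)]
  · obtain ⟨y, hy⟩ := exists_bary hK hT'K
    refine ⟨y, hb y (hy ▸ hT'c), by rw [hy, hT'c]; norm_num, fun T1 _ b c => ?_⟩
    rw [hy] at c
    rwa [← eq_of_subset_of_card_le c (by omega)]
  · rintro ⟨y, hy, hy1, hy2⟩
    have h2 := hX2 y hy
    have h4 := h3 _ (gsupp_mem y)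
    have : ∃ T ∈ K, T.card = 3 ∧ gsupp y ⊆ T := by
      by_cases h : (gsupp y).card = 2
      · exact D.edge_tri hK h3 (gsupp_mem y) h
      · exact ⟨_, gsupp_mem y, by omega, Subset.refl _⟩
    obtain ⟨T0, h5, h6, h7⟩ := this
    exact hy2.2 T0 h5 h6 h7 (hy1.2 T0 h5 h6 h7)

lemma DHSpace.sector_comb (D : DHSpace S p0) (hK : IsCplx K) (h3 : ∀ F ∈ K, F.card ≤ 3) {v0 : V}
    (hp : gsupp p0 = {v0}) :
    ∃ (b : V) (𝒯 : Finset (Finset V)), b ≠ v0 ∧ SingF S {v0, b} ∧ 𝒯.Nonempty ∧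
      (∀ T ∈ 𝒯, T ∈ K ∧ T.card = 3 ∧ v0 ∈ T ∧ b ∉ T) ∧
      (∀ w T T', w ≠ v0 → ¬ SingF S {v0, w} → T ∈ 𝒯 → T' ∈ K → T'.card = 3 → v0 ∈ T' → w ∈ T →
        w ∈ T' → T' ∈ 𝒯) := by
  classical
  obtain ⟨W, hW, C, C', hC, hC', hcov, hdis, hclC, hclS⟩ := D.sector
  obtain ⟨η, h0, h1, hηW⟩ := vert_nhds hp hW
  have hN := vert_nhds' hp h1
  have hNo : IsOpen {y : geomReal K | η < y.1 v0} := isOpen_lt continuous_const (cont_coord v0)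
  have hv : ∀ {y : geomReal K}, η < y.1 v0 → v0 ∈ gsupp y := fun h =>
    mem_gsupp_pos.2 (lt_of_le_of_lt h0 h)
  have h3S : ∀ {y : geomReal K}, (gsupp y).card = 3 → y ∉ S := fun h h' => D.tri h3 h' h
  -- dichotomy
  have hdich : ∀ G ∈ K, G.card = 3 → (∃ y ∈ C, gsupp y = G ∧ η < y.1 v0) →
      ∀ y, gsupp y = G → η < y.1 v0 → y ∈ C := by
    rintro G hG hGc ⟨y, hyC, hy, hyη⟩ z hz hzη
    by_contra hzC
    have hzC' := (hcov z (hηW z hzη) (h3S (hz ▸ hGc))).resolve_left hzC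
    obtain ⟨x, hx, hxC, hxC'⟩ := cell_preconn hG v0 η C C' hC hC'
      (fun x hx => hcov x (hηW x hx.2) (h3S (hx.1 ▸ hGc))) ⟨y, ⟨hy, hyη⟩, hyC⟩ ⟨z, ⟨hz, hzη⟩, hzC'⟩
    exact hdis x (hηW x hx.2) (h3S (hx.1 ▸ hGc)) hxC hxC'
  -- the vertex b
  obtain ⟨y, hyη, hyS, hyC⟩ := mem_closure_iff_nhds.1 hclS _ hN
  have hyp : y ≠ p0 := by
    rintro rfl
    exact hyC (closure_mono Set.sdiff_subset hclC)
  obtain ⟨b, hb, hyb⟩ := D.star_edge h3 hp hyS hyp (lt_of_le_of_lt h0 hyη)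
  refine ⟨b, K.filter fun G => G.card = 3 ∧ v0 ∈ G ∧ ∀ y, gsupp y = G → η < y.1 v0 → y ∈ C,
    hb, ⟨y, hyS, hyb⟩, ?_, ?_, ?_⟩
  · obtain ⟨z, hzη, hzC, hzS⟩ := mem_closure_iff_nhds.1 hclC _ hN
    have hzv := hv hzη
    have hzp : gsupp z ≠ {v0} := by
      intro h
      exact hzS (eq_vert h hp ▸ D.mem)
    have hz2 : 2 ≤ (gsupp z).card := by
      have h4 : 0 < (gsupp z).card := card_pos.2 ⟨_, hzv⟩
      have : (gsupp z).card ≠ 1 := by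
        intro h
        obtain ⟨a, ha⟩ := card_eq_one.1 h
        rw [ha, mem_singleton] at hzv
        exact hzp (hzv ▸ ha)
      omega
    have h4 := h3 _ (gsupp_mem z)
    have : ∃ T ∈ K, T.card = 3 ∧ gsupp z ⊆ T := by
      by_cases h : (gsupp z).card = 2
      · exact D.edge_tri hK h3 (gsupp_mem z) h
      · exact ⟨_, gsupp_mem z, by omega, Subset.refl _⟩
    obtain ⟨G, hG, hGc, hzG⟩ := this
    refine ⟨G, mem_filter.2 ⟨hG, hGc, hzG hzv, hdich G hG hGc ?_⟩⟩
    obtain ⟨x, ⟨hxC, hxη⟩, hx⟩ := mem_closure_cell hK hG hzG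
      (Filter.inter_mem (hC.mem_nhds hzC) (hNo.mem_nhds hzη))
    exact ⟨x, hxC, hx, hxη⟩
  · intro G hG
    obtain ⟨hGK, hGc, hGv, hGC⟩ := mem_filter.1 hG
    refine ⟨hGK, hGc, hGv, fun hbG => hyC ?_⟩
    rw [mem_closure_iff_nhds]
    intro N hN'
    obtain ⟨x, ⟨hxN, hxη⟩, hx⟩ := mem_closure_cell hK hGK (q := y)
      (by rw [hyb]; simp [insert_subset_iff, hGv, hbG]) (Filter.inter_mem hN' (hNo.mem_nhds hyη))
    exact ⟨x, hxN, hGC x hx hxη⟩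
  · intro w G G' hw hs hG hG'K hG'c hvG' hwG hwG'
    obtain ⟨hGK, hGc, hGv, hGC⟩ := mem_filter.1 hG
    have heK : ({v0, w} : Finset V) ∈ K :=
      hK.2 _ hGK _ (by simp [insert_subset_iff, hGv, hwG]) (by simp)
    refine mem_filter.2 ⟨hG'K, hG'c, hvG', hdich G' hG'K hG'c ?_⟩
    obtain ⟨q, hqη, hq⟩ := mem_closure_cell hK heK (q := p0) (by rw [hp]; simp) hN
    have hqS : q ∉ S := fun h => hs ⟨q, h, hq⟩
    have hqC : q ∈ C := by
      by_contra hqC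
      have hqC' := (hcov q (hηW q hqη) hqS).resolve_left hqC
      obtain ⟨x, ⟨hxC', hxη⟩, hx⟩ := mem_closure_cell hK hGK (q := q)
        (by rw [hq]; simp [insert_subset_iff, hGv, hwG])
        (Filter.inter_mem (hC'.mem_nhds hqC') (hNo.mem_nhds hqη))
      exact hdis x (hηW x hxη) (h3S (hx ▸ hGc)) (hGC x hx hxη) hxC'
    obtain ⟨x, ⟨hxC, hxη⟩, hx⟩ := mem_closure_cell hK hG'K (q := q)
        (by rw [hq]; simp [insert_subset_iff, hvG', hwG'])
        (Filter.inter_mem (hC.mem_nhds hqC) (hNo.mem_nhds hqη))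
    exact ⟨x, hxC, hx, hxη⟩

/-- the combinatorial structure of a triangulated dunce hat -/
structure CombDH (K : Finset (Finset V)) (SE : Finset (Finset V)) (SV : Finset V) (v0 : V) : Prop where
  cplx : IsCplx K
  dim : ∀ F ∈ K, F.card ≤ 3
  SE_K : ∀ e ∈ SE, e ∈ K ∧ e.card = 2
  deg3 : ∀ u v, u ≠ v → ({u, v} : Finset V) ∈ SE →
    (univ.filter fun w => w ∉ ({u, v} : Finset V) ∧ insert w ({u, v} : Finset V) ∈ K).card = 3
  deg2 : ∀ u v, u ≠ v → ({u, v} : Finset V) ∈ K → ({u, v} : Finset V) ∉ SE →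
    (univ.filter fun w => w ∉ ({u, v} : Finset V) ∧ insert w ({u, v} : Finset V) ∈ K).card = 2
  sing : singVerts K ⊆ SV
  SV_K : ∀ v ∈ SV, {v} ∈ K
  two : ∀ v ∈ SV, (univ.filter fun x => x ≠ v ∧ ({v, x} : Finset V) ∈ SE).card = 2
  closed : ∀ v x, x ≠ v → ({v, x} : Finset V) ∈ SE → v ∈ SV
  v0_mem : v0 ∈ SV
  vert_edge : ∀ v, {v} ∈ K → ∃ x, x ≠ v ∧ ({v, x} : Finset V) ∈ K
  conn : ∀ 𝒟 : Finset (Finset V), (∃ T ∈ 𝒟, T ∈ K ∧ T.card = 3) →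
    (∀ e T T', e.card = 2 → e ∉ SE → T ∈ K → T.card = 3 → T' ∈ K → T'.card = 3 →
      e ⊆ T → e ⊆ T' → T ∈ 𝒟 → T' ∈ 𝒟) → ∀ T ∈ K, T.card = 3 → T ∈ 𝒟
  sector : ∃ (b : V) (𝒯 : Finset (Finset V)), b ≠ v0 ∧ {v0, b} ∈ SE ∧ 𝒯.Nonempty ∧
      (∀ T ∈ 𝒯, T ∈ K ∧ T.card = 3 ∧ v0 ∈ T ∧ b ∉ T) ∧
      (∀ w T T', w ≠ v0 → {v0, w} ∉ SE → T ∈ 𝒯 → T' ∈ K → T'.card = 3 → v0 ∈ T' → w ∈ T →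
        w ∈ T' → T' ∈ 𝒯)

theorem exists_CombDH (hdh : IsDunceHatTri K) (h3 : ∀ F ∈ K, F.card ≤ 3) :
    ∃ SE SV v0, CombDH K SE SV v0 := by
  classical
  obtain ⟨hK, ⟨Φ⟩⟩ := hdh
  obtain ⟨S, p0, D⟩ := exists_DHSpace Φ
  obtain ⟨v0, hv0⟩ := D.p0_vert hK h3
  have hSE : ∀ e : Finset V, 2 ≤ e.card → (e ∈ K.filter (fun e => e.card = 2 ∧ SingF S e) ↔ SingF S e) := by
    intro e he
    rw [mem_filter]
    constructor
    · exact fun h => h.2.2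
    · intro h
      refine ⟨?_, ?_, h⟩
      · obtain ⟨q, hq, rfl⟩ := h
        exact gsupp_mem q
      · obtain ⟨q, hq, rfl⟩ := h
        have h1 := D.tri h3 hq
        have h2 := h3 _ (gsupp_mem q)
        omega
  have hSE2 : ∀ {u v : V}, u ≠ v → (({u, v} : Finset V) ∈ K.filter (fun e => e.card = 2 ∧ SingF S e) ↔
      SingF S {u, v}) := fun h => hSE _ (card_pair h).ge
  have hwing : ∀ u v, (univ.filter fun w => w ∉ ({u, v} : Finset V) ∧
      insert w ({u, v} : Finset V) ∈ K).card = Fintype.card (Wing K u v) := by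
    intro u v
    exact (Fintype.card_subtype _).symm
  refine ⟨K.filter (fun e => e.card = 2 ∧ SingF S e), univ.filter (fun v => SingF S {v}), v0, ?_⟩
  constructor
  · exact hK
  · exact h3
  · intro e he
    exact ⟨(mem_filter.1 he).1, (mem_filter.1 he).2.1⟩
  · intro u v huv he
    rw [hSE2 huv] at he
    obtain ⟨q, hq, e⟩ := he
    rw [hwing]
    exact D.edge_three hK h3 huv e hq
  · intro u v huv hK' he
    rw [hSE2 huv] at he
    obtain ⟨q, hq⟩ := exists_bary hK hK'
    rw [hwing]
    exact D.edge_two hK h3 huv hq fun h => he ⟨q, h, hq⟩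
  · intro v hv
    unfold singVerts at hv
    rw [mem_filter] at hv
    obtain ⟨hvK, hvc⟩ := hv
    obtain ⟨G, hG, hvG⟩ := mem_verts.1 hvK
    obtain ⟨p, hp⟩ := exists_bary hK (hK.2 G hG {v} (by simpa using hvG) (by simp))
    refine mem_filter.2 ⟨mem_univ _, p, ?_, hp⟩
    by_contra h
    exact hvc (D.circle hK h3 hp h)
  · intro v hv
    obtain ⟨q, hq, e⟩ := (mem_filter.1 hv).2
    exact e ▸ gsupp_mem q
  · intro v hv
    obtain ⟨q, hq, e⟩ := (mem_filter.1 hv).2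
    have := D.two_sing hK h3 e hq
    rw [Nat.card_eq_fintype_card, Fintype.card_subtype] at this
    refine Eq.trans ?_ this
    congr 1
    ext x
    have e1 : ∀ P : V → Prop, ∀ [DecidablePred P], (x ∈ univ.filter P ↔ P x) := by
      intro P _; simp
    rw [e1, e1]
    constructor
    · rintro ⟨b, c⟩
      exact ⟨b, (hSE2 b.symm).1 c⟩
    · rintro ⟨b, c⟩
      exact ⟨b, (hSE2 b.symm).2 c⟩
  · intro v x hx he
    rw [hSE2 hx.symm] at he
    have heK : {v, x} ∈ K := by
      obtain ⟨q, hq, e⟩ := he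
      exact e ▸ gsupp_mem q
    obtain ⟨p, hp⟩ := exists_bary hK (hK.2 _ heK {v} (by simp) (by simp))
    exact mem_filter.2 ⟨mem_univ _, p, D.sing_closed hK h3 hx hp he, hp⟩
  · exact mem_filter.2 ⟨mem_univ _, p0, D.mem, hv0⟩
  · intro v hv
    obtain ⟨p, hp⟩ := exists_bary hK hv
    by_cases hS : p ∈ S
    · have := D.two_sing hK h3 hp hS
      have hpos : 0 < Nat.card {x : V // x ≠ v ∧ SingF S {v, x}} := by omega
      obtain ⟨⟨x, hx, q, hq, e⟩⟩ := (Nat.card_pos_iff.1 hpos).1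
      exact ⟨x, hx, e ▸ gsupp_mem q⟩
    · exact D.reg_edge hp hS hK
  · intro 𝒟 h1 h2
    refine D.tri_conn hK h3 𝒟 h1 ?_
    intro e T T' hc hs
    exact h2 e T T' hc (fun h => hs ((hSE e hc.ge).1 h))
  · obtain ⟨b, 𝒯, h1, h2, h4, h5, h6⟩ := D.sector_comb hK h3 hv0
    refine ⟨b, 𝒯, h1, (hSE2 h1.symm).2 h2, h4, h5, ?_⟩
    intro w T T' hw hs
    exact h6 w T T' hw fun h => hs ((hSE2 hw.symm).2 h)

end hh3

section ii1
variable [Fintype V] {K SE : Finset (Finset V)} {SV : Finset V} {v0 : V}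

lemma tri_deg {u v : V} (huv : u ≠ v) :
    ((K.filter fun T => T.card = 3).filter fun T => ({u, v} : Finset V) ⊆ T).card =
    (univ.filter fun w => w ∉ ({u, v} : Finset V) ∧ insert w ({u, v} : Finset V) ∈ K).card := by
  symm
  refine Finset.card_bij (fun w _ => insert w ({u, v} : Finset V)) ?_ ?_ ?_
  · intro w hw
    obtain ⟨-, h1, h2⟩ := mem_filter.1 hw
    rw [mem_filter, mem_filter]
    exact ⟨⟨h2, by rw [card_insert_of_notMem h1, card_pair huv]⟩, subset_insert _ _⟩
  · intro w hw w' hw' e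
    obtain ⟨-, h1, h2⟩ := mem_filter.1 hw
    have : w ∈ insert w' ({u, v} : Finset V) := by rw [← e]; simp
    exact (mem_insert.1 this).resolve_right h1
  · intro T hT
    rw [mem_filter, mem_filter] at hT
    obtain ⟨⟨h1, h2⟩, h4⟩ := hT
    have h5 : (T \ {u, v}).card = 1 := by rw [card_sdiff_of_subset h4, h2, card_pair huv]
    obtain ⟨w, hw⟩ := card_eq_one.1 h5
    have hw' : w ∈ T \ {u, v} := by rw [hw]; simp
    have e : insert w ({u, v} : Finset V) = T := by
      rw [insert_eq, ← hw]; exact sdiff_union_of_subset h4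
    exact ⟨w, mem_filter.2 ⟨mem_univ _, (mem_sdiff.1 hw').2, e ▸ h1⟩, e⟩

lemma CombDH.deg (H : CombDH K SE SV v0) {e : Finset V} (he : e ∈ K) (hc : e.card = 2) :
    ((K.filter fun T => T.card = 3).filter fun T => e ⊆ T).card = 2 + if e ∈ SE then 1 else 0 := by
  obtain ⟨u, v, huv, rfl⟩ := card_eq_two.1 hc
  rw [tri_deg huv]
  split_ifs with h
  · exact H.deg3 u v huv h
  · exact H.deg2 u v huv he h

lemma CombDH.three_f2 (H : CombDH K SE SV v0) :
    3 * fnum K 2 = 2 * fnum K 1 + SE.card := by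
  have h := sum_card_bipartiteAbove_eq_sum_card_bipartiteBelow (s := K.filter fun e => e.card = 2)
    (t := K.filter fun T => T.card = 3) (fun e T => e ⊆ T)
  have h1 : ∑ e ∈ K.filter (fun e => e.card = 2),
      (bipartiteAbove (fun e T : Finset V => e ⊆ T) (K.filter fun T => T.card = 3) e).card =
      2 * fnum K 1 + SE.card := by
    have : ∀ e ∈ K.filter (fun e => e.card = 2),
      (bipartiteAbove (fun e T : Finset V => e ⊆ T) (K.filter fun T => T.card = 3) e).card =
        2 + if e ∈ SE then 1 else 0 := by
      intro e he
      exact H.deg (mem_filter.1 he).1 (mem_filter.1 he).2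
    rw [sum_congr rfl this, sum_add_distrib, sum_const, smul_eq_mul, mul_comm, sum_boole]
    have h2 : (K.filter (fun e => e.card = 2)).filter (fun e => e ∈ SE) = SE := by
      ext e
      rw [mem_filter, mem_filter]
      exact ⟨fun h => h.2, fun h => ⟨H.SE_K e h, h⟩⟩
    rw [h2]; rfl
  have h2 : ∑ T ∈ K.filter (fun e => e.card = 3),
      (bipartiteBelow (fun e T : Finset V => e ⊆ T) (K.filter fun T => T.card = 2) T).card =
      3 * fnum K 2 := by
    have : ∀ T ∈ K.filter (fun e => e.card = 3),
      (bipartiteBelow (fun e T : Finset V => e ⊆ T) (K.filter fun T => T.card = 2) T).card = 3 := by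
      intro T hT
      obtain ⟨hTK, hTc⟩ := mem_filter.1 hT
      have : bipartiteBelow (fun e T : Finset V => e ⊆ T) (K.filter fun T => T.card = 2) T =
          T.powersetCard 2 := by
        ext e
        rw [mem_bipartiteBelow, mem_filter, mem_powersetCard]
        constructor
        · rintro ⟨⟨a, b⟩, c⟩; exact ⟨c, b⟩
        · rintro ⟨a, b⟩
          refine ⟨⟨H.cplx.2 T hTK e a ?_, b⟩, a⟩
          rintro rfl; simp at b
      rw [this, card_powersetCard, hTc]; rfl
    rw [sum_congr rfl this, sum_const, smul_eq_mul, mul_comm]; rfl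
  rw [← h1, ← h2]; exact h.symm

lemma CombDH.SE_card (H : CombDH K SE SV v0) : SE.card = SV.card := by
  have h := sum_card_bipartiteAbove_eq_sum_card_bipartiteBelow (s := SV)
    (t := SE) (fun v e => v ∈ e)
  have h1 : ∀ v ∈ SV, (bipartiteAbove (fun (v : V) e => v ∈ e) SE v).card = 2 := by
    intro v hv
    rw [← H.two v hv]
    symm
    refine Finset.card_bij (fun x _ => {v, x}) ?_ ?_ ?_
    · intro x hx
      obtain ⟨-, h1, h2⟩ := mem_filter.1 hx
      exact (mem_bipartiteAbove _).2 ⟨h2, by simp⟩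
    · intro x hx y hy e
      obtain ⟨-, h1, h2⟩ := mem_filter.1 hx
      have : x ∈ ({v, y} : Finset V) := by rw [← e]; simp
      simp only [mem_insert, mem_singleton] at this
      exact this.resolve_left h1
    · intro e he
      obtain ⟨h1, h2⟩ := (mem_bipartiteAbove _).1 he
      have hc := (H.SE_K e h1).2
      have h7 : (e.erase v).card = 1 := by rw [card_erase_of_mem h2, hc]
      obtain ⟨w, hw⟩ := card_eq_one.1 h7
      have hw' : w ∈ e.erase v := by rw [hw]; simp
      have e1 : {v, w} = e := by rw [← insert_erase h2, hw]
      exact ⟨w, mem_filter.2 ⟨mem_univ _, (mem_erase.1 hw').1, e1 ▸ h1⟩, e1⟩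
  have h2 : ∀ e ∈ SE, (bipartiteBelow (fun (v : V) e => v ∈ e) SV e).card = 2 := by
    intro e he
    have hc := (H.SE_K e he).2
    rw [← hc]
    congr 1
    ext v
    rw [mem_bipartiteBelow]
    refine ⟨fun h => h.2, fun h => ⟨?_, h⟩⟩
    have h7 : (e.erase v).card = 1 := by rw [card_erase_of_mem h, hc]
    obtain ⟨w, hw⟩ := card_eq_one.1 h7
    have hw' : w ∈ e.erase v := by rw [hw]; simp
    have e1 : {v, w} = e := by rw [← insert_erase h, hw]
    exact H.closed v w (mem_erase.1 hw').1 (e1 ▸ he)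
  rw [sum_congr rfl h1, sum_congr rfl h2, sum_const, sum_const] at h
  simp only [smul_eq_mul] at h
  omega

lemma CombDH.edge_tri (H : CombDH K SE SV v0) {e : Finset V} (he : e ∈ K) (hc : e.card = 2) :
    ∃ T ∈ K, T.card = 3 ∧ e ⊆ T := by
  have h := H.deg he hc
  have : 0 < ((K.filter fun T => T.card = 3).filter fun T => e ⊆ T).card := by omega
  obtain ⟨T, hT⟩ := card_pos.1 this
  rw [mem_filter, mem_filter] at hT
  exact ⟨T, hT.1.1, hT.1.2, hT.2⟩

lemma CombDH.vert_tri (H : CombDH K SE SV v0) {v : V} (hv : {v} ∈ K) :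
    ∃ T ∈ K, T.card = 3 ∧ v ∈ T := by
  obtain ⟨x, hx, hxK⟩ := H.vert_edge v hv
  obtain ⟨T, h1, h2, h3⟩ := H.edge_tri hxK (card_pair hx.symm)
  exact ⟨T, h1, h2, h3 (by simp)⟩

lemma CombDH.const (H : CombDH K SE SV v0) {α : Type} [DecidableEq α] (f : V → α)
    (hf : ∀ u v, u ≠ v → ({u, v} : Finset V) ∈ K → f u = f v) (v : V) (hv : {v} ∈ K) :
    f v = f v0 := by
  have htri : ∀ T ∈ K, T.card = 3 → ∀ u ∈ T, ∀ w ∈ T, f u = f w := by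
    intro T hT _ u hu w hw
    by_cases h : u = w
    · rw [h]
    · exact hf u w h (H.cplx.2 T hT _ (by simp [insert_subset_iff, hu, hw]) (by simp))
  obtain ⟨T0, h1, h2, h3⟩ := H.vert_tri (H.SV_K v0 H.v0_mem)
  obtain ⟨T, g1, g2, g3⟩ := H.vert_tri hv
  have := H.conn (univ.filter fun T => ∀ w ∈ T, f w = f v0)
    ⟨T0, mem_filter.2 ⟨mem_univ _, fun w hw => htri T0 h1 h2 w hw v0 h3⟩, h1, h2⟩ ?_ T g1 g2
  · exact (mem_filter.1 this).2 v g3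
  · intro e T T' hc _ hT hTc hT' hTc' heT heT' hTD
    obtain ⟨x, hx⟩ : e.Nonempty := card_pos.1 (by omega)
    refine mem_filter.2 ⟨mem_univ _, fun w hw => ?_⟩
    rw [htri T' hT' hTc' w hw x (heT' hx)]
    exact (mem_filter.1 hTD).2 x (heT hx)

omit [DecidableEq V] [Fintype V] in
lemma euler_lin {A B C : Type} [Fintype A] [Fintype B] [Fintype C] [DecidableEq A] [DecidableEq B]
    [DecidableEq C] (N : Matrix A B (ZMod 2)) (M : Matrix B C (ZMod 2)) (hNM : N * M = 0)
    (hM : ∀ x : C → ZMod 2, (∀ e, ∑ T, M e T * x T = 0) → x = 0)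
    (hN : ∀ x : A → ZMod 2, (∀ e, ∑ v, N v e * x v = 0) → ∃ c, ∀ v, x v = c) :
    Fintype.card A + Fintype.card C ≤ Fintype.card B + 1 := by
  have hrM : M.rank = Fintype.card C := by
    rw [Matrix.rank, LinearMap.finrank_range_of_inj, Module.finrank_fintype_fun_eq_card]
    rw [← LinearMap.ker_eq_bot, LinearMap.ker_eq_bot']
    intro x hx
    exact hM x fun e => congrFun hx e
  have hrN : Fintype.card A ≤ N.rank + 1 := by
    rw [← Matrix.rank_transpose]
    have h1 := LinearMap.finrank_range_add_finrank_ker (N.transpose.mulVecLin)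
    rw [Module.finrank_fintype_fun_eq_card] at h1
    have h2 : LinearMap.ker N.transpose.mulVecLin ≤ Submodule.span (ZMod 2) {fun _ => 1} := by
      intro x hx
      rw [LinearMap.mem_ker] at hx
      obtain ⟨c, hc⟩ := hN x fun e => congrFun hx e
      rw [Submodule.mem_span_singleton]
      exact ⟨c, funext fun v => by rw [hc]; simp⟩
    have h3 := Submodule.finrank_mono h2
    have h4 := finrank_span_le_card (R := ZMod 2) ({fun _ => 1} : Set (A → ZMod 2))
    simp only [Set.toFinset_singleton, card_singleton] at h4
    unfold Matrix.rank
    omega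
  have := Matrix.rank_add_rank_le_card_of_mul_eq_zero hNM
  omega

lemma CombDH.euler (H : CombDH K SE SV v0) : fnum K 0 + fnum K 2 ≤ fnum K 1 + 1 := by
  obtain ⟨M, hM⟩ : ∃ M : Matrix (K.filter fun e => e.card = 2) (K.filter fun e => e.card = 3) (ZMod 2),
    ∀ e T, M e T = if e.1 ⊆ T.1 then 1 else 0 := ⟨Matrix.of fun e T => _, fun _ _ => rfl⟩
  obtain ⟨N, hN⟩ : ∃ N : Matrix {v : V // {v} ∈ K} (K.filter fun e => e.card = 2) (ZMod 2),
    ∀ v e, N v e = if v.1 ∈ e.1 then 1 else 0 := ⟨Matrix.of fun e T => _, fun _ _ => rfl⟩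
  have hV : Fintype.card {v : V // {v} ∈ K} = fnum K 0 := by
    unfold fnum
    rw [Fintype.card_subtype]
    refine Finset.card_bij (fun v _ => {v}) ?_ ?_ ?_
    · intro v hv
      exact mem_filter.2 ⟨(mem_filter.1 hv).2, by simp⟩
    · intro v _ w _ h
      exact singleton_injective h
    · intro e he
      obtain ⟨v, rfl⟩ := card_eq_one.1 (mem_filter.1 he).2
      exact ⟨v, mem_filter.2 ⟨mem_univ _, (mem_filter.1 he).1⟩, rfl⟩
  have hE : Fintype.card (K.filter fun e => e.card = 2) = fnum K 1 := Fintype.card_coe _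
  have hT : Fintype.card (K.filter fun e => e.card = 3) = fnum K 2 := Fintype.card_coe _
  rw [← hV, ← hE, ← hT]
  refine euler_lin N M ?_ ?_ ?_
  · ext v T
    obtain ⟨T, hT⟩ := T
    obtain ⟨hTK, hTc⟩ := mem_filter.1 hT
    rw [Matrix.mul_apply, Matrix.zero_apply]
    have e1 : ∀ e, N v e * M e ⟨T, hT⟩ = if v.1 ∈ e.1 ∧ e.1 ⊆ T then 1 else 0 := by
      intro e
      simp only [hN, hM, ite_and, mul_ite, mul_one, mul_zero]
      split_ifs <;> rfl
    rw [sum_congr rfl fun e _ => e1 e]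
    rw [sum_coe_sort (K.filter fun e => e.card = 2)
      (fun e => if v.1 ∈ e ∧ e ⊆ T then (1 : ZMod 2) else 0), sum_boole]
    have e2 : (K.filter fun e => e.card = 2).filter (fun e => v.1 ∈ e ∧ e ⊆ T) =
        (T.powersetCard 2).filter (fun e => v.1 ∈ e) := by
      ext e
      simp only [mem_filter, mem_powersetCard]
      constructor
      · rintro ⟨⟨a, b⟩, c, d⟩; exact ⟨⟨d, b⟩, c⟩
      · rintro ⟨⟨a, b⟩, c⟩
        refine ⟨⟨H.cplx.2 T hTK e a ?_, b⟩, c, a⟩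
        rintro rfl; simp at b
    rw [e2]
    by_cases hv : v.1 ∈ T
    · obtain ⟨a, b, hab, hTe⟩ : ∃ a b, a ≠ b ∧ T.erase v.1 = {a, b} :=
        card_eq_two.1 (by rw [card_erase_of_mem hv, hTc])
      have ha : a ∈ T.erase v.1 := by rw [hTe]; simp
      have hb : b ∈ T.erase v.1 := by rw [hTe]; simp
      obtain ⟨ha1, ha2⟩ := mem_erase.1 ha
      obtain ⟨hb1, hb2⟩ := mem_erase.1 hb
      have e3 : (T.powersetCard 2).filter (fun e => v.1 ∈ e) = {{v.1, a}, {v.1, b}} := by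
        ext e
        simp only [mem_filter, mem_powersetCard, mem_insert, mem_singleton]
        constructor
        · rintro ⟨⟨h1, h2⟩, h3⟩
          have h7 : (e.erase v.1).card = 1 := by rw [card_erase_of_mem h3, h2]
          obtain ⟨w, hw⟩ := card_eq_one.1 h7
          have hw' : w ∈ T.erase v.1 := by
            apply erase_subset_erase _ h1; rw [hw]; simp
          rw [← insert_erase h3, hw]
          rw [hTe, mem_insert, mem_singleton] at hw'
          rcases hw' with rfl | rfl
          · left; rfl
          · right; rfl
        · rintro (rfl | rfl)
          · exact ⟨⟨by simp [insert_subset_iff, hv, ha2], card_pair (Ne.symm ha1)⟩, by simp⟩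
          · exact ⟨⟨by simp [insert_subset_iff, hv, hb2], card_pair (Ne.symm hb1)⟩, by simp⟩
      rw [e3, card_pair]
      · rfl
      · intro h
        have : a ∈ ({v.1, b} : Finset V) := by rw [← h]; simp
        simp only [mem_insert, mem_singleton] at this
        rcases this with h | h
        · exact ha1 h
        · exact hab h
    · have e3 : (T.powersetCard 2).filter (fun e => v.1 ∈ e) = ∅ := by
        refine filter_eq_empty_iff.2 ?_
        intro e he h
        exact hv ((mem_powersetCard.1 he).1 h)
      rw [e3]; simp
  · intro x hx
    have hx' : ∀ e ∈ K, e.card = 2 →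
        ∑ T : (K.filter fun e => e.card = 3), (if e ⊆ T.1 then x T else 0) = 0 := by
      intro e he hc
      have := hx ⟨e, mem_filter.2 ⟨he, hc⟩⟩
      simp only [hM, ite_mul, one_mul, zero_mul] at this
      exact this
    let X : Finset V → ZMod 2 := fun T => if h : T ∈ K.filter (fun e => e.card = 3) then x ⟨T, h⟩ else 0
    have hX : ∀ T, x T = X T.1 := by
      intro T; simp only [X]; rw [dif_pos T.2]
    have hx2 : ∀ e ∈ K, e.card = 2 →
        ∑ T ∈ (K.filter fun e => e.card = 3).filter (fun T => e ⊆ T), X T = 0 := by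
      intro e he hc
      rw [← hx' e he hc, sum_filter]
      rw [← sum_coe_sort (K.filter fun e => e.card = 3)]
      refine sum_congr rfl fun T _ => ?_
      rw [hX]
    have hz : ∀ a : ZMod 2, a ≠ 1 → a = 0 := by decide
    by_contra hne
    have hex : ∃ T, x T = 1 := by
      by_contra! h
      exact hne (funext fun T => hz _ (h T))
    obtain ⟨T1, hT1⟩ := hex
    have hall := H.conn (univ.filter fun T => X T = 1) ⟨T1.1, mem_filter.2 ⟨mem_univ _, by rw [← hX, hT1]⟩,
      (mem_filter.1 T1.2).1, (mem_filter.1 T1.2).2⟩ ?_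
    · obtain ⟨b, 𝒯, hb, hbS, -⟩ := H.sector
      obtain ⟨h1, h2⟩ := H.SE_K _ hbS
      have h4 := hx2 _ h1 h2
      rw [sum_congr rfl (g := fun _ => 1)] at h4
      · rw [sum_const, H.deg h1 h2, if_pos hbS] at h4
        exact absurd h4 (by decide)
      · intro T hT
        rw [mem_filter, mem_filter] at hT
        exact (mem_filter.1 (hall T hT.1.1 hT.1.2)).2
    · intro e T T' hc hS hT hTc hT' hTc' heT heT' hTD
      refine mem_filter.2 ⟨mem_univ _, ?_⟩
      have hT1 := (mem_filter.1 hTD).2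
      by_cases hTT : T = T'
      · rw [← hTT]; exact hT1
      · have heK : e ∈ K := H.cplx.2 T hT e heT (by rintro rfl; simp at hc)
        have hd := H.deg heK hc
        rw [if_neg hS] at hd
        have h4 := hx2 e heK hc
        have : {T, T'} = (K.filter fun e => e.card = 3).filter (fun T => e ⊆ T) := by
          refine eq_of_subset_of_card_le ?_ (by rw [hd, card_pair hTT])
          intro a ha
          rw [mem_insert, mem_singleton] at ha
          rw [mem_filter, mem_filter]
          rcases ha with rfl | rfl
          · exact ⟨⟨hT, hTc⟩, heT⟩
          · exact ⟨⟨hT', hTc'⟩, heT'⟩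
        rw [← this, sum_pair hTT, hT1] at h4
        have hh : ∀ a : ZMod 2, 1 + a = 0 → a = 1 := by decide
        exact hh _ h4
  · intro x hx
    let X : V → ZMod 2 := fun v => if h : {v} ∈ K then x ⟨v, h⟩ else 0
    have hX : ∀ v, x v = X v.1 := by
      intro v; simp only [X]; rw [dif_pos v.2]
    have hc : ∀ u v, u ≠ v → ({u, v} : Finset V) ∈ K → X u = X v := by
      intro u v huv hK'
      have hu : {u} ∈ K := H.cplx.2 _ hK' _ (by simp) (by simp)
      have hv : {v} ∈ K := H.cplx.2 _ hK' _ (by simp) (by simp)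
      have := hx ⟨{u, v}, mem_filter.2 ⟨hK', card_pair huv⟩⟩
      simp only [hN, ite_mul, one_mul, zero_mul] at this
      rw [← sum_filter] at this
      have e : (univ.filter fun w : {v : V // {v} ∈ K} => w.1 ∈ ({u, v} : Finset V)) = {⟨u, hu⟩, ⟨v, hv⟩} := by
        ext w
        simp only [mem_filter, mem_univ, true_and, mem_insert, mem_singleton]
        rw [Subtype.ext_iff, Subtype.ext_iff]
      rw [e, sum_pair (fun h => huv (congrArg Subtype.val h)), hX, hX] at this
      have hh : ∀ a b : ZMod 2, a + b = 0 → a = b := by decide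
      exact hh _ _ this
    exact ⟨X v0, fun v => by rw [hX, H.const X hc v.1 v.2]⟩

lemma CombDH.f1_ge (H : CombDH K SE SV v0) :
    (singVerts K).card + 3 * fnum K 0 ≤ fnum K 1 + 3 := by
  have h1 := H.three_f2
  have h2 := H.SE_card
  have h3 := H.euler
  have h4 := card_le_card H.sing
  omega

end ii1

lemma link_eight (N : V → Finset V) (c : V → Bool) (P : V → V → Prop) (a b : V) (hab : a ≠ b)
    (hsym : ∀ w x, x ∈ N w → w ∈ N x) (hc : ∀ w x, x ∈ N w → c x ≠ c w)
    (hd : ∀ w x, x ∈ N w → 2 ≤ (N w).card) (hb : (N b).card = 3)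
    (hPs : ∀ w x, P w x → P x w) (hPN : ∀ w x, P w x → x ∈ N w)
    (hPb : ∀ w x, P w x → w ≠ b)
    (hcl : ∀ w x x', w ≠ a → w ≠ b → P w x → x' ∈ N w → P w x')
    (hP : ∃ w x, P w x) :
    ∃ L : Finset V, 8 ≤ L.card ∧ ∀ z ∈ L, ∃ t, t ∈ N z := by
  have hbool : ∀ p q r : Bool, p ≠ q → q ≠ r → p = r := by decide
  -- a second neighbour
  have hsec : ∀ w x, x ∈ N w → ∃ x' ∈ N w, x' ≠ x := fun w x h =>
    exists_mem_ne (by have := hd w x h; omega) x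
  obtain ⟨w, x, hwx, hwa⟩ : ∃ w x, P w x ∧ w ≠ a := by
    obtain ⟨w, x, h⟩ := hP
    by_cases hwa : w = a
    · refine ⟨x, w, hPs _ _ h, fun hx => ?_⟩
      exact hc _ _ (hPN _ _ h) (by rw [hwa, hx])
    · exact ⟨w, x, h, hwa⟩
  have hwb := hPb _ _ hwx
  obtain ⟨x', hx'N, hx'⟩ := hsec w x (hPN _ _ hwx)
  have hwx' := hcl w x x' hwa hwb hwx hx'N
  obtain ⟨y, hya, hwy⟩ : ∃ y, y ≠ a ∧ P w y := by
    by_cases h : x = a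
    · exact ⟨x', fun h' => hx' (h'.trans h.symm), hwx'⟩
    · exact ⟨x, h, hwx⟩
  have hyw := hPs _ _ hwy
  obtain ⟨w', hw'N, hw'⟩ := hsec y w (hPN _ _ hyw)
  have hyw' := hcl y w w' hya (hPb _ _ hyw) hyw hw'N
  have hcw : c w' = c w := hbool _ _ _ (hc _ _ hw'N) (hc _ _ (hPN _ _ hwy))
  have hcx := hc _ _ (hPN _ _ hwx)
  have hcx' := hc _ _ hx'N
  set M : Finset V := {w, w', x, x'} with hM
  have hMc : M.card = 4 := by
    rw [hM, card_insert_of_notMem, card_insert_of_notMem, card_pair hx'.symm]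
    · simp only [mem_insert, mem_singleton, not_or]
      exact ⟨fun h => hcx (h ▸ hcw), fun h => hcx' (h ▸ hcw)⟩
    · simp only [mem_insert, mem_singleton, not_or]
      exact ⟨hw'.symm, fun h => hcx (h ▸ rfl), fun h => hcx' (h ▸ rfl)⟩
  have hMP : ∀ z ∈ M, ∃ t, P z t := by
    intro z hz
    simp only [hM, mem_insert, mem_singleton] at hz
    rcases hz with rfl | rfl | rfl | rfl
    · exact ⟨_, hwx⟩
    · exact ⟨_, hPs _ _ hyw'⟩
    · exact ⟨_, hPs _ _ hwx⟩
    · exact ⟨_, hPs _ _ hwx'⟩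
  -- the vertices around b
  obtain ⟨d, hdN, hda⟩ : ∃ d ∈ N b, d ≠ a := exists_mem_ne (by omega) a
  have hdb : b ∈ N d := hsym _ _ hdN
  obtain ⟨e, heN, heb⟩ := hsec d b hdb
  have hdne : d ≠ b := fun h => hc _ _ hdN (by rw [h])
  have hce : c e = c b := hbool _ _ _ (hc _ _ heN) (hc _ _ hdN)
  set M' : Finset V := insert b (insert e (N b)) with hM'
  have hM'c : M'.card = 5 := by
    rw [hM', card_insert_of_notMem, card_insert_of_notMem, hb]
    · exact fun h => hc _ _ h hce
    · rw [mem_insert, not_or]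
      exact ⟨heb.symm, fun h => hc _ _ h rfl⟩
  have hint : M ∩ M' ⊆ {a} := by
    intro z hz
    rw [mem_inter] at hz
    obtain ⟨t, ht⟩ := hMP z hz.1
    have hzb := hPb _ _ ht
    have h2 := hz.2
    rw [hM', mem_insert, mem_insert] at h2
    rw [mem_singleton]
    by_contra hza
    rcases h2 with h | h | h
    · exact hzb h
    · subst h
      have h1 := hcl z t d hza hzb ht (hsym _ _ heN)
      exact hPb _ _ (hPs _ _ (hcl d z b hda hdne (hPs _ _ h1) hdb)) rfl
    · exact hPb _ _ (hPs _ _ (hcl z t b hza hzb ht (hsym _ _ h))) rfl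
  refine ⟨M ∪ M', ?_, ?_⟩
  · have h1 := card_union_add_card_inter M M'
    have h2 := card_le_card hint
    rw [card_singleton] at h2
    omega
  · intro z hz
    rw [mem_union] at hz
    rcases hz with hz | hz
    · obtain ⟨t, ht⟩ := hMP z hz
      exact ⟨t, hPN _ _ ht⟩
    · rw [hM', mem_insert, mem_insert] at hz
      rcases hz with rfl | rfl | h
      · exact ⟨d, hdN⟩
      · exact ⟨d, hsym _ _ heN⟩
      · exact ⟨b, hsym _ _ h⟩

section ii2
variable [Fintype V] {K SE : Finset (Finset V)} {SV : Finset V} {v0 : V}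

omit [Fintype V] in
lemma fnum_zero (hK : IsCplx K) : fnum K 0 = (verts K).card := by
  unfold fnum
  symm
  refine Finset.card_bij (fun v _ => {v}) ?_ ?_ ?_
  · intro v hv
    obtain ⟨G, hG, hvG⟩ := mem_verts.1 hv
    exact mem_filter.2 ⟨hK.2 G hG _ (by simpa using hvG) (by simp), by simp⟩
  · intro v _ w _ h
    exact singleton_injective h
  · intro e he
    obtain ⟨v, rfl⟩ := card_eq_one.1 (mem_filter.1 he).2
    exact ⟨v, mem_verts.2 ⟨_, (mem_filter.1 he).1, by simp⟩, rfl⟩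

lemma CombDH.deg_ge (H : CombDH K SE SV v0) {u v : V} (huv : u ≠ v) (he : {u, v} ∈ K) :
    2 ≤ (univ.filter fun w => w ∉ ({u, v} : Finset V) ∧ insert w ({u, v} : Finset V) ∈ K).card := by
  by_cases h : {u, v} ∈ SE
  · rw [H.deg3 u v huv h]; norm_num
  · rw [H.deg2 u v huv he h]

lemma CombDH.ten (H : CombDH K SE SV v0) (κ : V → Fin 3) (hκ : ProperColoring 2 K κ) :
    10 ≤ (verts K).card := by
  obtain ⟨b, 𝒯, hbv, hbS, hne, hT, hTcl⟩ := H.sector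
  have htwo := H.two v0 H.v0_mem
  obtain ⟨a, haN, hab⟩ := exists_mem_ne
    (s := univ.filter fun x => x ≠ v0 ∧ ({v0, x} : Finset V) ∈ SE) (by omega) b
  obtain ⟨-, hav, haS⟩ := mem_filter.1 haN
  have hall : ∀ x, x ≠ v0 → {v0, x} ∈ SE → x = a ∨ x = b := by
    intro x hx hxS
    have : {a, b} = univ.filter fun x => x ≠ v0 ∧ ({v0, x} : Finset V) ∈ SE := by
      refine eq_of_subset_of_card_le ?_ (by rw [htwo, card_pair hab])
      intro z hz
      rw [mem_insert, mem_singleton] at hz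
      rcases hz with rfl | rfl
      · exact haN
      · exact mem_filter.2 ⟨mem_univ _, hbv, hbS⟩
    have h2 : x ∈ ({a, b} : Finset V) := by
      rw [this]; exact mem_filter.2 ⟨mem_univ _, hx, hxS⟩
    simpa using h2
  have hinj : ∀ F ∈ K, ∀ u ∈ F, ∀ v ∈ F, u ≠ v → κ u ≠ κ v := by
    intro F hF u hu v hv huv h
    exact huv (hκ F hF (mem_coe.2 hu) (mem_coe.2 hv) h)
  let N : V → Finset V := fun w => univ.filter fun x =>
    w ≠ v0 ∧ x ∉ ({v0, w} : Finset V) ∧ insert x ({v0, w} : Finset V) ∈ K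
  have hN : ∀ {w x}, x ∈ N w ↔ w ≠ v0 ∧ x ∉ ({v0, w} : Finset V) ∧
      insert x ({v0, w} : Finset V) ∈ K := by
    intro w x; simp [N]
  have hNe : ∀ {w}, w ≠ v0 → N w = univ.filter fun x =>
      x ∉ ({v0, w} : Finset V) ∧ insert x ({v0, w} : Finset V) ∈ K := by
    intro w hw; ext x; simp [N, hw]
  have hins : ∀ w x : V, insert x ({v0, w} : Finset V) = insert w ({v0, x} : Finset V) := by
    intro w x; ext z; simp only [mem_insert, mem_singleton]; tauto
  have hsym : ∀ w x, x ∈ N w → w ∈ N x := by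
    intro w x h
    obtain ⟨h1, h2, h3⟩ := hN.1 h
    simp only [mem_insert, mem_singleton, not_or] at h2
    refine hN.2 ⟨h2.1, ?_, hins w x ▸ h3⟩
    simp only [mem_insert, mem_singleton, not_or]
    exact ⟨h1, Ne.symm h2.2⟩
  have hcol : ∀ w x, x ∈ N w → κ w ≠ κ v0 ∧ κ x ≠ κ v0 ∧ κ x ≠ κ w := by
    intro w x h
    obtain ⟨h1, h2, h3⟩ := hN.1 h
    simp only [mem_insert, mem_singleton, not_or] at h2
    exact ⟨hinj _ h3 w (by simp) v0 (by simp) h1, hinj _ h3 x (by simp) v0 (by simp) h2.1,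
      hinj _ h3 x (by simp) w (by simp) h2.2⟩
  have hcardT : ∀ w x, x ∈ N w → (insert x ({v0, w} : Finset V)).card = 3 := by
    intro w x h
    obtain ⟨h1, h2, h3⟩ := hN.1 h
    rw [card_insert_of_notMem h2, card_pair h1.symm]
  have hlink := link_eight N (fun v => decide (κ v = κ v0 + 1))
    (fun w x => x ∈ N w ∧ insert x ({v0, w} : Finset V) ∈ 𝒯) a b hab hsym ?_ ?_ ?_ ?_ ?_ ?_ ?_ ?_
  · obtain ⟨L, hL, hLN⟩ := hlink
    obtain ⟨w, hw⟩ : L.Nonempty := card_pos.1 (by omega)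
    obtain ⟨x, hx⟩ := hLN w hw
    obtain ⟨h1, h2, h3⟩ := hN.1 hx
    obtain ⟨c1, c2, c3⟩ := hcol w x hx
    have hwx : w ≠ x := fun h => c3 (by rw [h])
    have hwxK : ({w, x} : Finset V) ∈ K := H.cplx.2 _ h3 _ (by
      simp [insert_subset_iff]) (by simp)
    obtain ⟨v', hv', hne'⟩ := exists_mem_ne (lt_of_lt_of_le one_lt_two (H.deg_ge hwx hwxK)) v0
    obtain ⟨-, h4, h5⟩ := mem_filter.1 hv'
    simp only [mem_insert, mem_singleton, not_or] at h4
    have c4 := hinj _ h5 v' (by simp) w (by simp) h4.1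
    have c5 := hinj _ h5 v' (by simp) x (by simp) h4.2
    have hfin : ∀ p q r s : Fin 3, q ≠ p → r ≠ p → r ≠ q → s ≠ q → s ≠ r → s = p := by decide
    have c6 : κ v' = κ v0 := hfin _ _ _ _ c1 c2 c3 c4 c5
    have hLc : ∀ z ∈ L, κ z ≠ κ v0 := by
      intro z hz
      obtain ⟨t, ht⟩ := hLN z hz
      exact (hcol z t ht).1
    have hsub : insert v0 (insert v' L) ⊆ verts K := by
      intro z hz
      rw [mem_insert, mem_insert] at hz
      rcases hz with rfl | rfl | hz
      · exact mem_verts.2 ⟨_, h3, by simp⟩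
      · exact mem_verts.2 ⟨_, h5, by simp⟩
      · obtain ⟨t, ht⟩ := hLN z hz
        exact mem_verts.2 ⟨_, (hN.1 ht).2.2, by simp⟩
    have := card_le_card hsub
    rw [card_insert_of_notMem, card_insert_of_notMem] at this
    · omega
    · exact fun h => hLc _ h c6
    · rw [mem_insert, not_or]
      exact ⟨hne'.symm, fun h => hLc _ h rfl⟩
  · intro w x h
    obtain ⟨c1, c2, c3⟩ := hcol w x h
    have : ∀ p q r : Fin 3, q ≠ p → r ≠ p → r ≠ q → decide (r = p + 1) ≠ decide (q = p + 1) := by decide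
    exact this _ _ _ c1 c2 c3
  · intro w x h
    obtain ⟨h1, h2, h3⟩ := hN.1 h
    rw [hNe h1]
    exact H.deg_ge h1.symm (H.cplx.2 _ h3 _ (subset_insert _ _) (by simp))
  · rw [hNe hbv]
    exact H.deg3 v0 b hbv.symm hbS
  · rintro w x ⟨h1, h2⟩
    exact ⟨hsym _ _ h1, hins w x ▸ h2⟩
  · rintro w x ⟨h1, h2⟩
    exact h1
  · rintro w x ⟨h1, h2⟩ rfl
    exact (hT _ h2).2.2.2 (by simp)
  · rintro w x x' hwa hwb ⟨h1, h2⟩ hx'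
    obtain ⟨g1, g2, g3⟩ := hN.1 hx'
    refine ⟨hx', hTcl w _ _ g1 (fun h => ?_) h2 g3 (hcardT w x' hx') (by simp) (by simp) (by simp)⟩
    rcases hall w g1 h with h | h
    · exact hwa h
    · exact hwb h
  · obtain ⟨T, hTT⟩ := hne
    obtain ⟨hTK, hTc, hTv, hTb⟩ := hT T hTT
    obtain ⟨w, x, hwx, e⟩ : ∃ w x, w ≠ x ∧ T.erase v0 = {w, x} :=
      card_eq_two.1 (by rw [card_erase_of_mem hTv, hTc])
    have hw : w ∈ T.erase v0 := by rw [e]; simp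
    have hx : x ∈ T.erase v0 := by rw [e]; simp
    have e' : insert x ({v0, w} : Finset V) = T := by
      rw [← insert_erase hTv, e]; ext z; simp only [mem_insert, mem_singleton]; tauto
    refine ⟨w, x, hN.2 ⟨(mem_erase.1 hw).1, ?_, e' ▸ hTK⟩, e' ▸ hTT⟩
    simp only [mem_insert, mem_singleton, not_or]
    exact ⟨(mem_erase.1 hx).1, hwx.symm⟩

omit [Fintype V] in
lemma bichrom_le (X : Finset V) (κ : V → Fin 3) (hX : X.card = 10) :
    ((X.powersetCard 2).filter fun e => (e.image κ).card = 2).card ≤ 33 := by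
  let A : Fin 3 → Finset V := fun i => X.filter fun v => κ v = i
  have hA : (A 0).card + (A 1).card + (A 2).card = 10 := by
    have h := card_eq_sum_card_fiberwise (s := X) (f := κ) (t := univ) (fun _ _ => mem_coe.2 (mem_univ _))
    rw [Fin.sum_univ_three, hX] at h
    exact h.symm
  let f : V × V → Finset V := fun p => {p.1, p.2}
  have hsub : (X.powersetCard 2).filter (fun e => (e.image κ).card = 2) ⊆
      ((A 0 ×ˢ A 1).image f ∪ (A 0 ×ˢ A 2).image f) ∪ (A 1 ×ˢ A 2).image f := by
    intro e he
    rw [mem_filter, mem_powersetCard] at he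
    obtain ⟨⟨heX, hec⟩, hi⟩ := he
    obtain ⟨u, v, huv, rfl⟩ := card_eq_two.1 hec
    have hu : u ∈ X := heX (by simp)
    have hv : v ∈ X := heX (by simp)
    have hne : κ u ≠ κ v := by
      intro h
      rw [image_insert, image_singleton, h] at hi
      simp at hi
    have hmem : ∀ i j, ∀ u v, u ∈ X → v ∈ X → κ u = i → κ v = j → ({u, v} : Finset V) ∈ (A i ×ˢ A j).image f := by
      intro i j u v hu hv h1 h2
      refine mem_image.2 ⟨(u, v), mem_product.2 ⟨mem_filter.2 ⟨hu, h1⟩, mem_filter.2 ⟨hv, h2⟩⟩, rfl⟩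
    have hf : ∀ p q : Fin 3, p ≠ q → (p = 0 ∧ q = 1) ∨ (p = 0 ∧ q = 2) ∨ (p = 1 ∧ q = 2) ∨
      (q = 0 ∧ p = 1) ∨ (q = 0 ∧ p = 2) ∨ (q = 1 ∧ p = 2) := by decide
    rw [mem_union, mem_union]
    rcases hf _ _ hne with h | h | h | h | h | h
    · exact Or.inl (Or.inl (hmem _ _ u v hu hv h.1 h.2))
    · exact Or.inl (Or.inr (hmem _ _ u v hu hv h.1 h.2))
    · exact Or.inr (hmem _ _ u v hu hv h.1 h.2)
    · rw [pair_comm]; exact Or.inl (Or.inl (hmem _ _ v u hv hu h.1 h.2))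
    · rw [pair_comm]; exact Or.inl (Or.inr (hmem _ _ v u hv hu h.1 h.2))
    · rw [pair_comm]; exact Or.inr (hmem _ _ v u hv hu h.1 h.2)
  have h1 : ∀ i j, ((A i ×ˢ A j).image f).card ≤ (A i).card * (A j).card := fun i j =>
    card_image_le.trans (card_product _ _).le
  have h2 := (card_le_card hsub).trans ((card_union_le _ _).trans (Nat.add_le_add_right (card_union_le _ _) _))
  have h3 := h1 0 1
  have h4 := h1 0 2
  have h5 := h1 1 2
  have h6 : (A 0).card * (A 1).card + (A 0).card * (A 2).card + (A 1).card * (A 2).card ≤ 33 := by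
    generalize (A 0).card = p at *
    generalize (A 1).card = q at *
    generalize (A 2).card = r at *
    have : 3 * (p * q + p * r + q * r) ≤ 100 := by
      have h : (p + q + r) ^ 2 = 100 := by rw [hA]; norm_num
      zify at h ⊢
      nlinarith [sq_nonneg ((p : ℤ) - q), sq_nonneg ((p : ℤ) - r), sq_nonneg ((q : ℤ) - r)]
    omega
  omega

omit [Fintype V] in
lemma f1_add_m (κ : V → Fin 3) (hκ : ProperColoring 2 K κ) :
    fnum K 1 + (((verts K).powersetCard 2).filter fun e => (e.image κ).card = 2 ∧ e ∉ K).card =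
    (((verts K).powersetCard 2).filter fun e => (e.image κ).card = 2).card := by
  rw [← card_filter_add_card_filter_not (s := ((verts K).powersetCard 2).filter
    fun e => (e.image κ).card = 2) (fun e => e ∈ K), filter_filter, filter_filter]
  congr 1
  unfold fnum
  congr 1
  ext e
  rw [mem_filter, mem_filter, mem_powersetCard]
  constructor
  · rintro ⟨h1, h2⟩
    refine ⟨⟨fun v hv => mem_verts.2 ⟨e, h1, hv⟩, h2⟩, ?_, h1⟩
    rw [card_image_of_injOn (hκ e h1), h2]
  · rintro ⟨⟨h1, h2⟩, h3, h4⟩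
    exact ⟨h4, h2⟩

end ii2

/-- Every balanced triangulation `Δ` of the dunce hat has `f₀ ≥ 10`; moreover, if
`f₀^sing + m ≥ 7`, where `m` is the number of bichromatic missing edges, then
`f₀ ≥ 11`. -/
theorem stmt8 {V : Type} [DecidableEq V] [Fintype V] (K : Finset (Finset V))
    (hdh : IsDunceHatTri K) (κ : V → Fin 3) (hκ : ProperColoring 2 K κ)
    (m : ℕ) (hm : m = (((verts K).powersetCard 2).filter fun e => (e.image κ).card = 2 ∧ e ∉ K).card) :
    10 ≤ fnum K 0 ∧ (7 ≤ (singVerts K).card + m → 11 ≤ fnum K 0) := by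
  have h3 : ∀ F ∈ K, F.card ≤ 3 := by
    intro F hF
    rw [← card_image_of_injOn (hκ F hF)]
    exact (card_le_univ _).trans (by simp)
  obtain ⟨SE, SV, v0, H⟩ := exists_CombDH hdh h3
  have h10 := H.ten κ hκ
  have h0 := fnum_zero (K := K) hdh.1
  refine ⟨by omega, fun h7 => ?_⟩
  by_contra hlt
  have hX : (verts K).card = 10 := by omega
  have h1 := bichrom_le (verts K) κ hX
  have h2 := f1_add_m (K := K) κ hκ
  have h4 := H.f1_ge
  omega
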